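/- Let S ⊂ ℙ(V) be a reduced irreducible ruled surface of degree d ≥ 3 which is not a cone, and let C̃ ⊂ Gr(2,V) be the set of points of Gr corresponding to the lines contained in S. Then C̃ is Zariski closed and is the union of a single irreducible curve C of degree d (not contained in any plane σ₂(p₀)) together with a finite, possibly empty, set of points. Moreover, through a general point of S there passes exactly one line of S. -/

import Mathlib

namespace RQS

open MvPolynomial


open MvPolynomial

variable (K : Type) [Field K]

/-- Projective n-space modelled as the projectivization of `Fin n → K`
(so `PP K (n+1)` is ℙⁿ). -/
abbrev PP (n : ℕ) : Type := Projectivization K (Fin n → K)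

variable {K}

/-- Vanishing of a (homogeneous) polynomial at a projective point. -/
def vanishes {n : ℕ} (p : MvPolynomial (Fin n) K) (x : PP K n) : Prop :=
  ∀ (v : Fin n → K) (h : v ≠ 0), Projectivization.mk K v h = x → eval v p = 0

/-- Projective zero locus of a set of polynomials. -/
def zeroLocus {n : ℕ} (S : Set (MvPolynomial (Fin n) K)) : Set (PP K n) :=
  {x | ∀ p ∈ S, vanishes p x}

/-- Zariski closed subsets of projective space. -/
def ZClosed {n : ℕ} (X : Set (PP K n)) : Prop :=
  ∃ S : Set (MvPolynomial (Fin n) K), (∀ p ∈ S, ∃ d, p.IsHomogeneous d) ∧ X = zeroLocus S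

/-- Irreducibility with respect to the Zariski topology. -/
def ZIrred {n : ℕ} (X : Set (PP K n)) : Prop :=
  X.Nonempty ∧ ∀ A B : Set (PP K n), ZClosed A → ZClosed B → X ⊆ A ∪ B → X ⊆ A ∨ X ⊆ B

/-- `X` contains a chain of closed irreducible subsets of length `d+1`. -/
def dimGE {n : ℕ} (X : Set (PP K n)) (d : ℕ) : Prop :=
  ∃ f : Fin (d + 1) → Set (PP K n),
    (∀ i, ZClosed (f i) ∧ ZIrred (f i) ∧ f i ⊆ X) ∧ StrictMono f

/-- `X` has (Krull) dimension exactly `d`. -/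
def HasDim {n : ℕ} (X : Set (PP K n)) (d : ℕ) : Prop := dimGE X d ∧ ¬ dimGE X (d + 1)

/-- The hyperplane with coefficient vector `φ`. -/
def hyp {n : ℕ} (φ : Fin n → K) : Set (PP K n) :=
  {x | ∀ (v : Fin n → K) (h : v ≠ 0), Projectivization.mk K v h = x → ∑ i, φ i * v i = 0}

/-- Degree of a (reduced) curve: every hyperplane not containing it meets it in at most `d`
points, and some hyperplane meets it in exactly `d` points. -/
def HasCurveDeg {n : ℕ} (X : Set (PP K n)) (d : ℕ) : Prop :=
  (∀ φ : Fin n → K, φ ≠ 0 → ¬ X ⊆ hyp φ →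
    (X ∩ hyp φ).Finite ∧ (X ∩ hyp φ).ncard ≤ d) ∧
  (∃ φ : Fin n → K, φ ≠ 0 ∧ ¬ X ⊆ hyp φ ∧ (X ∩ hyp φ).ncard = d)

/-- An irreducible projective curve of degree `d`. -/
def IsCurveOfDeg {n : ℕ} (X : Set (PP K n)) (d : ℕ) : Prop :=
  ZClosed X ∧ ZIrred X ∧ HasDim X 1 ∧ HasCurveDeg X d

/-- A property holds at a general point of `S`. -/
def GenericPts {n : ℕ} (S : Set (PP K n)) (Q : PP K n → Prop) : Prop :=
  ∃ T : Set (PP K n), ZClosed T ∧ ¬ S ⊆ T ∧ ∀ p ∈ S, p ∉ T → Q p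

/-! ### Plücker coordinates: `p₁₂,p₁₃,p₁₄,p₂₃,p₂₄,p₃₄` indexed by `0,…,5` -/

/-- Plücker coordinates of the line through `u` and `v`, i.e. the bivector `u ∧ v`. -/
def plucker (u v : Fin 4 → K) : Fin 6 → K :=
  ![u 0 * v 1 - u 1 * v 0, u 0 * v 2 - u 2 * v 0, u 0 * v 3 - u 3 * v 0,
    u 1 * v 2 - u 2 * v 1, u 1 * v 3 - u 3 * v 1, u 2 * v 3 - u 3 * v 2]

/-- The Plücker quadric `p₁₂p₃₄ - p₁₃p₂₄ + p₁₄p₂₃`, i.e. `½ w ∧ w`. -/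
def plQuad (w : Fin 6 → K) : K := w 0 * w 5 - w 1 * w 4 + w 2 * w 3

/-- The wedge pairing `w ∧ z ∈ Λ⁴V ≅ K` of two bivectors. -/
def plPair (w z : Fin 6 → K) : K :=
  w 0 * z 5 + w 5 * z 0 - w 1 * z 4 - w 4 * z 1 + w 2 * z 3 + w 3 * z 2

/-- The wedge `w ∧ v ∈ Λ³V ≅ V*` of a bivector `w` with a vector `v`;
`w ∧ v = 0` expresses that the point `v̄` lies on the line `w̄`. -/
def wedgePt (w : Fin 6 → K) (v : Fin 4 → K) : Fin 4 → K :=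
  ![w 0 * v 2 - w 1 * v 1 + w 3 * v 0,
    w 0 * v 3 - w 2 * v 1 + w 4 * v 0,
    w 1 * v 3 - w 2 * v 2 + w 5 * v 0,
    w 3 * v 3 - w 4 * v 2 + w 5 * v 1]

/-- The set of points of ℙ³ on the line with Plücker vector `w`. -/
def lineOfRep (w : Fin 6 → K) : Set (PP K 4) :=
  {p | ∀ (v : Fin 4 → K) (h : v ≠ 0), Projectivization.mk K v h = p → wedgePt w v = 0}

/-- `w` represents a line of ℙ³: it is nonzero and decomposable. -/
def IsLineRep (w : Fin 6 → K) : Prop := w ≠ 0 ∧ plQuad w = 0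

variable (K) in
/-- The Grassmannian `Gr(2,4) ⊂ ℙ⁵` of lines in ℙ³. -/
def grass : Set (PP K 6) :=
  {x | ∃ (w : Fin 6 → K) (h : w ≠ 0), Projectivization.mk K w h = x ∧ plQuad w = 0}

/-- The line in ℙ³ corresponding to a point `x` of the Grassmannian. -/
def lineOf (x : PP K 6) : Set (PP K 4) :=
  {p | ∀ (w : Fin 6 → K) (h : w ≠ 0), Projectivization.mk K w h = x → p ∈ lineOfRep w}

/-- The set of (Grassmann points of) lines contained in a surface `S ⊂ ℙ³`. -/
def linesOf (S : Set (PP K 4)) : Set (PP K 6) :=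
  {x | x ∈ grass K ∧ lineOf x ⊆ S}

/-- A ruled surface: an irreducible closed surface which is a union of lines. -/
def IsRuled (S : Set (PP K 4)) : Prop :=
  ZClosed S ∧ ZIrred S ∧ HasDim S 2 ∧ ∀ p ∈ S, ∃ x ∈ linesOf S, p ∈ lineOf x

/-- Degree of a surface in ℙ³ via intersections with lines. -/
def HasSurfDeg (S : Set (PP K 4)) (d : ℕ) : Prop :=
  (∀ w : Fin 6 → K, IsLineRep w → ¬ lineOfRep w ⊆ S →
    (S ∩ lineOfRep w).Finite ∧ (S ∩ lineOfRep w).ncard ≤ d) ∧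
  (∃ w : Fin 6 → K, IsLineRep w ∧ ¬ lineOfRep w ⊆ S ∧ (S ∩ lineOfRep w).ncard = d)

/-- A cone: all lines of `S` pass through a common point. -/
def IsCone (S : Set (PP K 4)) : Prop :=
  ∃ p : PP K 4, ∀ x ∈ linesOf S, p ∈ lineOf x

/-- `σ₂(p₀)`: the 2-plane in the Grassmannian of all lines through `p₀`. -/
def sigma2 (p₀ : PP K 4) : Set (PP K 6) := {x | x ∈ grass K ∧ p₀ ∈ lineOf x}

/-- The projective tangent space `T_{Gr,x₀}` of the Plücker quadric at `x₀`,
namely the hyperplane `{z̄ : w₀ ∧ z = 0}`. -/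
def tangentGr (x₀ : PP K 6) : Set (PP K 6) :=
  {x | ∀ (w : Fin 6 → K) (h : w ≠ 0), Projectivization.mk K w h = x →
    ∀ (w₀ : Fin 6 → K) (h₀ : w₀ ≠ 0), Projectivization.mk K w₀ h₀ = x₀ → plPair w₀ w = 0}

/-- The linear span of (the representatives of) a subset of projective space. -/
def spanOfSet {n : ℕ} (X : Set (PP K n)) : Submodule K (Fin n → K) :=
  Submodule.span K {v | ∃ h : v ≠ 0, Projectivization.mk K v h ∈ X}

/-- The projective subspace associated to a linear subspace. -/
def projSub {n : ℕ} (U : Submodule K (Fin n → K)) : Set (PP K n) :=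
  {x | ∀ (v : Fin n → K) (h : v ≠ 0), Projectivization.mk K v h = x → v ∈ U}

/-- `P(C)`: the smallest projective subspace containing `C`. -/
def projSpanOf {n : ℕ} (X : Set (PP K n)) : Set (PP K n) := projSub (spanOfSet X)

/-! ### Smoothness via Jacobian criteria -/

/-- The homogeneous polynomials vanishing on `X`. -/
def homIdeal {n : ℕ} (X : Set (PP K n)) : Set (MvPolynomial (Fin n) K) :=
  {p | (∃ d, p.IsHomogeneous d) ∧ ∀ x ∈ X, vanishes p x}

/-- The span of the gradients at `v` of all homogeneous polynomials vanishing on `X`. -/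
def gradSpan {n : ℕ} (X : Set (PP K n)) (v : Fin n → K) : Submodule K (Fin n → K) :=
  Submodule.span K
    {g | ∃ p ∈ homIdeal X, g = fun i => eval v (pderiv i p)}

/-- Smooth point of a projective *curve* `X ⊂ ℙ(Kⁿ)` (Jacobian criterion:
the affine cone over `X` has a 2-dimensional tangent space there). -/
def CurveSmoothPt {n : ℕ} (X : Set (PP K n)) (x : PP K n) : Prop :=
  ∀ (v : Fin n → K) (h : v ≠ 0), Projectivization.mk K v h = x →
    Module.finrank K (gradSpan X v) = n - 2

/-- Smooth point of a *surface* `S ⊂ ℙ³` (Jacobian criterion). -/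
def SurfSmoothPt (S : Set (PP K 4)) (x : PP K 4) : Prop :=
  ∀ (v : Fin 4 → K) (h : v ≠ 0), Projectivization.mk K v h = x →
    Module.finrank K (gradSpan S v) = 1

/-- The singular locus of a surface `S ⊂ ℙ³`. -/
def singLocus (S : Set (PP K 4)) : Set (PP K 4) := {x ∈ S | ¬ SurfSmoothPt S x}

/-! ### The Zariski topology on projective space -/

/-- The affine cone over a set of projective points, without the origin. -/
def cone {n : ℕ} (X : Set (PP K n)) : Set (Fin n → K) :=
  {v | ∃ h : v ≠ 0, Projectivization.mk K v h ∈ X}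

theorem mem_cone_smul {n : ℕ} {X : Set (PP K n)} {v : Fin n → K} (hv : v ∈ cone X) {a : K}
    (ha : a ≠ 0) : a • v ∈ cone X := by
  obtain ⟨h, hX⟩ := hv
  refine ⟨smul_ne_zero ha h, ?_⟩
  rwa [(Projectivization.mk_eq_mk_iff' K _ _ _ h).2 ⟨a, rfl⟩]

theorem rep_mem_cone {n : ℕ} {X : Set (PP K n)} {x : PP K n} : x.rep ∈ cone X ↔ x ∈ X := by
  constructor
  · rintro ⟨h, hX⟩
    rwa [Projectivization.mk_rep] at hX
  · intro h
    exact ⟨x.rep_nonzero, by rwa [Projectivization.mk_rep]⟩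

theorem eval_smul_of_isHomogeneous {σ : Type} {p : MvPolynomial σ K} {d : ℕ}
    (hp : p.IsHomogeneous d) (a : K) (v : σ → K) : eval (a • v) p = a ^ d * eval v p := by
  simp only [eval_eq, Finset.mul_sum]
  refine Finset.sum_congr rfl fun m hm => ?_
  have : m.degree = d := by
    by_contra hne
    exact (mem_support_iff.1 hm) (hp.coeff_eq_zero hne)
  simp only [Pi.smul_apply, smul_eq_mul, mul_pow, Finset.prod_mul_distrib,
    Finset.prod_pow_eq_pow_sum]
  rw [show ∑ i ∈ m.support, m i = d from this]
  ring

theorem vanishes_mk_iff {n : ℕ} {p : MvPolynomial (Fin n) K} {d : ℕ} (hp : p.IsHomogeneous d)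
    {v : Fin n → K} (hv : v ≠ 0) : vanishes p (Projectivization.mk K v hv) ↔ eval v p = 0 := by
  constructor
  · intro h
    exact h v hv rfl
  · intro h w hw hwv
    obtain ⟨a, rfl⟩ := (Projectivization.mk_eq_mk_iff' K _ _ hw hv).1 hwv
    rw [eval_smul_of_isHomogeneous hp, h, mul_zero]

theorem ZClosed.exists_homogeneous {n : ℕ} {X : Set (PP K n)} (hX : ZClosed X) :
    ∃ s : Set (MvPolynomial (Fin n) K), (∀ p ∈ s, ∃ d, p.IsHomogeneous d) ∧
      ∀ (v : Fin n → K) (h : v ≠ 0), Projectivization.mk K v h ∈ X ↔ ∀ p ∈ s, eval v p = 0 := by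
  obtain ⟨s, hs, rfl⟩ := hX
  refine ⟨s, hs, fun v h => forall₂_congr fun p hp => ?_⟩
  obtain ⟨d, hd⟩ := hs p hp
  exact vanishes_mk_iff hd h

theorem eval_eq_sum_components {σ : Type} (p : MvPolynomial σ K) (v : σ → K) :
    eval v p = ∑ i ∈ Finset.range (p.totalDegree + 1), eval v (homogeneousComponent i p) := by
  conv_lhs => rw [← sum_homogeneousComponent p]
  rw [map_sum]

/-- A polynomial vanishing on all nonzero multiples of `v` has all its homogeneous components
vanishing at `v`. -/
theorem eval_homogeneousComponent_eq_zero [Infinite K] {σ : Type} {p : MvPolynomial σ K}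
    {v : σ → K} (h : ∀ a : K, a ≠ 0 → eval (a • v) p = 0) (k : ℕ) :
    eval v (homogeneousComponent k p) = 0 := by
  let q : Polynomial K := ∑ i ∈ Finset.range (p.totalDegree + 1),
    Polynomial.monomial i (eval v (homogeneousComponent i p))
  have hq : q = 0 := by
    apply Polynomial.eq_zero_of_infinite_isRoot
    refine Set.Infinite.mono ?_ (Set.finite_singleton (0 : K)).infinite_compl
    intro a ha
    have := h a ha
    rw [eval_eq_sum_components] at this
    simp only [Set.mem_ofPred_eq, Polynomial.IsRoot.def, q, Polynomial.eval_finsetSum,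
      Polynomial.eval_monomial]
    rw [← this]
    refine Finset.sum_congr rfl fun i _ => ?_
    rw [eval_smul_of_isHomogeneous (homogeneousComponent_isHomogeneous i p), mul_comm]
  by_cases hk : p.totalDegree < k
  · rw [homogeneousComponent_eq_zero _ _ hk, map_zero]
  · have := congrArg (fun r => Polynomial.coeff r k) hq
    simpa [q, Polynomial.finsetSum_coeff, Polynomial.coeff_monomial, Nat.lt_succ_iff, not_lt.1 hk]
      using this

theorem zClosed_of_eval [Infinite K] {n : ℕ} {X : Set (PP K n)} (s : Set (MvPolynomial (Fin n) K))
    (hs : ∀ (v : Fin n → K) (h : v ≠ 0), Projectivization.mk K v h ∈ X ↔ ∀ p ∈ s, eval v p = 0) :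
    ZClosed X := by
  refine ⟨{q | ∃ p ∈ s, ∃ k, q = homogeneousComponent k p}, ?_, ?_⟩
  · rintro _ ⟨p, -, k, rfl⟩
    exact ⟨k, homogeneousComponent_isHomogeneous k p⟩
  · ext x
    induction x using Projectivization.ind with | h v hv => ?_
    constructor
    · rintro hX _ ⟨p, hp, k, rfl⟩
      rw [vanishes_mk_iff (homogeneousComponent_isHomogeneous k p)]
      refine eval_homogeneousComponent_eq_zero (fun a ha => ?_) k
      obtain ⟨h', hX'⟩ := mem_cone_smul ⟨hv, hX⟩ ha
      exact (hs _ h').1 hX' p hp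
    · intro h
      rw [hs]
      intro p hp
      rw [eval_eq_sum_components]
      refine Finset.sum_eq_zero fun k _ => ?_
      exact (vanishes_mk_iff (homogeneousComponent_isHomogeneous k p) hv).1 (h _ ⟨p, hp, k, rfl⟩)

theorem ZClosed.mk_mem_iff {n : ℕ} {X : Set (PP K n)} (hX : ZClosed X) (v : Fin n → K)
    (hv : v ≠ 0) : Projectivization.mk K v hv ∈ X ↔
      ∀ p ∈ vanishingIdeal K (cone X), eval v p = 0 := by
  constructor
  · intro h p hp
    simpa using hp v ⟨hv, h⟩
  · intro h
    obtain ⟨s, -, hs⟩ := hX.exists_homogeneous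
    rw [hs]
    refine fun p hp => h p ?_
    rintro w ⟨hw, hwX⟩
    simpa using (hs w hw).1 hwX p hp

theorem homogeneousComponent_mem_vanishingIdeal_cone [Infinite K] {n : ℕ} {X : Set (PP K n)}
    {p : MvPolynomial (Fin n) K} (hp : p ∈ vanishingIdeal K (cone X)) (k : ℕ) :
    homogeneousComponent k p ∈ vanishingIdeal K (cone X) := by
  intro v hv
  have := eval_homogeneousComponent_eq_zero (p := p) (v := v)
    (fun a ha => by simpa using hp _ (mem_cone_smul hv ha)) k
  simpa using this

theorem zClosed_empty [Infinite K] {n : ℕ} : ZClosed (∅ : Set (PP K n)) :=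
  zClosed_of_eval {1} (by simp)

theorem zClosed_iInter [Infinite K] {n : ℕ} {ι : Sort*} {X : ι → Set (PP K n)}
    (h : ∀ i, ZClosed (X i)) : ZClosed (⋂ i, X i) := by
  choose s hs using fun i => (h i).exists_homogeneous
  refine zClosed_of_eval (⋃ i, s i) fun v hv => ?_
  simp only [Set.mem_iInter, (hs _).2 v hv, Set.mem_iUnion]
  exact ⟨fun h p ⟨i, hi⟩ => h i p hi, fun h i p hi => h p ⟨i, hi⟩⟩

theorem ZClosed.inter [Infinite K] {n : ℕ} {X Y : Set (PP K n)} (hX : ZClosed X)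
    (hY : ZClosed Y) : ZClosed (X ∩ Y) := by
  rw [Set.inter_eq_iInter]
  exact zClosed_iInter (Bool.rec hY hX)

theorem ZClosed.union [Infinite K] {n : ℕ} {X Y : Set (PP K n)} (hX : ZClosed X)
    (hY : ZClosed Y) : ZClosed (X ∪ Y) := by
  obtain ⟨s, -, hs⟩ := hX.exists_homogeneous
  obtain ⟨t, -, ht⟩ := hY.exists_homogeneous
  refine zClosed_of_eval {r | ∃ p ∈ s, ∃ q ∈ t, r = p * q} fun v hv => ?_
  rw [Set.mem_union, hs, ht]
  constructor
  · rintro (h | h) _ ⟨p, hp, q, hq, rfl⟩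
    · simp [h p hp]
    · simp [h q hq]
  · intro h
    by_contra! hc
    obtain ⟨⟨p, hp, hp'⟩, q, hq, hq'⟩ := hc
    have := h _ ⟨p, hp, q, hq, rfl⟩
    simp [hp', hq'] at this

theorem Set.Finite.zClosed_biUnion [Infinite K] {n : ℕ} {ι : Type*} {s : Set ι} (hs : s.Finite)
    {X : ι → Set (PP K n)} (h : ∀ i ∈ s, ZClosed (X i)) : ZClosed (⋃ i ∈ s, X i) := by
  induction s, hs using Set.Finite.induction_on with
  | empty => simpa using zClosed_empty
  | insert _ _ ih =>
    rw [Set.biUnion_insert]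
    exact (h _ (Set.mem_insert _ _)).union (ih fun i hi => h i (Set.mem_insert_of_mem _ hi))

theorem zClosed_singleton [Infinite K] {n : ℕ} (x : PP K n) : ZClosed ({x} : Set (PP K n)) := by
  refine zClosed_of_eval {p | ∃ i j, p = C (x.rep i) * X j - C (x.rep j) * X i} fun v hv => ?_
  constructor
  · rintro h _ ⟨i, j, rfl⟩
    rw [Set.mem_singleton_iff] at h
    have h' := h
    rw [← x.mk_rep, Projectivization.mk_eq_mk_iff'] at h'
    obtain ⟨a, rfl⟩ := h'
    simp only [map_sub, map_mul, eval_C, eval_X, Pi.smul_apply, smul_eq_mul]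
    ring
  · intro h
    obtain ⟨i, hi⟩ := Function.ne_iff.1 x.rep_nonzero
    rw [Set.mem_singleton_iff, ← x.mk_rep, Projectivization.mk_eq_mk_iff']
    refine ⟨v i / x.rep i, funext fun j => ?_⟩
    have := h _ ⟨i, j, rfl⟩
    simp only [map_sub, map_mul, eval_C, eval_X, sub_eq_zero] at this
    have hi' : x.rep i ≠ 0 := hi
    simp only [Pi.smul_apply, smul_eq_mul]
    field_simp
    linear_combination -this

theorem mk_mem_hyp_iff {n : ℕ} {φ v : Fin n → K} (hv : v ≠ 0) :
    Projectivization.mk K v hv ∈ hyp φ ↔ ∑ i, φ i * v i = 0 := by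
  constructor
  · intro h
    exact h v hv rfl
  · intro h w hw hwv
    obtain ⟨a, rfl⟩ := (Projectivization.mk_eq_mk_iff' K _ _ hw hv).1 hwv
    simp only [Pi.smul_apply, smul_eq_mul, mul_left_comm _ a, ← Finset.mul_sum, h, mul_zero]

theorem zClosed_hyp [Infinite K] {n : ℕ} (φ : Fin n → K) : ZClosed (hyp φ) := by
  refine zClosed_of_eval {∑ i, C (φ i) * X i} fun v hv => ?_
  rw [mk_mem_hyp_iff]
  simp

/-- Noetherianity: a nonempty family of closed sets has a minimal element. -/
theorem exists_minimal_zClosed {n : ℕ} (P : Set (PP K n) → Prop)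
    (h : ∃ X, ZClosed X ∧ P X) :
    ∃ X, ZClosed X ∧ P X ∧ ∀ Y, ZClosed Y → Y ⊂ X → ¬ P Y := by
  let A : Set (Ideal (MvPolynomial (Fin n) K)) :=
    {I | ∃ X, ZClosed X ∧ P X ∧ I = vanishingIdeal K (cone X)}
  have hA : A.Nonempty := by
    obtain ⟨X, hX, hP⟩ := h
    exact ⟨_, X, hX, hP, rfl⟩
  obtain ⟨_, ⟨X, hX, hP, rfl⟩, hmax⟩ :=
    wellFounded_gt.has_min A hA
  refine ⟨X, hX, hP, fun Y hY hYX hPY => hmax _ ⟨Y, hY, hPY, rfl⟩ ?_⟩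
  refine lt_of_le_of_ne (vanishingIdeal_anti_mono fun v ⟨hv, hvY⟩ => ⟨hv, hYX.1 hvY⟩) fun heq => ?_
  refine hYX.2 fun x hx => ?_
  induction x using Projectivization.ind with | h v hv => ?_
  rw [hY.mk_mem_iff, ← heq, ← hX.mk_mem_iff]
  exact hx

/-- The Zariski closure. -/
def zClosure {n : ℕ} (B : Set (PP K n)) : Set (PP K n) :=
  ⋂ T : {T : Set (PP K n) // ZClosed T ∧ B ⊆ T}, T.1

theorem zClosed_zClosure [Infinite K] {n : ℕ} (B : Set (PP K n)) : ZClosed (zClosure B) :=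
  zClosed_iInter fun T => T.2.1

theorem subset_zClosure {n : ℕ} (B : Set (PP K n)) : B ⊆ zClosure B :=
  Set.subset_iInter fun T => T.2.2

theorem zClosure_subset {n : ℕ} {B T : Set (PP K n)} (hT : ZClosed T) (h : B ⊆ T) :
    zClosure B ⊆ T :=
  Set.iInter_subset (fun T : {T : Set (PP K n) // ZClosed T ∧ B ⊆ T} => T.1) ⟨T, hT, h⟩

/-! ### Irreducible sets -/

theorem zIrred_singleton {n : ℕ} (x : PP K n) : ZIrred ({x} : Set (PP K n)) :=
  ⟨Set.singleton_nonempty x, fun A B _ _ h => by simpa using h⟩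

theorem ZIrred.exists_subset_of_biUnion [Infinite K] {n : ℕ} {Z : Set (PP K n)} (hZ : ZIrred Z)
    {ι : Type*} {s : Set ι} (hs : s.Finite) {X : ι → Set (PP K n)} (h : ∀ i ∈ s, ZClosed (X i))
    (hsub : Z ⊆ ⋃ i ∈ s, X i) : ∃ i ∈ s, Z ⊆ X i := by
  induction s, hs using Set.Finite.induction_on with
  | empty =>
    obtain ⟨z, hz⟩ := hZ.1
    simpa using hsub hz
  | @insert a s _ hs ih =>
    rw [Set.biUnion_insert] at hsub
    have h' : ∀ i ∈ s, ZClosed (X i) := fun i hi => h i (Set.mem_insert_of_mem _ hi)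
    rcases hZ.2 _ _ (h _ (Set.mem_insert _ _)) (Set.Finite.zClosed_biUnion hs h') hsub with h1 | h1
    · exact ⟨a, Set.mem_insert _ _, h1⟩
    · obtain ⟨i, hi, hi'⟩ := ih h' h1
      exact ⟨i, Set.mem_insert_of_mem _ hi, hi'⟩

theorem ZIrred.subsingleton_of_finite [Infinite K] {n : ℕ} {Z : Set (PP K n)} (hZ : ZIrred Z)
    (h : Z.Finite) : ∃ z, Z = {z} := by
  obtain ⟨z, hz, hz'⟩ := hZ.exists_subset_of_biUnion h (X := fun x => {x})
    (fun x _ => zClosed_singleton x) (by simp)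
  exact ⟨z, Set.Subset.antisymm hz' (by simpa using hz)⟩

theorem ZClosed.exists_components [Infinite K] {n : ℕ} {X : Set (PP K n)} (hX : ZClosed X) :
    ∃ 𝒵 : Set (Set (PP K n)), 𝒵.Finite ∧ (∀ Z ∈ 𝒵, ZClosed Z ∧ ZIrred Z) ∧ X = ⋃ Z ∈ 𝒵, Z := by
  by_contra hcon
  obtain ⟨Y, hY, hYP, hmin⟩ := exists_minimal_zClosed (fun X : Set (PP K n) =>
    ¬ ∃ 𝒵 : Set (Set (PP K n)), 𝒵.Finite ∧ (∀ Z ∈ 𝒵, ZClosed Z ∧ ZIrred Z) ∧ X = ⋃ Z ∈ 𝒵, Z)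
    ⟨X, hX, hcon⟩
  simp only [not_not] at hmin
  apply hYP
  rcases Set.eq_empty_or_nonempty Y with rfl | hne
  · exact ⟨∅, Set.finite_empty, by simp, by simp⟩
  by_cases hirr : ZIrred Y
  · exact ⟨{Y}, Set.finite_singleton _, by simpa using ⟨hY, hirr⟩, by simp⟩
  simp only [ZIrred, hne, true_and, not_forall, not_or] at hirr
  obtain ⟨A, B, hA, hB, hAB, hYA, hYB⟩ := hirr
  obtain ⟨𝒜, h𝒜, h𝒜', h𝒜''⟩ := hmin (Y ∩ A) (hY.inter hA)
    ⟨Set.inter_subset_left, fun h => hYA fun y hy => (h hy).2⟩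
  obtain ⟨ℬ, hℬ, hℬ', hℬ''⟩ := hmin (Y ∩ B) (hY.inter hB)
    ⟨Set.inter_subset_left, fun h => hYB fun y hy => (h hy).2⟩
  refine ⟨𝒜 ∪ ℬ, h𝒜.union hℬ, fun Z hZ => hZ.elim (h𝒜' Z) (hℬ' Z), ?_⟩
  rw [Set.biUnion_union, ← h𝒜'', ← hℬ'', ← Set.inter_union_distrib_left,
    Set.inter_eq_left.2 hAB]

/-- An infinite closed set all of whose proper closed subsets are finite. -/
def IsMinimalInfinite {n : ℕ} (Y : Set (PP K n)) : Prop :=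
  ZClosed Y ∧ Y.Infinite ∧ ∀ Z, ZClosed Z → Z ⊂ Y → Z.Finite

theorem ZClosed.exists_isMinimalInfinite {n : ℕ} {X : Set (PP K n)} (hX : ZClosed X)
    (h : X.Infinite) : ∃ Y ⊆ X, IsMinimalInfinite Y := by
  obtain ⟨Y, hY, ⟨hYX, hYi⟩, hmin⟩ :=
    exists_minimal_zClosed (fun Y => Y ⊆ X ∧ Y.Infinite) ⟨X, hX, subset_rfl, h⟩
  refine ⟨Y, hYX, hY, hYi, fun Z hZ hZY => ?_⟩
  by_contra hZi
  exact hmin Z hZ hZY ⟨hZY.1.trans hYX, hZi⟩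

theorem IsMinimalInfinite.subset_of_infinite [Infinite K] {n : ℕ} {Y A : Set (PP K n)}
    (hY : IsMinimalInfinite Y) (hA : ZClosed A) (h : (Y ∩ A).Infinite) : Y ⊆ A := by
  by_contra hYA
  exact h (hY.2.2 _ (hY.1.inter hA) ⟨Set.inter_subset_left, fun h => hYA fun y hy => (h hy).2⟩)

theorem IsMinimalInfinite.finite_inter [Infinite K] {n : ℕ} {Y A : Set (PP K n)}
    (hY : IsMinimalInfinite Y) (hA : ZClosed A) (h : ¬ Y ⊆ A) : (Y ∩ A).Finite := by
  by_contra hYA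
  exact h (hY.subset_of_infinite hA hYA)

theorem IsMinimalInfinite.zIrred [Infinite K] {n : ℕ} {Y : Set (PP K n)}
    (hY : IsMinimalInfinite Y) : ZIrred Y := by
  refine ⟨hY.2.1.nonempty, fun A B hA hB hAB => ?_⟩
  by_contra! hcon
  refine hY.2.1 (((hY.finite_inter hA hcon.1).union (hY.finite_inter hB hcon.2)).subset ?_)
  rw [← Set.inter_union_distrib_left]
  exact fun y hy => ⟨hy, hAB hy⟩

theorem IsMinimalInfinite.hasDim [Infinite K] {n : ℕ} {Y : Set (PP K n)}
    (hY : IsMinimalInfinite Y) : HasDim Y 1 := by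
  constructor
  · obtain ⟨y, hy⟩ := hY.2.1.nonempty
    refine ⟨![{y}, Y], ?_, ?_⟩
    · intro i
      fin_cases i
      · exact ⟨zClosed_singleton y, zIrred_singleton y, by simpa using hy⟩
      · exact ⟨hY.1, hY.zIrred, subset_rfl⟩
    · rw [Fin.strictMono_iff_lt_succ]
      intro i
      fin_cases i
      simp only [Fin.zero_eta, Fin.castSucc_zero, Fin.succ_zero_eq_one, Matrix.cons_val_zero,
        Matrix.cons_val_one]
      refine ⟨by simpa using hy, fun h => hY.2.1 ((Set.finite_singleton y).subset h)⟩
  · rintro ⟨f, hf, hmono⟩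
    have h12 : f 1 ⊂ f 2 := hmono (by decide)
    have h01 : f 0 ⊂ f 1 := hmono (by decide)
    have hfin := hY.2.2 _ (hf 1).1 (h12.trans_subset (hf 2).2.2)
    obtain ⟨z, hz⟩ := (hf 1).2.1.subsingleton_of_finite hfin
    obtain ⟨w, hw⟩ := (hf 0).2.1.1
    rw [hz] at h01
    obtain rfl : w = z := by simpa using h01.1 hw
    exact h01.2 (by simpa using hw)

/-- In a set of dimension at most two, a proper closed irreducible subset of an irreducible closed
set is a union of a curve-like set or a point. -/
theorem finite_of_ssubset_of_not_dimGE [Infinite K] {n : ℕ} {S Z A : Set (PP K n)}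
    (hS : ZClosed S) (hSi : ZIrred S) (hdim : ¬ dimGE S 3) (hZ : ZClosed Z) (hZi : ZIrred Z)
    (hZS : Z ⊂ S) (hA : ZClosed A) (hAZ : A ⊂ Z) : A.Finite := by
  obtain ⟨𝒵, hfin, h𝒵, rfl⟩ := hA.exists_components
  refine hfin.biUnion fun Y hY => ?_
  have hYZ : Y ⊂ Z := (Set.subset_biUnion_of_mem (u := fun Y => Y) hY).trans_ssubset hAZ
  obtain ⟨hYc, hYi⟩ := h𝒵 Y hY
  obtain ⟨y, hy⟩ := hYi.1
  by_contra hinf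
  refine hdim ⟨![{y}, Y, Z, S], ?_, ?_⟩
  · intro i
    fin_cases i
    · exact ⟨zClosed_singleton y, zIrred_singleton y, by simpa using hZS.1 (hYZ.1 hy)⟩
    · exact ⟨hYc, hYi, hYZ.1.trans hZS.1⟩
    · exact ⟨hZ, hZi, hZS.1⟩
    · exact ⟨hS, hSi, subset_rfl⟩
  · rw [Fin.strictMono_iff_lt_succ]
    intro i
    fin_cases i
    · exact ⟨by simpa using hy, fun h => hinf ((Set.finite_singleton y).subset h)⟩
    · exact hYZ
    · exact hZS

/-! ### Lines in projective three-space -/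

/-- The contraction of a bivector with a covector; these are the points of the line `w`. -/
def contr (w : Fin 6 → K) (φ : Fin 4 → K) : Fin 4 → K :=
  ![-(w 0 * φ 1) - w 1 * φ 2 - w 2 * φ 3, w 0 * φ 0 - w 3 * φ 2 - w 4 * φ 3,
    w 1 * φ 0 + w 3 * φ 1 - w 5 * φ 3, w 2 * φ 0 + w 4 * φ 1 + w 5 * φ 2]

theorem wedgePt_eq_zero_iff {w : Fin 6 → K} {v : Fin 4 → K} : wedgePt w v = 0 ↔
    w 0 * v 2 - w 1 * v 1 + w 3 * v 0 = 0 ∧ w 0 * v 3 - w 2 * v 1 + w 4 * v 0 = 0 ∧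
    w 1 * v 3 - w 2 * v 2 + w 5 * v 0 = 0 ∧ w 3 * v 3 - w 4 * v 2 + w 5 * v 1 = 0 := by
  simp [funext_iff, wedgePt, Fin.forall_fin_succ]

theorem wedgePt_smul_left (c : K) (w : Fin 6 → K) (v : Fin 4 → K) :
    wedgePt (c • w) v = c • wedgePt w v := by
  ext i; fin_cases i <;> simp [wedgePt] <;> ring

theorem wedgePt_smul_right (c : K) (w : Fin 6 → K) (v : Fin 4 → K) :
    wedgePt w (c • v) = c • wedgePt w v := by
  ext i; fin_cases i <;> simp [wedgePt] <;> ring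

theorem plQuad_smul (c : K) (w : Fin 6 → K) : plQuad (c • w) = c ^ 2 * plQuad w := by
  simp [plQuad]; ring

theorem plQuad_plucker (u v : Fin 4 → K) : plQuad (plucker u v) = 0 := by
  simp [plQuad, plucker]; ring

theorem plucker_comb (u v : Fin 4 → K) (a b c d : K) :
    plucker (a • u + b • v) (c • u + d • v) = (a * d - b * c) • plucker u v := by
  ext i; fin_cases i <;> simp [plucker] <;> ring

theorem wedgePt_plucker_comb (u v : Fin 4 → K) (a b : K) :
    wedgePt (plucker u v) (a • u + b • v) = 0 := by
  rw [wedgePt_eq_zero_iff]; simp [plucker]; refine ⟨?_, ?_, ?_, ?_⟩ <;> ring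

theorem contr_plucker (u v φ : Fin 4 → K) :
    contr (plucker u v) φ = (φ ⬝ᵥ u) • v + (-(φ ⬝ᵥ v)) • u := by
  ext i; fin_cases i <;> simp [plucker, contr, dotProduct, Fin.sum_univ_four] <;> ring

theorem wedgePt_contr {w : Fin 6 → K} (hw : plQuad w = 0) (φ : Fin 4 → K) :
    wedgePt w (contr w φ) = 0 := by
  rw [wedgePt_eq_zero_iff]
  simp only [contr, Matrix.cons_val]
  simp only [plQuad] at hw
  refine ⟨?_, ?_, ?_, ?_⟩
  · linear_combination (- φ 3) * hw
  · linear_combination (φ 2) * hw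
  · linear_combination (-φ 1) * hw
  · linear_combination (φ 0) * hw

theorem IsLineRep.exists_plucker {w : Fin 6 → K} (hw : IsLineRep w) :
    ∃ u v, w = plucker u v := by
  obtain ⟨h0, hq⟩ := hw
  have key : ∀ (i j : Fin 4) (k : Fin 6), (∀ l,
      plucker (contr w (Pi.single i 1)) (contr w (Pi.single j 1)) l = w k * w l) → w k ≠ 0 →
      ∃ u v, w = plucker u v := by
    intro i j k h hk
    refine ⟨(w k)⁻¹ • contr w (Pi.single i 1), contr w (Pi.single j 1), ?_⟩
    have := plucker_comb (contr w (Pi.single i 1)) (contr w (Pi.single j 1)) (w k)⁻¹ 0 0 1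
    simp only [zero_smul, add_zero, one_smul, zero_add, mul_one, mul_zero, sub_zero] at this
    rw [this]
    ext l
    rw [Pi.smul_apply, h l, smul_eq_mul, inv_mul_cancel_left₀ hk]
  simp only [plQuad] at hq
  obtain ⟨k, hk⟩ := Function.ne_iff.1 h0
  fin_cases k
  · refine key 0 1 0 (fun l => ?_) hk
    fin_cases l <;> simp [plucker, contr] <;> grind
  · refine key 0 2 1 (fun l => ?_) hk
    fin_cases l <;> simp [plucker, contr] <;> grind
  · refine key 0 3 2 (fun l => ?_) hk
    fin_cases l <;> simp [plucker, contr] <;> grind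
  · refine key 1 2 3 (fun l => ?_) hk
    fin_cases l <;> simp [plucker, contr] <;> grind
  · refine key 1 3 4 (fun l => ?_) hk
    fin_cases l <;> simp [plucker, contr] <;> grind
  · refine key 2 3 5 (fun l => ?_) hk
    fin_cases l <;> simp [plucker, contr] <;> grind

theorem exists_contr_of_wedgePt {w : Fin 6 → K} (h0 : w ≠ 0) {v : Fin 4 → K}
    (hv : wedgePt w v = 0) : ∃ φ, v = contr w φ := by
  rw [wedgePt_eq_zero_iff] at hv
  obtain ⟨h1, h2, h3, h4⟩ := hv
  obtain ⟨k, hk⟩ := Function.ne_iff.1 h0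
  fin_cases k
  · refine ⟨![v 1 / w 0, - v 0 / w 0, 0, 0], ?_⟩
    simp at hk
    ext l; fin_cases l <;> simp [contr] <;> field_simp <;> grind
  · refine ⟨![v 2 / w 1, 0, - v 0 / w 1, 0], ?_⟩
    simp at hk
    ext l; fin_cases l <;> simp [contr] <;> field_simp <;> grind
  · refine ⟨![v 3 / w 2, 0, 0, - v 0 / w 2], ?_⟩
    simp at hk
    ext l; fin_cases l <;> simp [contr] <;> field_simp <;> grind
  · refine ⟨![0, v 2 / w 3, - v 1 / w 3, 0], ?_⟩
    simp at hk
    ext l; fin_cases l <;> simp [contr] <;> field_simp <;> grind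
  · refine ⟨![0, v 3 / w 4, 0, - v 1 / w 4], ?_⟩
    simp at hk
    ext l; fin_cases l <;> simp [contr] <;> field_simp <;> grind
  · refine ⟨![0, 0, v 3 / w 5, - v 2 / w 5], ?_⟩
    simp at hk
    ext l; fin_cases l <;> simp [contr] <;> field_simp <;> grind

theorem wedgePt_plucker_iff {u v x : Fin 4 → K} (h : plucker u v ≠ 0) :
    wedgePt (plucker u v) x = 0 ↔ ∃ a b : K, x = a • u + b • v := by
  constructor
  · intro hx
    obtain ⟨φ, rfl⟩ := exists_contr_of_wedgePt h hx
    exact ⟨-(φ ⬝ᵥ v), φ ⬝ᵥ u, by rw [contr_plucker, add_comm]⟩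
  · rintro ⟨a, b, rfl⟩
    exact wedgePt_plucker_comb u v a b

theorem IsLineRep.exists_plucker_of_mem {w : Fin 6 → K} (hw : IsLineRep w) {x : Fin 4 → K}
    (hx : x ≠ 0) (hwx : wedgePt w x = 0) : ∃ y, w = plucker x y := by
  obtain ⟨u, v, rfl⟩ := hw.exists_plucker
  obtain ⟨a, b, rfl⟩ := (wedgePt_plucker_iff hw.1).1 hwx
  by_cases ha : a = 0
  · have hb : b ≠ 0 := by rintro rfl; simp [ha] at hx
    refine ⟨(-b⁻¹) • u + (0 : K) • v, ?_⟩
    rw [plucker_comb, ha]; simp [hb]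
  · refine ⟨(0 : K) • u + a⁻¹ • v, ?_⟩
    rw [plucker_comb]; simp [ha]

theorem IsLineRep.eq_smul_plucker {w : Fin 6 → K} (hw : IsLineRep w) {x y : Fin 4 → K}
    (hxy : plucker x y ≠ 0) (hwx : wedgePt w x = 0) (hwy : wedgePt w y = 0) :
    ∃ c : K, c ≠ 0 ∧ plucker x y = c • w := by
  have hx : x ≠ 0 := by
    rintro rfl; apply hxy; ext i; fin_cases i <;> simp [plucker]
  obtain ⟨z, rfl⟩ := hw.exists_plucker_of_mem hx hwx
  obtain ⟨a, b, rfl⟩ := (wedgePt_plucker_iff hw.1).1 hwy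
  have := plucker_comb x z 1 0 a b
  simp only [one_smul, zero_smul, add_zero, one_mul, zero_mul, sub_zero] at this
  refine ⟨b, ?_, this⟩
  rintro rfl
  apply hxy; rw [this, zero_smul]

theorem plucker_ne_zero {u v : Fin 4 → K} (hu : u ≠ 0) (h : ∀ c : K, v ≠ c • u) :
    plucker u v ≠ 0 := by
  intro h0
  obtain ⟨i, hi⟩ := Function.ne_iff.1 hu
  simp only [Pi.zero_apply] at hi
  apply h (v i / u i)
  have e := fun k => congrFun h0 k
  have e0 := e 0; have e1 := e 1; have e2 := e 2; have e3 := e 3; have e4 := e 4; have e5 := e 5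
  simp [plucker] at e0 e1 e2 e3 e4 e5
  ext j
  simp only [Pi.smul_apply, smul_eq_mul]
  field_simp
  fin_cases i <;> fin_cases j <;> simp <;> grind

theorem plucker_ne_zero_of_mk_ne {u v : Fin 4 → K} (hu : u ≠ 0) (hv : v ≠ 0)
    (h : Projectivization.mk K u hu ≠ Projectivization.mk K v hv) : plucker u v ≠ 0 := by
  refine plucker_ne_zero hu (fun c hc => h ?_)
  rw [Projectivization.mk_eq_mk_iff']
  have : c ≠ 0 := by rintro rfl; simp at hc; exact hv hc
  exact ⟨c⁻¹, by rw [hc, smul_smul, inv_mul_cancel₀ this, one_smul]⟩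

theorem plPair_plucker_plucker_left (x u v : Fin 4 → K) :
    plPair (plucker x u) (plucker x v) = 0 := by
  simp [plPair, plucker]; ring

theorem plPair_plucker_eq_det (a b c d : Fin 4 → K) :
    plPair (plucker a b) (plucker c d) = Matrix.det (Matrix.of ![a, b, c, d]) := by
  simp [plPair, plucker, Matrix.det_succ_row_zero, Fin.sum_univ_succ, Fin.succAbove]
  ring

theorem IsLineRep.plPair_eq_zero_iff {w z : Fin 6 → K} (hw : IsLineRep w) (hz : IsLineRep z) :
    plPair w z = 0 ↔ ∃ v ≠ 0, wedgePt w v = 0 ∧ wedgePt z v = 0 := by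
  constructor
  · intro h
    obtain ⟨a, b, rfl⟩ := hw.exists_plucker
    obtain ⟨c, d, rfl⟩ := hz.exists_plucker
    rw [plPair_plucker_eq_det] at h
    obtain ⟨t, ht, hM⟩ := Matrix.exists_vecMul_eq_zero_iff.2 h
    have hsum : (t 0 • a + t 1 • b) + (t 2 • c + t 3 • d) = 0 := by
      rw [← hM]
      ext i
      simp [Matrix.vecMul, dotProduct, Fin.sum_univ_four]
      ring
    have hindep : ∀ {u v : Fin 4 → K} {p q : K}, plucker u v ≠ 0 → p • u + q • v = 0 →
        p = 0 ∧ q = 0 := by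
      intro u v p q huv h
      constructor
      · have := plucker_comb u v p q 0 1
        rw [h] at this
        have h0 : plucker 0 ((0 : K) • u + (1 : K) • v) = 0 := by
          ext i; fin_cases i <;> simp [plucker]
        rw [h0] at this
        simpa [huv] using this.symm
      · have := plucker_comb u v 1 0 p q
        rw [h] at this
        have h0 : plucker ((1 : K) • u + (0 : K) • v) 0 = 0 := by
          ext i; fin_cases i <;> simp [plucker]
        rw [h0] at this
        simpa [huv] using this.symm
    refine ⟨t 0 • a + t 1 • b, ?_, wedgePt_plucker_comb _ _ _ _, ?_⟩
    · intro h0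
      obtain ⟨h1, h2⟩ := hindep hw.1 h0
      rw [h0, zero_add] at hsum
      obtain ⟨h3, h4⟩ := hindep hz.1 hsum
      apply ht
      ext i; fin_cases i <;> assumption
    · have : t 0 • a + t 1 • b = (-t 2) • c + (-t 3) • d := by
        rw [eq_neg_of_add_eq_zero_left hsum]; simp [add_comm]
      rw [this]; exact wedgePt_plucker_comb _ _ _ _
  · rintro ⟨v, hv, h1, h2⟩
    obtain ⟨y, rfl⟩ := hw.exists_plucker_of_mem hv h1
    obtain ⟨y', rfl⟩ := hz.exists_plucker_of_mem hv h2
    exact plPair_plucker_plucker_left _ _ _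

/-! #### Lines as points of the Grassmannian -/

theorem mk_mem_lineOfRep_iff {w : Fin 6 → K} {v : Fin 4 → K} (hv : v ≠ 0) :
    Projectivization.mk K v hv ∈ lineOfRep w ↔ wedgePt w v = 0 := by
  constructor
  · intro h; exact h v hv rfl
  · intro h u hu e
    obtain ⟨c, rfl⟩ := (Projectivization.mk_eq_mk_iff' K _ _ _ _).1 e
    rw [wedgePt_smul_right, h, smul_zero]

theorem lineOf_mk {w : Fin 6 → K} (hw : w ≠ 0) :
    lineOf (Projectivization.mk K w hw) = lineOfRep w := by
  ext p
  constructor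
  · intro h; exact h w hw rfl
  · intro h w' hw' e
    obtain ⟨c, rfl⟩ := (Projectivization.mk_eq_mk_iff' K _ _ _ _).1 e
    intro v hv hvp
    rw [wedgePt_smul_left, h v hv hvp, smul_zero]

theorem mk_mem_lineOf_mk_iff {w : Fin 6 → K} {v : Fin 4 → K} (hw : w ≠ 0) (hv : v ≠ 0) :
    Projectivization.mk K v hv ∈ lineOf (Projectivization.mk K w hw) ↔ wedgePt w v = 0 := by
  rw [lineOf_mk, mk_mem_lineOfRep_iff]

theorem mem_lineOf_iff {x : PP K 6} {p : PP K 4} : p ∈ lineOf x ↔ wedgePt x.rep p.rep = 0 := by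
  conv_lhs => rw [← x.mk_rep, ← p.mk_rep]
  exact mk_mem_lineOf_mk_iff _ _

theorem mk_mem_lineOf_iff {x : PP K 6} {v : Fin 4 → K} (hv : v ≠ 0) :
    Projectivization.mk K v hv ∈ lineOf x ↔ wedgePt x.rep v = 0 := by
  conv_lhs => rw [← x.mk_rep]
  exact mk_mem_lineOf_mk_iff _ _

theorem mk_mem_grass_iff {w : Fin 6 → K} (hw : w ≠ 0) :
    Projectivization.mk K w hw ∈ grass K ↔ plQuad w = 0 := by
  constructor
  · rintro ⟨w', hw', e, h⟩
    obtain ⟨c, rfl⟩ := (Projectivization.mk_eq_mk_iff' K _ _ _ _).1 e.symm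
    rw [plQuad_smul, h, mul_zero]
  · intro h; exact ⟨w, hw, rfl, h⟩

theorem isLineRep_rep {x : PP K 6} (hx : x ∈ grass K) : IsLineRep x.rep :=
  ⟨x.rep_nonzero, by rw [← x.mk_rep] at hx; exact (mk_mem_grass_iff _).1 hx⟩

theorem IsLineRep.mk_mem_grass {w : Fin 6 → K} (hw : IsLineRep w) :
    Projectivization.mk K w hw.1 ∈ grass K := (mk_mem_grass_iff _).2 hw.2

theorem eq_of_mem_lineOf {x y : PP K 6} (hx : x ∈ grass K) (hy : y ∈ grass K) {p q : PP K 4}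
    (hpq : p ≠ q) (hpx : p ∈ lineOf x) (hqx : q ∈ lineOf x) (hpy : p ∈ lineOf y)
    (hqy : q ∈ lineOf y) : x = y := by
  rw [mem_lineOf_iff] at *
  have h : plucker p.rep q.rep ≠ 0 :=
    plucker_ne_zero_of_mk_ne p.rep_nonzero q.rep_nonzero (by simpa using hpq)
  obtain ⟨a, ha, e1⟩ := (isLineRep_rep hx).eq_smul_plucker h hpx hqx
  obtain ⟨b, hb, e2⟩ := (isLineRep_rep hy).eq_smul_plucker h hpy hqy
  rw [← x.mk_rep, ← y.mk_rep, Projectivization.mk_eq_mk_iff']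
  refine ⟨a⁻¹ * b, ?_⟩
  rw [mul_smul, ← e2, e1, smul_smul, inv_mul_cancel₀ ha, one_smul]

/-- The hyperplane of bivectors orthogonal to `w` under the wedge pairing. -/
def orthVec (w : Fin 6 → K) : Fin 6 → K := ![w 5, - w 4, w 3, w 2, - w 1, w 0]

theorem sum_orthVec (w z : Fin 6 → K) : ∑ i, orthVec w i * z i = plPair w z := by
  simp [Fin.sum_univ_six, orthVec, plPair]; ring

theorem orthVec_ne_zero {w : Fin 6 → K} (hw : w ≠ 0) : orthVec w ≠ 0 := by
  intro h
  apply hw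
  have e := fun k => congrFun h k
  have e0 := e 0; have e1 := e 1; have e2 := e 2; have e3 := e 3; have e4 := e 4; have e5 := e 5
  simp [orthVec] at e0 e1 e2 e3 e4 e5
  ext i; fin_cases i <;> simp [*]

theorem plPair_comm (w z : Fin 6 → K) : plPair w z = plPair z w := by
  simp [plPair]; ring

/-- The hyperplane section of lines meeting the line `x`. -/
def polar (x : PP K 6) : Set (PP K 6) := hyp (orthVec x.rep)

theorem mem_polar_iff {x y : PP K 6} : y ∈ polar x ↔ plPair x.rep y.rep = 0 := by
  rw [polar, ← y.mk_rep, mk_mem_hyp_iff, sum_orthVec, y.mk_rep]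

theorem mem_polar_comm {x y : PP K 6} : y ∈ polar x ↔ x ∈ polar y := by
  rw [mem_polar_iff, mem_polar_iff, plPair_comm]

theorem mem_polar_iff_meet {x y : PP K 6} (hx : x ∈ grass K) (hy : y ∈ grass K) :
    y ∈ polar x ↔ ∃ p, p ∈ lineOf x ∧ p ∈ lineOf y := by
  rw [mem_polar_iff, (isLineRep_rep hx).plPair_eq_zero_iff (isLineRep_rep hy)]
  constructor
  · rintro ⟨v, hv, h1, h2⟩
    exact ⟨Projectivization.mk K v hv, (mk_mem_lineOf_iff hv).2 h1, (mk_mem_lineOf_iff hv).2 h2⟩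
  · rintro ⟨p, h1, h2⟩
    exact ⟨p.rep, p.rep_nonzero, mem_lineOf_iff.1 h1, mem_lineOf_iff.1 h2⟩

theorem zClosed_polar [Infinite K] (x : PP K 6) : ZClosed (polar x) := zClosed_hyp _

/-- Parametrization of a line by its spanning vectors. -/
theorem exists_span_of_mem_grass {x : PP K 6} (hx : x ∈ grass K) :
    ∃ u v : Fin 4 → K, plucker u v ≠ 0 ∧
      ∀ (z : Fin 4 → K) (hz : z ≠ 0), Projectivization.mk K z hz ∈ lineOf x ↔
        ∃ a b : K, z = a • u + b • v := by
  obtain ⟨u, v, h⟩ := (isLineRep_rep hx).exists_plucker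
  have h0 : plucker u v ≠ 0 := h ▸ x.rep_nonzero
  refine ⟨u, v, h0, fun z hz => ?_⟩
  rw [mk_mem_lineOf_iff hz, h, wedgePt_plucker_iff h0]

theorem comb_ne_zero {u v : Fin 4 → K} (h : plucker u v ≠ 0) {a b : K} (hab : a ≠ 0 ∨ b ≠ 0) :
    a • u + b • v ≠ 0 := by
  intro h0
  have z1 : ∀ z : Fin 4 → K, plucker 0 z = 0 := fun z => by
    ext i; fin_cases i <;> simp [plucker]
  have h1 := plucker_comb u v a b 0 1
  have h2 := plucker_comb u v a b 1 0
  rw [h0, z1] at h1 h2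
  have ha : a = 0 := by simpa [h] using h1.symm
  have hb : b = 0 := by simpa [h] using h2.symm
  tauto

theorem lineOf_infinite [Infinite K] {x : PP K 6} (hx : x ∈ grass K) : (lineOf x).Infinite := by
  obtain ⟨u, v, h0, h⟩ := exists_span_of_mem_grass hx
  have hne : ∀ t : K, (1 : K) • u + t • v ≠ 0 := fun t => comb_ne_zero h0 (Or.inl one_ne_zero)
  refine Set.infinite_of_injective_forall_mem (f := fun t : K => Projectivization.mk K _ (hne t))
    ?_ (fun t => (h _ _).2 ⟨1, t, rfl⟩)
  intro s t hst
  obtain ⟨c, hc⟩ := (Projectivization.mk_eq_mk_iff' K _ _ _ _).1 hst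
  by_contra hne'
  have h1 : (c - 1) • u + (c * t - s) • v = 0 := by
    rw [sub_smul, sub_smul, mul_smul]
    have : c • ((1 : K) • u + t • v) - ((1 : K) • u + s • v) = 0 := by rw [hc, sub_self]
    rw [← this]; simp only [smul_add, one_smul]; abel
  by_cases hc1 : c = 1
  · subst hc1
    refine comb_ne_zero h0 (Or.inr ?_) h1
    rw [one_mul, sub_ne_zero]; exact fun h => hne' h.symm
  · exact comb_ne_zero h0 (Or.inl (sub_ne_zero.2 hc1)) h1

theorem zClosed_lineOf [Infinite K] (x : PP K 6) : ZClosed (lineOf x) := by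
  refine zClosed_of_eval (Set.range fun i : Fin 4 =>
    (![C (x.rep 0) * X 2 - C (x.rep 1) * X 1 + C (x.rep 3) * X 0,
      C (x.rep 0) * X 3 - C (x.rep 2) * X 1 + C (x.rep 4) * X 0,
      C (x.rep 1) * X 3 - C (x.rep 2) * X 2 + C (x.rep 5) * X 0,
      C (x.rep 3) * X 3 - C (x.rep 4) * X 2 + C (x.rep 5) * X 1] :
        Fin 4 → MvPolynomial (Fin 4) K) i) fun v hv => ?_
  rw [mk_mem_lineOf_iff, wedgePt_eq_zero_iff, Set.forall_mem_range]
  simp [Fin.forall_fin_succ]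

theorem zIrred_lineOf [Infinite K] {x : PP K 6} (hx : x ∈ grass K) : ZIrred (lineOf x) := by
  refine ⟨(lineOf_infinite hx).nonempty, fun A B hA hB hAB => ?_⟩
  by_contra! hcon
  obtain ⟨⟨p, hp, hpA⟩, ⟨q, hq, hqB⟩⟩ :=
    And.intro (Set.not_subset.1 hcon.1) (Set.not_subset.1 hcon.2)
  obtain ⟨u, v, h0, h⟩ := exists_span_of_mem_grass hx
  obtain ⟨s, hs, hsA⟩ := hA.exists_homogeneous
  obtain ⟨t, ht, htB⟩ := hB.exists_homogeneous
  rw [← p.mk_rep] at hp hpA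
  rw [← q.mk_rep] at hq hqB
  rw [hsA] at hpA
  rw [htB] at hqB
  push Not at hpA hqB
  obtain ⟨f, hfs, hf⟩ := hpA
  obtain ⟨g, hgt, hg⟩ := hqB
  obtain ⟨a, b, hp'⟩ := (h _ p.rep_nonzero).1 hp
  obtain ⟨c, d, hq'⟩ := (h _ q.rep_nonzero).1 hq
  -- pull back along `(X₀, X₁) ↦ X₀ u + X₁ v`
  let φ : MvPolynomial (Fin 4) K →ₐ[K] MvPolynomial (Fin 2) K :=
    aeval fun i => X 0 * C (u i) + X 1 * C (v i)
  have hφ : ∀ (F : MvPolynomial (Fin 4) K) (e : Fin 2 → K),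
      eval e (φ F) = eval (e 0 • u + e 1 • v) F := by
    intro F e
    have : (eval e).comp φ.toRingHom = eval (e 0 • u + e 1 • v) := by
      apply MvPolynomial.ringHom_ext
      · intro r; simp [φ]
      · intro i; simp [φ]
    exact congrArg (fun ψ => ψ F) this
  have hprod : φ f * φ g * X 0 = 0 := by
    apply MvPolynomial.funext
    intro e
    rw [map_mul, map_mul, hφ, hφ, eval_X, map_zero]
    by_cases he : e 0 = 0
    · rw [he, mul_zero]
    · have hne := comb_ne_zero h0 (a := e 0) (b := e 1) (Or.inl he)
      have := hAB ((h _ hne).2 ⟨_, _, rfl⟩)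
      rcases this with hA' | hB'
      · rw [(hsA _ _).1 hA' f hfs]; simp
      · rw [(htB _ _).1 hB' g hgt]; simp
  rcases mul_eq_zero.1 hprod with h1 | h1
  · rcases mul_eq_zero.1 h1 with h1 | h1
    · apply hf
      have := hφ f ![a, b]
      rw [h1] at this
      rw [hp']; simpa using this.symm
    · apply hg
      have := hφ g ![c, d]
      rw [h1] at this
      rw [hq']; simpa using this.symm
  · exact X_ne_zero _ h1

theorem zClosed_grass [Infinite K] : ZClosed (grass K) := by
  refine zClosed_of_eval {X 0 * X 5 - X 1 * X 4 + X 2 * X 3} fun v hv => ?_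
  rw [mk_mem_grass_iff]
  simp [plQuad]

theorem zClosed_sigma2 [Infinite K] (p : PP K 4) : ZClosed (sigma2 p) := by
  refine zClosed_grass.inter (?_ : ZClosed {x | p ∈ lineOf x})
  refine zClosed_of_eval (Set.range fun i : Fin 4 =>
    (![X 0 * C (p.rep 2) - X 1 * C (p.rep 1) + X 3 * C (p.rep 0),
      X 0 * C (p.rep 3) - X 2 * C (p.rep 1) + X 4 * C (p.rep 0),
      X 1 * C (p.rep 3) - X 2 * C (p.rep 2) + X 5 * C (p.rep 0),
      X 3 * C (p.rep 3) - X 4 * C (p.rep 2) + X 5 * C (p.rep 1)] :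
        Fin 4 → MvPolynomial (Fin 6) K) i) fun v hv => ?_
  rw [Set.mem_ofPred_eq, ← p.mk_rep, mk_mem_lineOf_mk_iff, wedgePt_eq_zero_iff,
    Set.forall_mem_range]
  simp [Fin.forall_fin_succ]

/-- The lines contained in a closed set form a closed set. -/
theorem zClosed_linesOf [Infinite K] {A : Set (PP K 4)} (hA : ZClosed A) : ZClosed (linesOf A) := by
  obtain ⟨s, hs, hsA⟩ := hA.exists_homogeneous
  let P : (Fin 4 → K) → Fin 4 → MvPolynomial (Fin 6) K := fun φ =>
    ![-(X 0 * C (φ 1)) - X 1 * C (φ 2) - X 2 * C (φ 3),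
      X 0 * C (φ 0) - X 3 * C (φ 2) - X 4 * C (φ 3),
      X 1 * C (φ 0) + X 3 * C (φ 1) - X 5 * C (φ 3),
      X 2 * C (φ 0) + X 4 * C (φ 1) + X 5 * C (φ 2)]
  have hP : ∀ φ w f, eval w (aeval (P φ) f) = eval (contr w φ) f := by
    intro φ w f
    have : (eval w).comp (aeval (R := K) (P φ)).toRingHom = eval (contr w φ) := by
      apply MvPolynomial.ringHom_ext
      · intro r; simp
      · intro i; fin_cases i <;> simp [P, contr]
    exact congrArg (fun ψ => ψ f) this
  refine zClosed_of_eval ({X 0 * X 5 - X 1 * X 4 + X 2 * X 3} ∪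
    {g | ∃ f ∈ s, ∃ φ, g = aeval (P φ) f}) fun w hw => ?_
  change (_ ∧ lineOf _ ⊆ A) ↔ _
  rw [mk_mem_grass_iff, lineOf_mk]
  constructor
  · rintro ⟨hq, hl⟩ p (rfl | ⟨f, hf, φ, rfl⟩)
    · simpa [plQuad] using hq
    · rw [hP]
      obtain ⟨q, hqm⟩ := (lineOf_infinite ((mk_mem_grass_iff hw).2 hq)).nonempty
      rw [lineOf_mk] at hqm
      have hqA := hl hqm
      rw [← q.mk_rep, hsA] at hqA
      by_cases h0 : contr w φ = 0
      · obtain ⟨d, hd⟩ := hs f hf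
        rw [h0, ← zero_smul K q.rep, eval_smul_of_isHomogeneous hd, hqA f hf, mul_zero]
      · refine (hsA _ h0).1 (hl ?_) f hf
        rw [mk_mem_lineOfRep_iff]
        exact wedgePt_contr hq φ
  · intro h
    refine ⟨by simpa [plQuad] using h _ (Or.inl rfl), fun p hp => ?_⟩
    rw [← p.mk_rep, mk_mem_lineOfRep_iff] at hp
    rw [← p.mk_rep, hsA]
    intro f hf
    obtain ⟨φ, hφ⟩ := exists_contr_of_wedgePt hw hp
    rw [hφ, ← hP]
    exact h _ (Or.inr ⟨f, hf, φ, rfl⟩)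

/-! #### Planes -/

theorem mem_hyp_iff {n : ℕ} {φ : Fin n → K} {p : PP K n} : p ∈ hyp φ ↔ φ ⬝ᵥ p.rep = 0 := by
  conv_lhs => rw [← p.mk_rep]
  exact mk_mem_hyp_iff _

theorem lineOf_subset_hyp {x : PP K 6} (hx : x ∈ grass K) {p q : PP K 4} (hpq : p ≠ q)
    (hp : p ∈ lineOf x) (hq : q ∈ lineOf x) {f : Fin 4 → K} (hpf : p ∈ hyp f) (hqf : q ∈ hyp f) :
    lineOf x ⊆ hyp f := by
  have h : plucker p.rep q.rep ≠ 0 :=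
    plucker_ne_zero_of_mk_ne p.rep_nonzero q.rep_nonzero (by simpa using hpq)
  obtain ⟨c, hc, e⟩ := (isLineRep_rep hx).eq_smul_plucker h (mem_lineOf_iff.1 hp)
    (mem_lineOf_iff.1 hq)
  intro r hr
  rw [mem_lineOf_iff] at hr
  have hr' : wedgePt (plucker p.rep q.rep) r.rep = 0 := by
    rw [e, wedgePt_smul_left, hr, smul_zero]
  obtain ⟨a, b, hab⟩ := (wedgePt_plucker_iff h).1 hr'
  rw [mem_hyp_iff] at *
  rw [hab, dotProduct_add, dotProduct_smul, dotProduct_smul, hpf, hqf]; simp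

theorem exists_dual {m n : ℕ} (hmn : m < n) (M : Fin m → Fin n → K) :
    ∃ f : Fin n → K, f ≠ 0 ∧ ∀ i, f ⬝ᵥ M i = 0 := by
  have h := LinearMap.ker_ne_bot_of_finrank_lt (f := (Matrix.of M).mulVecLin) (by simpa using hmn)
  obtain ⟨f, hf, h0⟩ := (Submodule.ne_bot_iff _).1 h
  refine ⟨f, h0, fun i => ?_⟩
  rw [dotProduct_comm]
  exact congrFun (LinearMap.mem_ker.1 hf) i

/-- There is a plane through a point and a line. -/
theorem exists_plane {x : PP K 6} (hx : x ∈ grass K) (q : PP K 4) :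
    ∃ f : Fin 4 → K, f ≠ 0 ∧ q ∈ hyp f ∧ lineOf x ⊆ hyp f := by
  obtain ⟨u, v, h0, h⟩ := exists_span_of_mem_grass hx
  obtain ⟨f, hf, hM⟩ := exists_dual (by norm_num : 3 < 4) ![q.rep, u, v]
  refine ⟨f, hf, mem_hyp_iff.2 (hM 0), fun r hr => ?_⟩
  rw [← r.mk_rep, h] at hr
  obtain ⟨a, b, hab⟩ := hr
  have h1 : f ⬝ᵥ u = 0 := hM 1
  have h2 : f ⬝ᵥ v = 0 := hM 2
  rw [mem_hyp_iff, hab, dotProduct_add, dotProduct_smul, dotProduct_smul, h1, h2]; simp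

/-- Two lines in a plane meet. -/
theorem mem_polar_of_subset_hyp {x y : PP K 6} (hx : x ∈ grass K) (hy : y ∈ grass K)
    {f : Fin 4 → K} (hf : f ≠ 0) (hxf : lineOf x ⊆ hyp f) (hyf : lineOf y ⊆ hyp f) :
    y ∈ polar x := by
  rw [mem_polar_iff]
  obtain ⟨u, v, h1⟩ := (isLineRep_rep hx).exists_plucker
  obtain ⟨u', v', h2⟩ := (isLineRep_rep hy).exists_plucker
  have key : ∀ {x : PP K 6} {u v : Fin 4 → K}, x.rep = plucker u v → lineOf x ⊆ hyp f →
      f ⬝ᵥ u = 0 ∧ f ⬝ᵥ v = 0 := by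
    intro x u v h1 hxf
    have h0 : plucker u v ≠ 0 := h1 ▸ x.rep_nonzero
    have := fun a b hab => (mk_mem_hyp_iff (comb_ne_zero h0 hab)).1
      (hxf ((mk_mem_lineOf_iff (comb_ne_zero h0 hab)).2 (h1 ▸ wedgePt_plucker_comb u v a b)))
    have e1 := this 1 0 (Or.inl one_ne_zero)
    have e2 := this 0 1 (Or.inr one_ne_zero)
    simp only [one_smul, zero_smul, add_zero, zero_add] at e1 e2
    exact ⟨e1, e2⟩
  rw [h1, h2, plPair_plucker_eq_det, ← Matrix.exists_mulVec_eq_zero_iff]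
  refine ⟨f, hf, ?_⟩
  ext i
  have e1 := key h1 hxf
  have e2 := key h2 hyf
  simp only [dotProduct_comm f] at e1 e2
  fin_cases i
  exacts [e1.1, e1.2, e2.1, e2.2]

/-! ### The projective Nullstellensatz and elimination -/

/-- An ideal whose only possible zero is the origin contains all monomials of large degree. -/
theorem exists_monomial_mem [IsAlgClosed K] {n : ℕ} (I : Ideal (MvPolynomial (Fin n) K))
    (hI : ∀ w, (∀ g ∈ I, eval w g = 0) → w = 0) :
    ∃ D, ∀ α : Fin n →₀ ℕ, D ≤ α.degree → monomial α (1 : K) ∈ I := by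
  have h1 : ∀ i, ∃ N, (X i : MvPolynomial (Fin n) K) ^ N ∈ I := by
    intro i
    change X i ∈ I.radical
    rw [← vanishingIdeal_zeroLocus_eq_radical (K := K), mem_vanishingIdeal_iff]
    intro w hw
    have hw0 : w = 0 := hI w (fun g hg => by simpa [aeval_eq_eval] using hw g hg)
    simp [hw0]
  choose N hN using h1
  refine ⟨∑ i, N i + 1, fun α hα => ?_⟩
  obtain ⟨i, hi⟩ : ∃ i, N i ≤ α i := by
    by_contra! hlt
    have : α.degree ≤ ∑ i, N i := by
      rw [Finsupp.degree_eq_sum]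
      exact Finset.sum_le_sum fun i _ => (hlt i).le
    omega
  have : monomial α (1 : K) = monomial (α - Finsupp.single i (N i)) 1 * X i ^ N i := by
    rw [X_pow_eq_monomial, monomial_mul, mul_one, tsub_add_cancel_of_le]
    rwa [Finsupp.single_le_iff]
  rw [this]
  exact I.mul_mem_left _ (hN i)

theorem eval_eq_sum_antidiag {n D : ℕ} {q : MvPolynomial (Fin n) K} (hq : q.IsHomogeneous D)
    (w : Fin n → K) : eval w q =
      ∑ β : Finset.univ.finsuppAntidiag D, coeff β.1 q * eval w (monomial β.1 1) := by
  rw [Finset.sum_coe_sort (Finset.univ.finsuppAntidiag D)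
    (fun β => coeff β q * eval w (monomial β 1))]
  rw [eval_eq]
  have : q.support ⊆ Finset.univ.finsuppAntidiag D := by
    intro m hm
    rw [Finset.mem_finsuppAntidiag]
    refine ⟨?_, Finset.subset_univ _⟩
    rw [← Finsupp.degree_eq_sum]
    by_contra hne
    exact (mem_support_iff.1 hm) (hq.coeff_eq_zero hne)
  rw [← Finset.sum_subset this]
  · refine Finset.sum_congr rfl fun m _ => ?_
    rw [eval_monomial, one_mul]; rfl
  · intro m _ hm
    rw [notMem_support_iff.1 hm, zero_mul]

/-- Elimination: the locus of parameters `p` for which a system that is homogeneous in `w` and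
bilinear in `(w, p)` has a nonzero solution is closed. -/
theorem exists_eliminant [IsAlgClosed K] {n m r : ℕ} (s : Set (MvPolynomial (Fin n) K))
    (hs : ∀ g ∈ s, ∃ d, g.IsHomogeneous d) (l : Fin r → Fin m → MvPolynomial (Fin n) K)
    (hl : ∀ i k, (l i k).IsHomogeneous 1) (p₀ : Fin m → K)
    (h₀ : ∀ w, (∀ g ∈ s, eval w g = 0) → (∀ i, ∑ k, p₀ k * eval w (l i k) = 0) → w = 0) :
    ∃ f : MvPolynomial (Fin m) K, eval p₀ f ≠ 0 ∧ ∀ p w, w ≠ 0 → (∀ g ∈ s, eval w g = 0) →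
      (∀ i, ∑ k, p k * eval w (l i k) = 0) → eval p f = 0 := by
  classical
  let Lp : Fin r → MvPolynomial (Fin n) K := fun i => ∑ k, C (p₀ k) * l i k
  obtain ⟨D, hD⟩ := exists_monomial_mem (Ideal.span s ⊔ Ideal.span (Set.range Lp)) (by
    intro w hw
    refine h₀ w (fun g hg => hw g (Ideal.mem_sup_left (Ideal.subset_span hg))) (fun i => ?_)
    have := hw (Lp i) (Ideal.mem_sup_right (Ideal.subset_span ⟨i, rfl⟩))
    simpa [Lp] using this)
  let A := Finset.univ.finsuppAntidiag (ι := Fin n) D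
  have hA : ∀ α ∈ A, ∃ g ∈ Ideal.span s, ∃ b : Fin r → MvPolynomial (Fin n) K,
      monomial α (1 : K) = g + ∑ i, b i * Lp i := by
    intro α hα
    rw [Finset.mem_finsuppAntidiag, ← Finsupp.degree_eq_sum] at hα
    obtain ⟨g, hg, h, hh, e⟩ := Submodule.mem_sup.1 (hD α hα.1.ge)
    obtain ⟨b, hb⟩ := (Ideal.mem_span_range_iff_exists_fun (R := MvPolynomial (Fin n) K)).1 hh
    exact ⟨g, hg, b, by rw [hb, e]⟩
  choose g hg b hb using fun α : A => hA α.1 α.2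
  let q : A → Fin m → MvPolynomial (Fin n) K := fun α k =>
    homogeneousComponent D (∑ i, b α i * l i k)
  let M : Matrix A A (MvPolynomial (Fin m) K) := fun α β =>
    C (if α = β then 1 else 0) - ∑ k, (C (p₀ k) - X k) * C (coeff β.1 (q α k))
  have hM : ∀ p, eval p M.det =
      Matrix.det (fun α β : A => (if α = β then 1 else 0) -
        ∑ k, (p₀ k - p k) * coeff β.1 (q α k)) := by
    intro p
    rw [RingHom.map_det]
    congr 1
    ext α β
    change eval p (C _ - _) = _
    simp
  refine ⟨M.det, ?_, fun p w hw hsw hlw => ?_⟩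
  · rw [hM]
    have : (fun α β : A => (if α = β then (1 : K) else 0) -
        ∑ k, (p₀ k - p₀ k) * coeff β.1 (q α k)) = (1 : Matrix A A K) := by
      ext α β; simp [Matrix.one_apply]
    rw [this, Matrix.det_one]; exact one_ne_zero
  · rw [hM]
    refine Matrix.exists_mulVec_eq_zero_iff.1 ⟨fun β => eval w (monomial β.1 1), ?_, ?_⟩
    · intro h0
      apply hw
      ext i
      have hmem : Finsupp.single i D ∈ A := by
        rw [Finset.mem_finsuppAntidiag, ← Finsupp.degree_eq_sum]
        exact ⟨by simp, Finset.subset_univ _⟩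
      have := congrFun h0 ⟨_, hmem⟩
      simp only [eval_monomial, one_mul, Pi.zero_apply] at this
      rw [Finsupp.prod_single_index (by simp)] at this
      exact eq_zero_of_pow_eq_zero this
    · ext α
      have hgw : ∀ g ∈ Ideal.span s, ∀ a : K, eval (a • w) g = 0 := by
        intro g hg a
        have hle : Ideal.span s ≤ RingHom.ker (eval (a • w)) := by
          rw [Ideal.span_le]
          intro f hf
          obtain ⟨d, hd⟩ := hs f hf
          rw [SetLike.mem_coe, RingHom.mem_ker, eval_smul_of_isHomogeneous hd, hsw f hf, mul_zero]
        exact hle hg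
      have hmono : homogeneousComponent D (monomial α.1 (1 : K)) = monomial α.1 1 := by
        have hα := α.2
        rw [Finset.mem_finsuppAntidiag, ← Finsupp.degree_eq_sum] at hα
        rw [homogeneousComponent_of_mem (isHomogeneous_monomial (1 : K) hα.1), if_pos rfl]
      have key : eval w (monomial α.1 1) = ∑ k, (p₀ k - p k) * eval w (q α k) := by
        have e : monomial α.1 1 - homogeneousComponent D (g α) =
            ∑ k, C (p₀ k) * q α k := by
          rw [← hmono]
          nth_rw 1 [hb α]
          rw [map_add, add_sub_cancel_left]
          simp only [q, ← homogeneousComponent_C_mul, ← map_sum, Lp]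
          congr 1
          simp only [Finset.mul_sum]
          rw [Finset.sum_comm]
          refine Finset.sum_congr rfl fun k _ => Finset.sum_congr rfl fun i _ => ?_
          ring
        have e1 := congrArg (eval w) e
        have e2 : eval w (homogeneousComponent D (g α)) = 0 :=
          eval_homogeneousComponent_eq_zero (fun a _ => hgw _ (hg α) a) D
        have e3 : ∑ k, p k * eval w (q α k) = 0 := by
          have : eval w (homogeneousComponent D (∑ k, C (p k) * ∑ i, b α i * l i k)) = 0 := by
            refine eval_homogeneousComponent_eq_zero (fun a _ => ?_) D
            have : ∑ k, C (p k) * ∑ i, b α i * l i k = ∑ i, b α i * ∑ k, C (p k) * l i k := by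
              simp only [Finset.mul_sum]
              rw [Finset.sum_comm]
              refine Finset.sum_congr rfl fun k _ => Finset.sum_congr rfl fun i _ => ?_
              ring
            rw [this, map_sum]
            refine Finset.sum_eq_zero fun i _ => ?_
            rw [map_mul, map_sum]
            have : ∑ k, eval (a • w) (C (p k) * l i k) = a * ∑ k, p k * eval w (l i k) := by
              rw [Finset.mul_sum]
              refine Finset.sum_congr rfl fun k _ => ?_
              rw [map_mul, eval_C, eval_smul_of_isHomogeneous (hl i k)]; ring
            rw [this, hlw, mul_zero, mul_zero]
          rw [map_sum, map_sum] at this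
          simpa [q, homogeneousComponent_C_mul] using this
        rw [map_sub, e2, sub_zero] at e1
        rw [e1, map_sum]
        simp only [sub_mul, Finset.sum_sub_distrib, e3, sub_zero, map_mul, eval_C]
      have e5 : ∀ k, eval w (q α k) = ∑ β : A, coeff β.1 (q α k) * eval w (monomial β.1 1) :=
        fun k => eval_eq_sum_antidiag (homogeneousComponent_isHomogeneous _ _) w
      have e6 : ∀ β : A, ((if α = β then (1 : K) else 0) - ∑ k, (p₀ k - p k) * coeff β.1 (q α k)) *
          eval w (monomial β.1 1) = (if α = β then eval w (monomial β.1 1) else 0) -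
          ∑ k, (p₀ k - p k) * (coeff β.1 (q α k) * eval w (monomial β.1 1)) := by
        intro β
        rw [sub_mul, ite_mul, one_mul, zero_mul, Finset.sum_mul]
        simp only [mul_assoc]
      simp only [Matrix.mulVec, dotProduct, Pi.zero_apply, e6]
      rw [Finset.sum_sub_distrib, Finset.sum_ite_eq, if_pos (Finset.mem_univ _), sub_eq_zero, key,
        Finset.sum_comm]
      simp only [e5, Finset.mul_sum]

/-- The union of the lines parametrized by `X`. -/
def sweep (X : Set (PP K 6)) : Set (PP K 4) := {p | ∃ x ∈ X, p ∈ lineOf x}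

theorem lineOf_subset_sweep {X : Set (PP K 6)} {x : PP K 6} (hx : x ∈ X) : lineOf x ⊆ sweep X :=
  fun _ hp => ⟨x, hx, hp⟩

theorem sweep_subset {X : Set (PP K 6)} {S : Set (PP K 4)} (h : X ⊆ linesOf S) : sweep X ⊆ S := by
  rintro p ⟨x, hx, hp⟩
  exact (h hx).2 hp

theorem zClosed_sweep [IsAlgClosed K] {Y : Set (PP K 6)} (hY : ZClosed Y) : ZClosed (sweep Y) := by
  obtain ⟨s, hs, hsY⟩ := hY.exists_homogeneous
  let l : Fin 4 → Fin 4 → MvPolynomial (Fin 6) K :=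
    ![![X 3, -X 1, X 0, 0], ![X 4, -X 2, 0, X 0], ![X 5, 0, -X 2, X 1], ![0, X 5, -X 4, X 3]]
  have hl : ∀ i k, (l i k).IsHomogeneous 1 := by
    intro i k
    fin_cases i <;> fin_cases k <;>
      first
        | exact isHomogeneous_X K _
        | exact (isHomogeneous_X K _).neg
        | exact isHomogeneous_zero _ _ _
  have hwedge : ∀ (w : Fin 6 → K) (p : Fin 4 → K),
      wedgePt w p = 0 ↔ ∀ i, ∑ k, p k * eval w (l i k) = 0 := by
    intro w p
    rw [wedgePt_eq_zero_iff]
    simp [Fin.forall_fin_succ, Fin.sum_univ_four, l]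
    refine and_congr ?_ (and_congr ?_ (and_congr ?_ ?_)) <;>
      exact Eq.congr_left (by ring)
  have hmem : ∀ (p : Fin 4 → K) (hp : p ≠ 0), Projectivization.mk K p hp ∈ sweep Y ↔
      ∃ w, w ≠ 0 ∧ (∀ g ∈ s, eval w g = 0) ∧ ∀ i, ∑ k, p k * eval w (l i k) = 0 := by
    intro p hp
    constructor
    · rintro ⟨x, hx, hpx⟩
      rw [← x.mk_rep, hsY] at hx
      rw [mk_mem_lineOf_iff] at hpx
      exact ⟨x.rep, x.rep_nonzero, hx, (hwedge _ _).1 hpx⟩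
    · rintro ⟨w, hw, h1, h2⟩
      exact ⟨Projectivization.mk K w hw, (hsY _ _).2 h1,
        (mk_mem_lineOf_mk_iff _ _).2 ((hwedge _ _).2 h2)⟩
  refine zClosed_of_eval {f | ∀ (p : Fin 4 → K) (hp : p ≠ 0),
    Projectivization.mk K p hp ∈ sweep Y → eval p f = 0} fun p₀ hp₀ => ?_
  refine ⟨fun h f hf => hf _ _ h, fun h => ?_⟩
  by_contra hcon
  obtain ⟨f, hf0, hf⟩ := exists_eliminant s hs l hl p₀ (fun w h1 h2 => by
    by_contra hw
    exact hcon ((hmem _ _).2 ⟨w, hw, h1, h2⟩))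
  refine hf0 (h f fun p hp hpY => ?_)
  obtain ⟨w, hw, h1, h2⟩ := (hmem _ _).1 hpY
  exact hf p w hw h1 h2

theorem zIrred_sweep [Infinite K] {X : Set (PP K 6)} (hX : ZIrred X) (hXg : X ⊆ grass K) :
    ZIrred (sweep X) := by
  obtain ⟨⟨x, hx⟩, hirr⟩ := hX
  obtain ⟨p, hp⟩ := (lineOf_infinite (hXg hx)).nonempty
  refine ⟨⟨p, x, hx, hp⟩, fun A B hA hB hAB => ?_⟩
  have : X ⊆ linesOf A ∪ linesOf B := by
    intro y hy
    rcases (zIrred_lineOf (hXg hy)).2 A B hA hB ((lineOf_subset_sweep hy).trans hAB) with h | h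
    · exact Or.inl ⟨hXg hy, h⟩
    · exact Or.inr ⟨hXg hy, h⟩
  rcases hirr _ _ (zClosed_linesOf hA) (zClosed_linesOf hB) this with h | h
  · exact Or.inl (sweep_subset h)
  · exact Or.inr (sweep_subset h)

theorem lineOf_injOn {x y : PP K 6} [Infinite K] (hx : x ∈ grass K) (hy : y ∈ grass K)
    (h : lineOf x ⊆ lineOf y) : x = y := by
  obtain ⟨p, hp, q, hq, hpq⟩ := (lineOf_infinite hx).nontrivial
  exact eq_of_mem_lineOf hx hy hpq hp hq (h hp) (h hq)

/-- A one-parameter family of lines in an irreducible surface sweeps out the surface. -/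
theorem sweep_eq [IsAlgClosed K] {S : Set (PP K 4)} (hS : ZClosed S) (hirr : ZIrred S)
    (hdim : ¬ dimGE S 3) {X : Set (PP K 6)} (hX : ZClosed X) (hXirr : ZIrred X)
    (hXS : X ⊆ linesOf S) (hXn : X.Nontrivial) : sweep X = S := by
  have : Infinite K := IsAlgClosed.instInfinite
  have hXg : X ⊆ grass K := fun x hx => (hXS hx).1
  refine subset_antisymm (sweep_subset hXS) ?_
  by_contra hcon
  obtain ⟨x, hx, y, hy, hxy⟩ := hXn
  have h1 : lineOf x ⊂ sweep X := by
    refine ⟨lineOf_subset_sweep hx, fun h => hxy ?_⟩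
    exact (lineOf_injOn (hXg hy) (hXg hx) ((lineOf_subset_sweep hy).trans h)).symm
  exact lineOf_infinite (hXg hx) (finite_of_ssubset_of_not_dimGE hS hirr hdim (zClosed_sweep hX)
    (zIrred_sweep hXirr hXg) ⟨sweep_subset hXS, hcon⟩ (zClosed_lineOf x) h1)

/-! ### The ruling of a ruled surface -/

theorem HasSurfDeg.finite_inter {S : Set (PP K 4)} {d : ℕ} (h : HasSurfDeg S d) {x : PP K 6}
    (hx : x ∈ grass K) (hxS : ¬ lineOf x ⊆ S) :
    (S ∩ lineOf x).Finite ∧ (S ∩ lineOf x).ncard ≤ d := by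
  have e : lineOf x = lineOfRep x.rep := by conv_lhs => rw [← x.mk_rep, lineOf_mk]
  rw [e] at hxS ⊢
  exact h.1 _ (isLineRep_rep hx) hxS

theorem HasSurfDeg.exists_line {S : Set (PP K 4)} {d : ℕ} (h : HasSurfDeg S d) :
    ∃ x ∈ grass K, ¬ lineOf x ⊆ S ∧ (S ∩ lineOf x).ncard = d := by
  obtain ⟨w, hw, h1, h2⟩ := h.2
  refine ⟨Projectivization.mk K w hw.1, hw.mk_mem_grass, ?_⟩
  rw [lineOf_mk]
  exact ⟨h1, h2⟩

/-- Lines meeting two incident lines pass through their common point or lie in their plane. -/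
theorem subset_sigma2_or_linesOf_hyp [Infinite K] {Y : Set (PP K 6)} (hYg : Y ⊆ grass K)
    (hY : ZIrred Y) {t t' : PP K 6} (ht : t ∈ grass K) (ht' : t' ∈ grass K) (hne : t ≠ t')
    (hmeet : t' ∈ polar t) (h1 : Y ⊆ polar t) (h2 : Y ⊆ polar t') :
    (∃ q, Y ⊆ sigma2 q) ∨ ∃ f : Fin 4 → K, f ≠ 0 ∧ Y ⊆ linesOf (hyp f) := by
  obtain ⟨q, hq, hq'⟩ := (mem_polar_iff_meet ht ht').1 hmeet
  obtain ⟨r, hr, hrq⟩ := ((lineOf_infinite ht').sdiff (Set.finite_singleton q)).nonempty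
  obtain ⟨f, hf, hrf, htf⟩ := exists_plane ht r
  have ht'f : lineOf t' ⊆ hyp f := lineOf_subset_hyp ht' hrq hr hq' hrf (htf hq)
  have hcov : Y ⊆ sigma2 q ∪ linesOf (hyp f) := by
    intro y hy
    by_cases hqy : q ∈ lineOf y
    · exact Or.inl ⟨hYg hy, hqy⟩
    · obtain ⟨a, ha, hay⟩ := (mem_polar_iff_meet ht (hYg hy)).1 (h1 hy)
      obtain ⟨b, hb, hby⟩ := (mem_polar_iff_meet ht' (hYg hy)).1 (h2 hy)
      have hab : a ≠ b := by
        rintro rfl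
        have haq : a ≠ q := by rintro rfl; exact hqy hay
        exact hne (eq_of_mem_lineOf ht ht' haq ha hq hb hq')
      exact Or.inr ⟨hYg hy, lineOf_subset_hyp (hYg hy) hab hay hby (htf ha) (ht'f hb)⟩
  rcases hY.2 _ _ (zClosed_sigma2 q) (zClosed_linesOf (zClosed_hyp f)) hcov with h | h
  · exact Or.inl ⟨q, h⟩
  · exact Or.inr ⟨f, hf, h⟩

/-- An irreducible family of lines of `S` all meeting a line `l` that has only finitely many
points on `S` is contained in some `σ₂(s)`, `s ∈ S ∩ l`. -/
theorem exists_subset_sigma2_of_subset_polar [Infinite K] {S : Set (PP K 4)} {Y : Set (PP K 6)}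
    (hYS : Y ⊆ linesOf S) (hY : ZIrred Y) {l : PP K 6} (hl : l ∈ grass K)
    (hfin : (S ∩ lineOf l).Finite) (h : Y ⊆ polar l) : ∃ s ∈ S ∩ lineOf l, Y ⊆ sigma2 s := by
  refine hY.exists_subset_of_biUnion hfin (fun s _ => zClosed_sigma2 s) fun y hy => ?_
  obtain ⟨p, hp, hpy⟩ := (mem_polar_iff_meet hl (hYS hy).1).1 (h hy)
  exact Set.mem_biUnion (⟨(hYS hy).2 hpy, hp⟩ : p ∈ S ∩ lineOf l) ⟨(hYS hy).1, hpy⟩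

theorem linesOf_infinite [Infinite K] {S : Set (PP K 4)} (hruled : IsRuled S) {l : PP K 6}
    (hl : l ∈ grass K) (hlS : ¬ lineOf l ⊆ S) (hnt : (S ∩ lineOf l).Nontrivial) :
    (linesOf S).Infinite := by
  intro hfin
  obtain ⟨x, hx, hSx⟩ := hruled.2.1.exists_subset_of_biUnion hfin
    (fun x _ => zClosed_lineOf x) (fun p hp => by
      obtain ⟨x, hx, hpx⟩ := hruled.2.2.2 p hp
      exact Set.mem_biUnion hx hpx)
  obtain ⟨p, hp, q, hq, hpq⟩ := hnt
  have := eq_of_mem_lineOf hx.1 hl hpq (hSx hp.1) (hSx hq.1) hp.2 hq.2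
  exact hlS (this ▸ hx.2)

/-- A line of `S` outside a one-parameter family of lines meets all members of the family. -/
theorem subset_polar_of_notMem [Infinite K] {S : Set (PP K 4)} {Y : Set (PP K 6)}
    (hYS : Y ⊆ linesOf S) (hY : IsMinimalInfinite Y) (hsw : sweep Y = S) {x : PP K 6}
    (hx : x ∈ linesOf S) (hxY : x ∉ Y) : Y ⊆ polar x := by
  by_contra hcon
  have hfin := hY.finite_inter (zClosed_polar x) hcon
  obtain ⟨y, hy, hxy⟩ := (zIrred_lineOf hx.1).exists_subset_of_biUnion hfin
    (fun y _ => zClosed_lineOf y) (fun p hp => by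
      have hpS := hx.2 hp
      rw [← hsw] at hpS
      obtain ⟨y, hy, hpy⟩ := hpS
      exact Set.mem_biUnion
        (⟨hy, (mem_polar_iff_meet hx.1 (hYS hy).1).2 ⟨p, hp, hpy⟩⟩ : y ∈ Y ∩ polar x) hpy)
  exact hxY (lineOf_injOn hx.1 (hYS hy.1).1 hxy ▸ hy.1)

/-- A one-parameter family of lines sweeping out a surface which is not a cone contains two skew
lines. -/
theorem exists_skew [Infinite K] {S : Set (PP K 4)} (hcone : ¬ IsCone S) {l : PP K 6}
    (hl : l ∈ grass K) (hlS : ¬ lineOf l ⊆ S) (hlfin : (S ∩ lineOf l).Finite)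
    (hnt : (S ∩ lineOf l).Nontrivial) {Y : Set (PP K 6)} (hYS : Y ⊆ linesOf S)
    (hY : IsMinimalInfinite Y) (hsw : sweep Y = S) : ∃ x ∈ Y, ∃ y ∈ Y, y ∉ polar x := by
  by_contra! hcon
  have hYg : Y ⊆ grass K := fun y hy => (hYS hy).1
  have hplane : ∀ f : Fin 4 → K, f ≠ 0 → Y ⊆ linesOf (hyp f) →
      ∃ s ∈ S ∩ lineOf l, Y ⊆ sigma2 s := by
    intro f hf hYf
    have hSf : S ⊆ hyp f := hsw ▸ sweep_subset hYf
    obtain ⟨p, hp, q, hq, hpq⟩ := hnt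
    have hlf := lineOf_subset_hyp hl hpq hp.2 hq.2 (hSf hp.1) (hSf hq.1)
    exact exists_subset_sigma2_of_subset_polar hYS hY.zIrred hl hlfin fun y hy =>
      mem_polar_of_subset_hyp hl (hYg hy) hf hlf (hYf hy).2
  have hs : ∃ s, Y ⊆ sigma2 s := by
    obtain ⟨y₁, hy₁, y₂, hy₂, hne⟩ := hY.2.1.nontrivial
    rcases subset_sigma2_or_linesOf_hyp hYg hY.zIrred (hYg hy₁) (hYg hy₂) hne
      (hcon _ hy₁ _ hy₂) (hcon _ hy₁) (hcon _ hy₂) with h | ⟨f, hf, h⟩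
    · exact h
    · obtain ⟨s, -, h⟩ := hplane f hf h
      exact ⟨s, h⟩
  obtain ⟨s, hs⟩ := hs
  simp only [IsCone, not_exists, not_forall] at hcone
  obtain ⟨x, hx, hsx⟩ := hcone s
  have hxY : x ∉ Y := fun h => hsx (hs h).2
  have hYx := subset_polar_of_notMem hYS hY hsw hx hxY
  obtain ⟨f, hf, hsf, hxf⟩ := exists_plane hx.1 s
  have hYf : Y ⊆ linesOf (hyp f) := by
    intro y hy
    obtain ⟨a, ha, hay⟩ := (mem_polar_iff_meet hx.1 (hYg hy)).1 (hYx hy)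
    have : s ≠ a := by rintro rfl; exact hsx ha
    exact ⟨hYg hy, lineOf_subset_hyp (hYg hy) this (hs hy).2 hay hsf (hxf ha)⟩
  obtain ⟨s', hs', hYs'⟩ := hplane f hf hYf
  by_cases hss : s' = s
  · subst hss
    obtain ⟨q, hq, hqs⟩ := hnt.exists_ne s'
    have hqS := hq.1
    rw [← hsw] at hqS
    obtain ⟨y, hy, hqy⟩ := hqS
    have := eq_of_mem_lineOf (hYg hy) hl hqs hqy (hs hy).2 hq.2 hs'.2
    exact hlS (this ▸ (hYS hy).2)
  · obtain ⟨y₁, hy₁, y₂, hy₂, hne⟩ := hY.2.1.nontrivial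
    exact hne (eq_of_mem_lineOf (hYg hy₁) (hYg hy₂) hss (hYs' hy₁).2 (hs hy₁).2
      (hYs' hy₂).2 (hs hy₂).2)

theorem plPair_add_smul (w y z : Fin 6 → K) (a b : K) :
    plPair w (a • y + b • z) = a * plPair w y + b * plPair w z := by
  simp [plPair]; ring

theorem plPair_self {w : Fin 6 → K} (hw : plQuad w = 0) : plPair w w = 0 := by
  simp only [plQuad, plPair] at *
  linear_combination 2 * hw

/-- Three pairwise skew lines are linearly independent. -/
theorem linearIndependent_of_skew {y : Fin 3 → Fin 6 → K} (hq : ∀ i, plQuad (y i) = 0)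
    (hs : ∀ i j, i ≠ j → plPair (y i) (y j) ≠ 0) : LinearIndependent K y := by
  have h2 : LinearIndependent K ![y 0, y 1] := by
    rw [LinearIndependent.pair_iff]
    intro a b hab
    have e1 := plPair_add_smul (y 0) (y 0) (y 1) a b
    have e2 := plPair_add_smul (y 1) (y 0) (y 1) a b
    have z : ∀ w : Fin 6 → K, plPair w 0 = 0 := fun w => by simp [plPair]
    rw [hab, z, plPair_self (hq _)] at e1 e2
    constructor
    · simpa [hs 1 0 (by decide)] using e2.symm
    · simpa [hs 0 1 (by decide)] using e1.symm
  have hy : y = ![y 0, y 1, y 2] := by ext i; fin_cases i <;> rfl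
  rw [hy]
  have h3 : LinearIndependent K (Fin.snoc ![y 0, y 1] (y 2) : Fin 3 → Fin 6 → K) := by
    rw [linearIndependent_finSnoc]
    refine ⟨h2, fun hmem => ?_⟩
    rw [Matrix.range_cons, Matrix.range_cons, Matrix.range_empty, Set.union_empty,
      Set.singleton_union, Submodule.mem_span_pair] at hmem
    obtain ⟨a, b, hab⟩ := hmem
    have hQ : plQuad (a • y 0 + b • y 1) = a * b * plPair (y 0) (y 1) := by
      have h0 := hq 0
      have h1 := hq 1
      simp only [plQuad, plPair, Pi.add_apply, Pi.smul_apply, smul_eq_mul] at *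
      linear_combination a ^ 2 * h0 + b ^ 2 * h1
    rw [hab, hq 2] at hQ
    have e1 := plPair_add_smul (y 0) (y 0) (y 1) a b
    have e2 := plPair_add_smul (y 1) (y 0) (y 1) a b
    rw [hab, plPair_self (hq _)] at e1 e2
    have n02 := hs 0 2 (by decide)
    have n12 := hs 1 2 (by decide)
    have n01 := hs 0 1 (by decide)
    rcases mul_eq_zero.1 hQ.symm with h | h
    · rcases mul_eq_zero.1 h with rfl | rfl
      · simp [n12] at e2
      · simp [n02] at e1
    · exact n01 h
  convert h3 using 1
  ext i
  fin_cases i <;> rfl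

theorem mem_span_of_plPair_eq_zero {t y : Fin 3 → Fin 6 → K} (ht : LinearIndependent K t)
    (hy : LinearIndependent K y) (h : ∀ i j, plPair (t i) (y j) = 0) {l : Fin 6 → K}
    (hl : ∀ i, plPair (t i) l = 0) : l ∈ Submodule.span K (Set.range y) := by
  let o : (Fin 6 → K) →ₗ[K] (Fin 6 → K) :=
    { toFun := orthVec
      map_add' := fun u v => by ext i; fin_cases i <;> simp [orthVec] <;> ring
      map_smul' := fun c u => by ext i; fin_cases i <;> simp [orthVec] }
  have ho : LinearMap.ker o = ⊥ := by
    rw [LinearMap.ker_eq_bot']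
    intro w hw
    by_contra hne
    exact orthVec_ne_zero hne hw
  let M : Matrix (Fin 3) (Fin 6) K := Matrix.of fun i => orthVec (t i)
  have hM : ∀ v i, M.mulVecLin v i = plPair (t i) v := fun v i => sum_orthVec _ _
  have hrank : M.rank = 3 := by
    have : LinearIndependent K M.row := ht.map' o ho
    simpa using this.rank_matrix
  have hker : Module.finrank K (LinearMap.ker M.mulVecLin) = 3 := by
    have := LinearMap.finrank_range_add_finrank_ker M.mulVecLin
    rw [← Matrix.rank, hrank] at this
    simp at this
    omega
  have hle : Submodule.span K (Set.range y) ≤ LinearMap.ker M.mulVecLin := by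
    rw [Submodule.span_le]
    rintro _ ⟨j, rfl⟩
    rw [SetLike.mem_coe, LinearMap.mem_ker]
    ext i
    rw [hM, h]; rfl
  rw [Submodule.eq_of_le_of_finrank_eq hle (by rw [hker, finrank_span_eq_card hy]; simp),
    LinearMap.mem_ker]
  ext i
  rw [hM, hl]; rfl

theorem exists_three {α : Type*} {s : Set α} (h : 3 ≤ s.ncard) :
    ∃ f : Fin 3 → α, Function.Injective f ∧ ∀ i, f i ∈ s := by
  have hfin : s.Finite := Set.finite_of_ncard_ne_zero (by omega)
  have := hfin.fintype
  have hc : Fintype.card (Fin 3) ≤ Fintype.card s := by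
    rw [Fintype.card_fin, Fintype.card_eq_nat_card]; exact h
  obtain ⟨e⟩ := Function.Embedding.nonempty_of_card_le hc
  exact ⟨fun i => (e i : α), fun i j hij => e.injective (Subtype.ext hij), fun i => (e i).2⟩

/-- The lines of a ruled surface of degree at least three which is not a cone: an irreducible
one-parameter family sweeping out the surface, and finitely many others. -/
theorem exists_ruling [IsAlgClosed K] {S : Set (PP K 4)} {d : ℕ} (hd : 3 ≤ d)
    (hruled : IsRuled S) (hdeg : HasSurfDeg S d) (hcone : ¬ IsCone S) :
    ∃ Y ⊆ linesOf S, IsMinimalInfinite Y ∧ (linesOf S \ Y).Finite ∧ sweep Y = S ∧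
      ∃ x ∈ Y, ∃ y ∈ Y, y ∉ polar x := by
  have : Infinite K := IsAlgClosed.instInfinite
  obtain ⟨l, hl, hlS, hlc⟩ := hdeg.exists_line
  have hlfin := (hdeg.finite_inter hl hlS).1
  obtain ⟨s, hsinj, hs⟩ := exists_three (hlc ▸ hd)
  have hnt : (S ∩ lineOf l).Nontrivial := ⟨s 0, hs 0, s 1, hs 1, hsinj.ne (by decide)⟩
  have hL : ZClosed (linesOf S) := zClosed_linesOf hruled.1
  have hsweep : ∀ Y ⊆ linesOf S, IsMinimalInfinite Y → sweep Y = S := fun Y hYS hY =>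
    sweep_eq hruled.1 hruled.2.1 hruled.2.2.1.2 hY.1 hY.zIrred hYS hY.2.1.nontrivial
  obtain ⟨Y, hYS, hY⟩ := hL.exists_isMinimalInfinite (linesOf_infinite hruled hl hlS hnt)
  have hsw := hsweep Y hYS hY
  obtain ⟨x, hx, y, hy, hxy⟩ := exists_skew hcone hl hlS hlfin hnt hYS hY hsw
  refine ⟨Y, hYS, hY, ?_, hsw, x, hx, y, hy, hxy⟩
  by_contra hinf
  have hYg : Y ⊆ grass K := fun y hy => (hYS hy).1
  obtain ⟨z, hz⟩ : ∃ z, z ∈ Y ∧ z ∉ polar x ∧ z ∉ polar y := by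
    by_contra! hcon
    have h1 := hY.finite_inter (zClosed_polar x) fun h => hxy (h hy)
    have h2 := hY.finite_inter (zClosed_polar y) fun h => hxy (mem_polar_comm.1 (h hx))
    refine hY.2.1 ((h1.union h2).subset fun z hz => ?_)
    by_cases hzx : z ∈ polar x
    · exact Or.inl ⟨hz, hzx⟩
    · exact Or.inr ⟨hz, hcon z hz hzx⟩
  obtain ⟨X, hXG, hX⟩ :=
    (hL.inter (zClosed_iInter fun y : Y => zClosed_polar y.1)).exists_isMinimalInfinite
    (Set.Infinite.mono (fun x hx => ⟨hx.1, Set.mem_iInter.2 fun y =>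
      mem_polar_comm.1 (subset_polar_of_notMem hYS hY hsw hx.1 hx.2 y.2)⟩) hinf)
  have hXS : X ⊆ linesOf S := fun t ht => (hXG ht).1
  have hXY : ∀ t ∈ X, Y ⊆ polar t := fun t ht y hy =>
    mem_polar_comm.1 (Set.mem_iInter.1 (hXG ht).2 ⟨y, hy⟩)
  have hXsw := hsweep X hXS hX
  have hXskew : ∀ t ∈ X, ∀ t' ∈ X, t ≠ t' → t' ∉ polar t := by
    intro t ht t' ht' hne hmeet
    rcases subset_sigma2_or_linesOf_hyp hYg hY.zIrred (hXS ht).1 (hXS ht').1 hne hmeet (hXY t ht)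
      (hXY t' ht') with ⟨q, h⟩ | ⟨f, hf, h⟩
    · exact hxy ((mem_polar_iff_meet (hYg hx) (hYg hy)).2 ⟨q, (h hx).2, (h hy).2⟩)
    · exact hxy (mem_polar_of_subset_hyp (hYg hx) (hYg hy) hf (h hx).2 (h hy).2)
  have ht : ∀ i, ∃ t ∈ X, s i ∈ lineOf t := fun i => by
    have := (hs i).1
    rwa [← hXsw] at this
  choose t htX hst using ht
  have htinj : Function.Injective t := by
    intro i j hij
    by_contra hne
    have := eq_of_mem_lineOf (hXS (htX i)).1 hl (hsinj.ne hne) (hst i) (hij ▸ hst j) (hs i).2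
      (hs j).2
    exact hlS (this ▸ (hXS (htX i)).2)
  have htind : LinearIndependent K fun i => (t i).rep :=
    linearIndependent_of_skew (fun i => (isLineRep_rep (hXS (htX i)).1).2) fun i j hij => by
      have := hXskew _ (htX i) _ (htX j) (htinj.ne hij)
      rwa [mem_polar_iff] at this
  have hyind : LinearIndependent K fun i => (![x, y, z] i).rep := by
    refine linearIndependent_of_skew (fun i => (isLineRep_rep ?_).2) fun i j hij => ?_
    · fin_cases i
      exacts [hYg hx, hYg hy, hYg hz.1]
    · rw [mem_polar_iff] at hxy
      have h1 := hz.2.1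
      have h2 := hz.2.2
      rw [mem_polar_iff] at h1 h2
      have hxy' := plPair_comm x.rep y.rep ▸ hxy
      have h1' := plPair_comm x.rep z.rep ▸ h1
      have h2' := plPair_comm y.rep z.rep ▸ h2
      fin_cases i <;> fin_cases j <;> first | exact absurd rfl hij | assumption
  have hXl : X ⊆ polar l := by
    have hmem := mem_span_of_plPair_eq_zero htind hyind (fun i j => by
      rw [← mem_polar_iff]
      apply hXY _ (htX i)
      fin_cases j
      exacts [hx, hy, hz.1]) (l := l.rep) (fun i => by
      rw [← mem_polar_iff, mem_polar_iff_meet (hXS (htX i)).1 hl]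
      exact ⟨s i, hst i, (hs i).2⟩)
    intro u hu
    rw [mem_polar_comm, mem_polar_iff, ← sum_orthVec]
    have hle : Submodule.span K (Set.range fun i => (![x, y, z] i).rep) ≤
        LinearMap.ker (Matrix.mulVecLin (Matrix.of fun _ : Unit => orthVec u.rep)) := by
      rw [Submodule.span_le]
      rintro _ ⟨i, rfl⟩
      rw [SetLike.mem_coe, LinearMap.mem_ker]
      ext
      change ∑ k, orthVec u.rep k * _ = 0
      rw [sum_orthVec, ← mem_polar_iff]
      apply hXY _ hu
      fin_cases i
      exacts [hx, hy, hz.1]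
    exact congrFun (LinearMap.mem_ker.1 (hle hmem)) ()
  obtain ⟨p, -, hXp⟩ := exists_subset_sigma2_of_subset_polar hXS hX.zIrred hl hlfin hXl
  obtain ⟨u, hu, u', hu', hne⟩ := hX.2.1.nontrivial
  exact hXskew u hu u' hu' hne ((mem_polar_iff_meet (hXS hu).1 (hXS hu').1).2
    ⟨p, (hXp hu).2, (hXp hu').2⟩)

theorem eval_aeval {σ τ : Type} (w : σ → K) (π : τ → MvPolynomial σ K) (g : MvPolynomial τ K) :
    eval w (aeval π g) = eval (fun i => eval w (π i)) g := by
  induction g using MvPolynomial.induction_on with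
  | C a => simp
  | add p q hp hq => rw [map_add, map_add, map_add, hp, hq]
  | mul_X p i hp => rw [map_mul, map_mul, map_mul, hp, aeval_X, eval_X]

/-- The image under the polynomial map `π` of the affine set cut out by `s`. -/
def polyImage {σ τ : Type} (s : Set (MvPolynomial σ K)) (π : τ → MvPolynomial σ K) :
    Set (τ → K) :=
  {p | ∃ w : σ → K, (∀ f ∈ s, eval w f = 0) ∧ ∀ i, eval w (π i) = p i}

/-- The image of a closed set under a polynomial map contains a nonempty open subset of its
closure, provided this closure is irreducible. -/
theorem exists_open_subset_image [IsAlgClosed K] {σ τ : Type} [Finite σ] [Finite τ]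
    (s : Set (MvPolynomial σ K)) (π : τ → MvPolynomial σ K)
    (hI : (vanishingIdeal K (polyImage s π)).IsPrime) :
    ∃ u ∉ vanishingIdeal K (polyImage s π),
      ∀ p : τ → K, (∀ g ∈ vanishingIdeal K (polyImage s π), eval p g = 0) → eval p u ≠ 0 →
        p ∈ polyImage s π := by
  set I := vanishingIdeal K (polyImage s π) with hIdef
  set J : Ideal (MvPolynomial σ K) := vanishingIdeal K {w : σ → K | ∀ f ∈ s, eval w f = 0}
    with hJ
  let φ : MvPolynomial τ K →+* MvPolynomial σ K ⧸ J :=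
    (Ideal.Quotient.mk J).comp (aeval π : MvPolynomial τ K →ₐ[K] MvPolynomial σ K).toRingHom
  have hφ (g : MvPolynomial τ K) : φ g = Ideal.Quotient.mk J (aeval π g) := rfl
  have hcomap : (⊥ : Ideal (MvPolynomial σ K ⧸ J)).comap φ = I := by
    ext g
    rw [Ideal.mem_comap, hφ, Ideal.mem_bot, Ideal.Quotient.eq_zero_iff_mem, hJ,
      mem_vanishingIdeal_iff, hIdef, mem_vanishingIdeal_iff]
    simp only [aeval_eq_eval]
    constructor
    · rintro h p ⟨w, hw, hp⟩
      have := h w hw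
      rw [eval_aeval] at this
      simpa [funext hp] using this
    · intro h w hw
      rw [eval_aeval]
      exact h _ ⟨w, hw, fun i => rfl⟩
  have hfin : φ.FinitePresentation := by
    apply RingHom.FinitePresentation.of_finiteType.mp
    apply RingHom.FiniteType.of_comp_finiteType (f := algebraMap K _)
    have : φ.comp (algebraMap K _) = algebraMap K (MvPolynomial σ K ⧸ J) := by
      ext a
      simp [hφ]
      rfl
    rw [this, RingHom.finiteType_algebraMap]
    infer_instance
  obtain ⟨D, hD⟩ := PrimeSpectrum.exists_constructibleSetData_iff.mpr
    (PrimeSpectrum.isConstructible_range_comap hfin)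
  obtain ⟨P, hP, -, hPI⟩ := Ideal.exists_comap_eq_of_mem_minimalPrimes (f := φ) (I := ⊥) I (by
    rw [hcomap, Ideal.minimalPrimes_eq_subsingleton_self]; rfl)
  have hmem : (⟨I, hI⟩ : PrimeSpectrum (MvPolynomial τ K)) ∈ D.toSet := by
    rw [hD]
    exact ⟨⟨P, hP⟩, by ext1; exact hPI⟩
  simp only [PrimeSpectrum.ConstructibleSetData.toSet, Set.mem_iUnion] at hmem
  obtain ⟨c, hc, hcI⟩ := hmem
  simp only [PrimeSpectrum.BasicConstructibleSetData.toSet, Set.mem_sdiff,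
    PrimeSpectrum.mem_zeroLocus, Set.singleton_subset_iff, SetLike.mem_coe] at hcI
  refine ⟨c.f, hcI.2, fun p hp hpc => ?_⟩
  have hm : (vanishingIdeal K {p}).IsMaximal := inferInstance
  have hmem' : (⟨vanishingIdeal K {p}, hm.isPrime⟩ : PrimeSpectrum (MvPolynomial τ K)) ∈
      D.toSet := by
    simp only [PrimeSpectrum.ConstructibleSetData.toSet, Set.mem_iUnion]
    refine ⟨c, hc, ?_⟩
    simp only [PrimeSpectrum.BasicConstructibleSetData.toSet, Set.mem_sdiff,
      PrimeSpectrum.mem_zeroLocus, Set.singleton_subset_iff, SetLike.mem_coe]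
    refine ⟨hcI.1.trans fun g hg => ?_, ?_⟩
    · exact (mem_vanishingIdeal_singleton_iff (k := K) p g).2 (by simpa using hp g hg)
    · rw [mem_vanishingIdeal_singleton_iff]
      simpa using hpc
  rw [hD] at hmem'
  obtain ⟨⟨Q, hQ⟩, hQp⟩ := hmem'
  have hQp' : Q.comap φ = vanishingIdeal K {p} := congrArg PrimeSpectrum.asIdeal hQp
  obtain ⟨M, hM, hQM⟩ := Q.exists_le_maximal hQ.ne_top
  have hMp : M.comap φ = vanishingIdeal K {p} :=
    (hm.eq_of_le (Ideal.comap_ne_top φ hM.ne_top)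
      (hQp' ▸ Ideal.comap_mono hQM)).symm
  have hM' : (M.comap (Ideal.Quotient.mk J)).IsMaximal :=
    Ideal.comap_isMaximal_of_surjective _ Ideal.Quotient.mk_surjective
  obtain ⟨w, hw⟩ := eq_vanishingIdeal_singleton_of_isMaximal K hM'
  refine ⟨w, fun f hf => ?_, fun i => ?_⟩
  · have : f ∈ M.comap (Ideal.Quotient.mk J) := by
      rw [Ideal.mem_comap, Ideal.Quotient.eq_zero_iff_mem.2]
      · exact M.zero_mem
      · rw [hJ, mem_vanishingIdeal_iff]
        intro v hv
        simpa using hv f hf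
    rw [hw, mem_vanishingIdeal_singleton_iff] at this
    simpa using this
  · have : X i - C (p i) ∈ M.comap φ := by
      rw [hMp, mem_vanishingIdeal_singleton_iff]
      simp
    have h2 : aeval π (X i - C (p i)) ∈ M.comap (Ideal.Quotient.mk J) := this
    rw [hw, mem_vanishingIdeal_singleton_iff] at h2
    simpa [sub_eq_zero] using h2

theorem mk_smul_rep {n : ℕ} (p : PP K n) {a : K} (ha : a ≠ 0) :
    Projectivization.mk K (a • p.rep) (smul_ne_zero ha p.rep_nonzero) = p := by
  conv_rhs => rw [← p.mk_rep]
  exact (Projectivization.mk_eq_mk_iff' _ _ _ _ _).2 ⟨a, rfl⟩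

/-- The points of projective space on whose punctured cone line `u` vanishes identically. -/
def coneLocus {n : ℕ} (u : MvPolynomial (Fin n) K) : Set (PP K n) :=
  {x | ∀ a : K, a ≠ 0 → eval (a • x.rep) u = 0}

theorem mk_mem_coneLocus_iff {n : ℕ} {u : MvPolynomial (Fin n) K} {v : Fin n → K} (hv : v ≠ 0) :
    Projectivization.mk K v hv ∈ coneLocus u ↔ ∀ a : K, a ≠ 0 → eval (a • v) u = 0 := by
  obtain ⟨c, hc⟩ := Projectivization.exists_smul_eq_mk_rep K v hv
  have hc' : (c : K) • v = (Projectivization.mk K v hv).rep := hc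
  rw [coneLocus, Set.mem_ofPred_eq, ← hc']
  constructor
  · intro h a ha
    have := h (a * (c : K)⁻¹) (mul_ne_zero ha (inv_ne_zero c.ne_zero))
    rwa [smul_smul, mul_assoc, inv_mul_cancel₀ c.ne_zero, mul_one] at this
  · intro h a ha
    rw [smul_smul]
    exact h _ (mul_ne_zero ha c.ne_zero)

theorem zClosed_coneLocus [Infinite K] {n : ℕ} (u : MvPolynomial (Fin n) K) :
    ZClosed (coneLocus u) := by
  refine zClosed_of_eval (Set.range fun k => homogeneousComponent k u) fun v hv => ?_
  rw [mk_mem_coneLocus_iff, Set.forall_mem_range]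
  refine ⟨fun h k => eval_homogeneousComponent_eq_zero h k, fun h a _ => ?_⟩
  rw [eval_eq_sum_components]
  refine Finset.sum_eq_zero fun k _ => ?_
  rw [eval_smul_of_isHomogeneous (homogeneousComponent_isHomogeneous k u), h k, mul_zero]

theorem subset_coneLocus_iff {n : ℕ} {u : MvPolynomial (Fin n) K} {X : Set (PP K n)} :
    X ⊆ coneLocus u ↔ u ∈ vanishingIdeal K (cone X) := by
  rw [mem_vanishingIdeal_iff]
  simp only [aeval_eq_eval]
  constructor
  · rintro h v ⟨hv, hvX⟩
    simpa using (mk_mem_coneLocus_iff hv).1 (h hvX) 1 one_ne_zero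
  · intro h x hx a ha
    exact h _ (mem_cone_smul (rep_mem_cone.2 hx) ha)

theorem coneLocus_mul_subset [Infinite K] {n : ℕ} (f g : MvPolynomial (Fin n) K) :
    coneLocus (f * g) ⊆ coneLocus f ∪ coneLocus g := by
  intro x hx
  let P (h : MvPolynomial (Fin n) K) : Polynomial K :=
    aeval (fun i => Polynomial.C (x.rep i) * Polynomial.X) h
  have hP (h : MvPolynomial (Fin n) K) (a : K) : (P h).eval a = eval (a • x.rep) h := by
    induction h using MvPolynomial.induction_on with
    | C c => simp [P]
    | add p q hp hq => simp only [P, map_add, Polynomial.eval_add] at hp hq ⊢; rw [hp, hq]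
    | mul_X p i hp =>
      simp only [P, map_mul, Polynomial.eval_mul, aeval_X, eval_X, Pi.smul_apply, smul_eq_mul,
        Polynomial.eval_C, Polynomial.eval_X] at hp ⊢
      rw [hp, mul_comm a]
  have h0 : P f * P g = 0 := by
    refine Polynomial.eq_zero_of_infinite_isRoot _ ?_
    refine (Set.infinite_of_finite_compl (s := {a : K | a ≠ 0}) ?_).mono fun a ha => ?_
    · convert Set.finite_singleton (0 : K)
      ext; simp
    · have := hx a ha
      rw [Set.mem_ofPred_eq, Polynomial.IsRoot.def, Polynomial.eval_mul, hP, hP, ← map_mul]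
      exact this
  rcases mul_eq_zero.1 h0 with h | h
  · exact Or.inl fun a _ => by rw [← hP, h, Polynomial.eval_zero]
  · exact Or.inr fun a _ => by rw [← hP, h, Polynomial.eval_zero]

theorem ZIrred.isPrime_vanishingIdeal [Infinite K] {n : ℕ} {X : Set (PP K n)} (hX : ZIrred X) :
    (vanishingIdeal K (cone X)).IsPrime := by
  rw [Ideal.isPrime_iff]
  refine ⟨fun h => ?_, fun {f g} hfg => ?_⟩
  · obtain ⟨x, hx⟩ := hX.1
    have h1 : (1 : MvPolynomial (Fin n) K) ∈ vanishingIdeal K (cone X) := h ▸ trivial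
    have := mem_vanishingIdeal_iff.1 h1 _ (rep_mem_cone.2 hx)
    simp at this
  · rw [← subset_coneLocus_iff] at hfg ⊢
    rw [← subset_coneLocus_iff]
    exact hX.2 _ _ (zClosed_coneLocus f) (zClosed_coneLocus g)
      (hfg.trans (coneLocus_mul_subset f g))

/-- The points lying on at least two lines of the family `Y`. -/
def multiplePts (Y : Set (PP K 6)) : Set (PP K 4) :=
  {p | ∃ x ∈ Y, ∃ y ∈ Y, x ≠ y ∧ p ∈ lineOf x ∧ p ∈ lineOf y}

theorem mk_ne_mk_iff {n : ℕ} {v w : Fin n → K} (hv : v ≠ 0) (hw : w ≠ 0) :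
    Projectivization.mk K v hv ≠ Projectivization.mk K w hw ↔
      ∃ i j, v i * w j - v j * w i ≠ 0 := by
  rw [not_iff_comm]
  push Not
  rw [Projectivization.mk_eq_mk_iff']
  constructor
  · intro h
    obtain ⟨j, hj⟩ := Function.ne_iff.1 hw
    refine ⟨v j / w j, ?_⟩
    ext i
    have := h i j
    simp only [Pi.zero_apply] at hj
    simp only [Pi.smul_apply, smul_eq_mul]
    field_simp
    linear_combination -this
  · rintro ⟨a, rfl⟩ i j
    simp only [Pi.smul_apply, smul_eq_mul]
    ring

/-- If the multiple points of a closed family of lines are dense in an irreducible set `S`, they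
contain a nonempty open subset of `S`. -/
theorem exists_open_subset_multiplePts [IsAlgClosed K] {S : Set (PP K 4)} {Y : Set (PP K 6)}
    (hirr : ZIrred S) (hY : ZClosed Y) (hYS : multiplePts Y ⊆ S)
    (hdense : S ⊆ zClosure (multiplePts Y)) :
    ∃ A, ZClosed A ∧ ¬ S ⊆ A ∧ ∀ p ∈ S, p ∉ A → p ∈ multiplePts Y := by
  have : Infinite K := IsAlgClosed.instInfinite
  obtain ⟨s, -, hs⟩ := hY.exists_homogeneous
  let V (i : Fin 4) : MvPolynomial (Fin 4 ⊕ Fin 6 ⊕ Fin 6 ⊕ Fin 6 × Fin 6) K := X (.inl i)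
  let W₁ (i : Fin 6) : MvPolynomial (Fin 4 ⊕ Fin 6 ⊕ Fin 6 ⊕ Fin 6 × Fin 6) K :=
    X (.inr (.inl i))
  let W₂ (i : Fin 6) : MvPolynomial (Fin 4 ⊕ Fin 6 ⊕ Fin 6 ⊕ Fin 6 × Fin 6) K :=
    X (.inr (.inr (.inl i)))
  let t (i : Fin 6 × Fin 6) : MvPolynomial (Fin 4 ⊕ Fin 6 ⊕ Fin 6 ⊕ Fin 6 × Fin 6) K :=
    X (.inr (.inr (.inr i)))
  let wp (W : Fin 6 → MvPolynomial (Fin 4 ⊕ Fin 6 ⊕ Fin 6 ⊕ Fin 6 × Fin 6) K) : Fin 4 →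
      MvPolynomial (Fin 4 ⊕ Fin 6 ⊕ Fin 6 ⊕ Fin 6 × Fin 6) K :=
    ![W 0 * V 2 - W 1 * V 1 + W 3 * V 0,
      W 0 * V 3 - W 2 * V 1 + W 4 * V 0,
      W 1 * V 3 - W 2 * V 2 + W 5 * V 0,
      W 3 * V 3 - W 4 * V 2 + W 5 * V 1]
  let eqs : Set (MvPolynomial (Fin 4 ⊕ Fin 6 ⊕ Fin 6 ⊕ Fin 6 × Fin 6) K) :=
    (aeval W₁ '' s ∪ aeval W₂ '' s) ∪ (Set.range (wp W₁) ∪ Set.range (wp W₂)) ∪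
      {∑ i, t i * (W₁ i.1 * W₂ i.2 - W₁ i.2 * W₂ i.1) - 1}
  have key (v : Fin 4 → K) (hv : v ≠ 0) :
      v ∈ polyImage eqs V ↔ Projectivization.mk K v hv ∈ multiplePts Y := by
    have hz (z : Fin 4 ⊕ Fin 6 ⊕ Fin 6 ⊕ Fin 6 × Fin 6 → K) (hzv : ∀ i, eval z (V i) = v i) :
        (∀ f ∈ eqs, eval z f = 0) ↔
          (((∀ f ∈ s, eval (fun i => eval z (W₁ i)) f = 0) ∧
            ∀ f ∈ s, eval (fun i => eval z (W₂ i)) f = 0) ∧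
            wedgePt (fun i => eval z (W₁ i)) v = 0 ∧ wedgePt (fun i => eval z (W₂ i)) v = 0) ∧
            ∑ i, eval z (t i) * (eval z (W₁ i.1) * eval z (W₂ i.2) -
              eval z (W₁ i.2) * eval z (W₂ i.1)) = 1 := by
      simp only [eqs, Set.union_singleton, Set.mem_insert_iff, Set.mem_union, or_imp, forall_and,
        forall_eq, Set.forall_mem_image, eval_aeval, Set.forall_mem_range, Fin.forall_fin_succ,
        wedgePt, wp, funext_iff, ← hzv, map_sub, map_sum, map_mul, map_one, sub_eq_zero]
      simp
      tauto
    constructor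
    · rintro ⟨z, hz1, hzv⟩
      obtain ⟨⟨⟨h1, h2⟩, h3, h4⟩, h5⟩ := (hz z hzv).1 hz1
      obtain ⟨i, -, hi⟩ := Finset.exists_ne_zero_of_sum_ne_zero (h5 ▸ one_ne_zero)
      have hi := right_ne_zero_of_mul hi
      have hw1 : (fun i => eval z (W₁ i)) ≠ 0 := by
        intro h
        have h' (i) : eval z (W₁ i) = 0 := congrFun h i
        simp [h'] at hi
      have hw2 : (fun i => eval z (W₂ i)) ≠ 0 := by
        intro h
        have h' (i) : eval z (W₂ i) = 0 := congrFun h i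
        simp [h'] at hi
      exact ⟨_, (hs _ hw1).2 h1, _, (hs _ hw2).2 h2, (mk_ne_mk_iff hw1 hw2).2 ⟨_, _, hi⟩,
        (mk_mem_lineOf_mk_iff hw1 hv).2 h3, (mk_mem_lineOf_mk_iff hw2 hv).2 h4⟩
    · rintro ⟨x, hx, y, hy, hxy, hpx, hpy⟩
      induction x using Projectivization.ind with | _ w hw
      induction y using Projectivization.ind with | _ w' hw'
      obtain ⟨i, j, hij⟩ := (mk_ne_mk_iff hw hw').1 hxy
      rw [mk_mem_lineOf_mk_iff] at hpx hpy
      let z : Fin 4 ⊕ Fin 6 ⊕ Fin 6 ⊕ Fin 6 × Fin 6 → K :=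
        Sum.elim v (Sum.elim w (Sum.elim w' (Pi.single (i, j) (w i * w' j - w j * w' i)⁻¹)))
      have hzv : ∀ i, eval z (V i) = v i := fun i => by simp [V, z]
      have hw1 : (fun i => eval z (W₁ i)) = w := by ext i; simp [W₁, z]
      have hw2 : (fun i => eval z (W₂ i)) = w' := by ext i; simp [W₂, z]
      refine ⟨z, (hz z hzv).2 ?_, hzv⟩
      rw [hw1, hw2]
      refine ⟨⟨⟨(hs _ _).1 hx, (hs _ _).1 hy⟩, hpx, hpy⟩, ?_⟩
      rw [Finset.sum_eq_single (i, j)]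
      · simp only [W₁, W₂, t, z, eval_X, Sum.elim_inr, Sum.elim_inl, Pi.single_eq_same]
        exact inv_mul_cancel₀ hij
      · intro k _ hk
        simp [t, z, Pi.single_eq_of_ne hk]
      · simp
  have hSdense : vanishingIdeal K (polyImage eqs V) = vanishingIdeal K (cone S) := by
    apply le_antisymm
    · intro f hf
      rw [← subset_coneLocus_iff]
      refine hdense.trans (zClosure_subset (zClosed_coneLocus f) fun p hp a ha => ?_)
      rw [mem_vanishingIdeal_iff] at hf
      have := hf (a • p.rep) ((key _ (smul_ne_zero ha p.rep_nonzero)).2 (by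
        rwa [mk_smul_rep p ha]))
      simpa using this
    · intro f hf
      rw [mem_vanishingIdeal_iff] at hf ⊢
      intro v hv
      by_cases hv0 : v = 0
      · subst hv0
        have h0 := homogeneousComponent_mem_vanishingIdeal_cone
          (mem_vanishingIdeal_iff.2 hf) 0
        obtain ⟨x, hx⟩ := hirr.1
        have := mem_vanishingIdeal_iff.1 h0 _ (rep_mem_cone.2 hx)
        rw [homogeneousComponent_zero] at this
        simp only [aeval_eq_eval] at this ⊢
        simpa [MvPolynomial.constantCoeff_eq] using this
      · exact hf v ⟨hv0, hYS ((key v hv0).1 hv)⟩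
  obtain ⟨u, hu, hup⟩ := exists_open_subset_image eqs V (hSdense ▸ hirr.isPrime_vanishingIdeal)
  refine ⟨coneLocus u, zClosed_coneLocus u, ?_, fun p hp hpu => ?_⟩
  · rwa [subset_coneLocus_iff, ← hSdense]
  · rw [coneLocus, Set.mem_ofPred_eq] at hpu
    push Not at hpu
    obtain ⟨a, ha, hau⟩ := hpu
    rw [← mk_smul_rep p ha]
    refine (key _ _).1 (hup _ (fun g hg => ?_) hau)
    rw [hSdense] at hg
    have := mem_vanishingIdeal_iff.1 hg (a • p.rep) (mem_cone_smul (rep_mem_cone.2 hp) ha)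
    simpa using this

theorem not_subset_zClosure_multiplePts [IsAlgClosed K] {S : Set (PP K 4)} {Y : Set (PP K 6)}
    (hirr : ZIrred S) (hYS : Y ⊆ linesOf S) (hY : IsMinimalInfinite Y) (hsweep : sweep Y = S)
    (hskew : ∃ x ∈ Y, ∃ y ∈ Y, y ∉ polar x) : ¬ S ⊆ zClosure (multiplePts Y) := by
  have : Infinite K := IsAlgClosed.instInfinite
  intro hdense
  have hmult : multiplePts Y ⊆ S := by
    rintro p ⟨x, hx, -, -, -, hpx, -⟩
    exact (hYS hx).2 hpx
  obtain ⟨A, hA, hSA, hAY⟩ := exists_open_subset_multiplePts hirr hY.1 hmult hdense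
  have hE : (Y ∩ ⋂ y : Y, polar y.1).Finite := by
    refine hY.finite_inter (zClosed_iInter fun y => zClosed_polar _) fun h => ?_
    obtain ⟨x, hx, y, hy, hxy⟩ := hskew
    exact hxy (Set.mem_iInter.1 (h hy) ⟨x, hx⟩)
  have hD : (Y ∩ linesOf A).Finite := by
    refine hY.finite_inter (zClosed_linesOf hA) fun h => hSA ?_
    rw [← hsweep]
    rintro p ⟨x, hx, hpx⟩
    exact (h hx).2 hpx
  obtain ⟨x, hx, hxED⟩ := (hY.2.1.sdiff (hE.union hD)).nonempty
  have hxA : ¬ lineOf x ⊆ A := fun h => hxED (Or.inr ⟨hx, (hYS hx).1, h⟩)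
  have hfin : (Y ∩ polar x).Finite := by
    refine hY.finite_inter (zClosed_polar x) fun h => hxED (Or.inl ⟨hx, ?_⟩)
    exact Set.mem_iInter.2 fun y => mem_polar_comm.1 (h y.2)
  have hcover : lineOf x ⊆ A ∪ ⋃ y ∈ (Y ∩ polar x) \ {x}, lineOf y := by
    intro p hp
    by_cases hpA : p ∈ A
    · exact Or.inl hpA
    refine Or.inr ?_
    obtain ⟨y, hy, z, hz, hyz, hpy, hpz⟩ := hAY p ((hYS hx).2 hp) hpA
    have (t) (ht : t ∈ Y) (hpt : p ∈ lineOf t) (htx : t ≠ x) :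
        p ∈ ⋃ y ∈ (Y ∩ polar x) \ {x}, lineOf y :=
      Set.mem_biUnion (x := t) ⟨⟨ht, (mem_polar_iff_meet (hYS hx).1 (hYS ht).1).2 ⟨p, hp, hpt⟩⟩,
        htx⟩ hpt
    by_cases hyx : y = x
    · exact this z hz hpz (fun h => hyz (hyx.trans h.symm))
    · exact this y hy hpy hyx
  rcases (zIrred_lineOf (hYS hx).1).2 _ _ hA
    (Set.Finite.zClosed_biUnion hfin.sdiff fun y _ => zClosed_lineOf y) hcover with h | h
  · exact hxA h
  · obtain ⟨y, hy, hxy⟩ := (zIrred_lineOf (hYS hx).1).exists_subset_of_biUnion hfin.sdiff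
      (fun y _ => zClosed_lineOf y) h
    exact hy.2 (lineOf_injOn (hYS hx).1 (hYS hy.1.1).1 hxy).symm

theorem not_subset_lineOf [Infinite K] {S : Set (PP K 4)} {Y : Set (PP K 6)}
    (hYS : Y ⊆ linesOf S) (hY : Y.Infinite) {x : PP K 6} (hx : x ∈ grass K) : ¬ S ⊆ lineOf x := by
  intro h
  refine hY ((Set.finite_singleton x).subset fun y hy => ?_)
  exact lineOf_injOn (hYS hy).1 hx ((hYS hy).2.trans h)

/-- Through a general point of `S` there passes exactly one line of `S`. -/
theorem exists_unique_line [IsAlgClosed K] {S : Set (PP K 4)} {Y : Set (PP K 6)}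
    (hirr : ZIrred S) (hYS : Y ⊆ linesOf S) (hY : IsMinimalInfinite Y)
    (hfin : (linesOf S \ Y).Finite) (hsweep : sweep Y = S)
    (hskew : ∃ x ∈ Y, ∃ y ∈ Y, y ∉ polar x) :
    ∃ T, ZClosed T ∧ ¬ S ⊆ T ∧ ∀ p ∈ S, p ∉ T → ∃! x, x ∈ linesOf S ∧ p ∈ lineOf x := by
  have : Infinite K := IsAlgClosed.instInfinite
  refine ⟨zClosure (multiplePts Y) ∪ ⋃ x ∈ linesOf S \ Y, lineOf x,
    (zClosed_zClosure _).union (Set.Finite.zClosed_biUnion hfin fun x _ => zClosed_lineOf x),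
    fun h => ?_, fun p hp hpT => ?_⟩
  · rcases hirr.2 _ _ (zClosed_zClosure _)
      (Set.Finite.zClosed_biUnion hfin fun x _ => zClosed_lineOf x) h with h | h
    · exact not_subset_zClosure_multiplePts hirr hYS hY hsweep hskew h
    · obtain ⟨x, hx, hSx⟩ := hirr.exists_subset_of_biUnion hfin (fun x _ => zClosed_lineOf x) h
      exact not_subset_lineOf hYS hY.2.1 hx.1.1 hSx
  · rw [Set.mem_union, not_or] at hpT
    have hmem (x) (hx : x ∈ linesOf S) (hpx : p ∈ lineOf x) : x ∈ Y := by
      by_contra hxY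
      exact hpT.2 (Set.mem_biUnion (x := x) ⟨hx, hxY⟩ hpx)
    obtain ⟨x, hx, hpx⟩ := hsweep.symm ▸ hp
    refine ⟨x, ⟨hYS hx, hpx⟩, fun y hy => ?_⟩
    by_contra hxy
    exact hpT.1 (subset_zClosure _ ⟨y, hmem y hy.1 hy.2, x, hx, hxy, hy.2, hpx⟩)

section Separating

open IntermediateField

/-- Among finitely many generators of a field extension of transcendence degree one over a perfect
field, each of them a transcendence basis, one is a separating element. -/
theorem exists_isSeparable_adjoin_simple {k L : Type} [Field k] [PerfectField k] [Field L]
    [Algebra k L] {G : Set L} (hG : G.Finite) (hne : G.Nonempty) (hgen : adjoin k G = ⊤)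
    (htr : ∀ x ∈ G, IsTranscendenceBasis k ((↑) : ({x} : Set L) → L)) :
    ∃ x ∈ G, Algebra.IsSeparable k⟮x⟯ L := by
  obtain _ | ⟨p, hp, hpk⟩ := CharP.exists' k
  · obtain ⟨x, hx⟩ := hne
    have : Algebra.IsAlgebraic k⟮x⟯ L := by
      convert! (htr x hx).isAlgebraic_field <;> simp
    exact ⟨x, hx, inferInstance⟩
  have : ExpChar k p := .prime hp.out
  have : CharP L p := .of_ringHom_of_ne_zero (algebraMap k L) p hp.out.ne_zero
  have H : ∀ s : Finset L,
      LinearIndepOn k _root_.id (s : Set L) → LinearIndepOn k (· ^ p) (s : Set L) := fun s hs => by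
    refine hs.map_of_injective_injective (frobeniusEquiv k p).symm
      (frobenius L p).toAddMonoidHom (by simp) (fun m hm => ?_) fun r m => ?_
    · simpa using hm
    · change ((frobeniusEquiv k p).symm r • m) ^ p = r • m ^ p
      rw [smul_pow, ← frobenius_def, frobenius_apply_frobeniusEquiv_symm]
  obtain ⟨x, hx, hmax⟩ := hG.exists_maximalFor
    (fun x => (separableClosure k⟮x⟯ L).restrictScalars k) _ hne
  refine ⟨x, hx, ?_⟩
  rw [← separableClosure.eq_top_iff, ← (restrictScalars_injective k).eq_iff,
    restrictScalars_top, eq_top_iff, ← hgen, adjoin_le_iff]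
  intro n hn
  by_contra hnx
  have hne' : n ≠ x := by
    rintro rfl
    exact hnx (le_restrictScalars_separableClosure _ (mem_adjoin_simple_self k n))
  obtain ⟨i, hi₁, hi₂⟩ := exists_isTranscendenceBasis_and_isSeparable_of_linearIndepOn_pow'
    p hp.out (a := id) H {x} n (htr x hx) (by simpa using hne')
  rw [Set.image_id] at hi₂
  have hcard := hi₁.cardinalMk_eq (htr x hx)
  rw [Cardinal.mk_singleton] at hcard
  by_cases hin : i = n
  · subst hin
    rw [Set.insert_sdiff_self_of_notMem (by simpa using hne')] at hi₂
    exact hnx hi₂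
  by_cases hix : i = x
  · subst hix
    have hset : (insert n {i} : Set L) \ {i} = {n} := by
      ext t
      simp only [Set.mem_sdiff, Set.mem_insert_iff, Set.mem_singleton_iff]
      constructor
      · tauto
      · rintro rfl; exact ⟨Or.inl rfl, hne'⟩
    rw [hset] at hi₂
    refine hnx (hmax hn ?_ (le_restrictScalars_separableClosure _ (mem_adjoin_simple_self k n)))
    rw [separableClosure_le_separableClosure_iff, adjoin_le_iff, Set.singleton_subset_iff]
    exact hi₂
  · have hset : (insert n {x} : Set L) \ {i} = {n, x} := by
      rw [Set.sdiff_singleton_eq_self]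
      simp [hin, hix]
    rw [hset] at hcard
    have h2 : Cardinal.mk ({n, x} : Set L) = 2 := by
      rw [Cardinal.mk_insert (by simpa using hne'), Cardinal.mk_singleton]
      norm_num
    rw [h2] at hcard
    norm_num at hcard

end Separating

section FiniteFibres

/-- A maximal ideal of a finite type algebra over an algebraically closed field is killed by a
character. -/
theorem exists_algHom_of_isMaximal [IsAlgClosed K] {R : Type} [CommRing R] [Algebra K R]
    [Algebra.FiniteType K R] (Q : Ideal R) [Q.IsMaximal] :
    ∃ χ : R →ₐ[K] K, ∀ r ∈ Q, χ r = 0 := by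
  let _ : Field (R ⧸ Q) := Ideal.Quotient.field Q
  have : Module.Finite K (R ⧸ Q) := finite_of_finite_type_of_isJacobsonRing K (R ⧸ Q)
  let e : K ≃ₐ[K] (R ⧸ Q) := AlgEquiv.ofBijective (Algebra.ofId K (R ⧸ Q))
    IsAlgClosed.algebraMap_bijective_of_isIntegral
  refine ⟨e.symm.toAlgHom.comp (Ideal.Quotient.mkₐ K Q), fun r hr => ?_⟩
  simp [Ideal.Quotient.eq_zero_iff_mem.2 hr]

theorem exists_bezout_of_separable_map {P F : Type} [CommRing P] [IsDomain P] [Field F]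
    [Algebra P F] [IsFractionRing P F] {M : Polynomial P}
    (hM : (M.map (algebraMap P F)).Separable) :
    ∃ δ : P, δ ≠ 0 ∧ ∃ A B : Polynomial P,
      A * M + B * Polynomial.derivative M = Polynomial.C δ := by
  obtain ⟨a, b, hab⟩ := hM
  obtain ⟨s, hs, hA⟩ := IsLocalization.integerNormalization_spec (nonZeroDivisors P) a
  obtain ⟨t, ht, hB⟩ := IsLocalization.integerNormalization_spec (nonZeroDivisors P) b
  refine ⟨s * t, nonZeroDivisors.ne_zero (mul_mem hs ht),
    t • IsLocalization.integerNormalization (nonZeroDivisors P) a,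
    s • IsLocalization.integerNormalization (nonZeroDivisors P) b, ?_⟩
  apply Polynomial.map_injective _ (IsFractionRing.injective P F)
  rw [Polynomial.derivative_map] at hab
  simp only [Polynomial.map_add, Polynomial.map_mul, hA, hB,
    Polynomial.map_C, map_mul, Algebra.smul_def, Polynomial.algebraMap_apply]
  linear_combination (Polynomial.C (algebraMap P F s) * Polynomial.C (algebraMap P F t)) * hab

theorem exists_isIntegral_primitive {P R F L : Type} [CommRing P] [IsDomain P] [CommRing R]
    [IsDomain R] [Algebra P R] [Module.Finite P R] [FaithfulSMul P R]
    [Field F] [Field L] [Algebra P F] [IsFractionRing P F] [Algebra R L] [IsFractionRing R L]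
    [Algebra F L] [Algebra P L] [IsScalarTower P F L] [IsScalarTower P R L]
    [FiniteDimensional F L] [Algebra.IsSeparable F L] :
    ∃ θ : R, IntermediateField.adjoin F {algebraMap R L θ} = ⊤ := by
  obtain ⟨α, hα⟩ := Field.exists_primitive_element F L
  obtain ⟨r, s, hs, rfl⟩ := IsFractionRing.div_surjective (A := R) α
  obtain ⟨h, hh, c, hc⟩ := (Algebra.IsAlgebraic.isAlgebraic (R := P) s).exists_nonzero_dvd hs
  refine ⟨r * c, ?_⟩
  have hs0 : algebraMap R L s ≠ 0 := by
    simpa using nonZeroDivisors.ne_zero hs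
  have hc' : algebraMap F L (algebraMap P F h) = algebraMap R L s * algebraMap R L c := by
    rw [← IsScalarTower.algebraMap_apply, IsScalarTower.algebraMap_apply P R L, hc, map_mul]
  have hh0 : algebraMap F L (algebraMap P F h) ≠ 0 := by
    rw [← IsScalarTower.algebraMap_apply, IsScalarTower.algebraMap_apply P R L]
    simpa using hh
  rw [eq_top_iff, ← hα, IntermediateField.adjoin_simple_le_iff]
  have : algebraMap R L r / algebraMap R L s =
      algebraMap R L (r * c) / algebraMap F L (algebraMap P F h) := by
    rw [hc'] at hh0 ⊢
    rw [map_mul]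
    have : algebraMap R L c ≠ 0 := right_ne_zero_of_mul hh0
    field_simp
  rw [this]
  exact div_mem (IntermediateField.mem_adjoin_simple_self F _)
    (IntermediateField.algebraMap_mem _ _)

/-- A finite separable cover of the affine line has full fibres over all but finitely many
points. -/
theorem exists_finset_algHom [IsAlgClosed K] {R F L : Type} [CommRing R] [IsDomain R] [Algebra K R]
    [Algebra (Polynomial K) R] [IsScalarTower K (Polynomial K) R] [Module.Finite (Polynomial K) R]
    [FaithfulSMul (Polynomial K) R]
    [Field F] [Field L] [Algebra (Polynomial K) F] [IsFractionRing (Polynomial K) F]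
    [Algebra R L] [IsFractionRing R L] [Algebra F L] [Algebra (Polynomial K) L]
    [IsScalarTower (Polynomial K) F L] [IsScalarTower (Polynomial K) R L]
    [Algebra.IsSeparable F L] :
    ∃ B : Set K, B.Finite ∧ ∀ τ ∉ B, ∃ s : Finset (R →ₐ[K] K),
      s.card = Module.finrank (Polynomial K) R ∧
        ∀ χ ∈ s, χ (algebraMap (Polynomial K) R Polynomial.X) = τ := by
  have : FiniteDimensional F L :=
    Module.Finite.of_isLocalizedModule (nonZeroDivisors (Polynomial K)) (Rₚ := F)
      (IsScalarTower.toAlgHom (Polynomial K) R L).toLinearMap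
  obtain ⟨θ, hθ⟩ := exists_isIntegral_primitive (P := Polynomial K) (R := R) (F := F) (L := L)
  have hintg : IsIntegral (Polynomial K) θ := Algebra.IsIntegral.isIntegral θ
  have hmin := minpoly.isIntegrallyClosed_eq_field_fractions F L hintg
  set M := minpoly (Polynomial K) θ with hMdef
  have hmonic : M.Monic := minpoly.monic hintg
  have hdeg : M.natDegree = Module.finrank (Polynomial K) R := by
    rw [Field.primitive_element_iff_minpoly_natDegree_eq, hmin, hmonic.natDegree_map] at hθ
    rw [hθ, IsFractionRing.finrank_eq (Polynomial K) F R L]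
  obtain ⟨δ, hδ, A, B, hAB⟩ := exists_bezout_of_separable_map (M := M) (F := F)
    (hmin ▸ Algebra.IsSeparable.isSeparable F (algebraMap R L θ))
  refine ⟨δ.rootSet K, Polynomial.rootSet_finite _ _, fun τ hτ => ?_⟩
  have hτ' : δ.eval τ ≠ 0 := fun h => hτ (by
    rw [Polynomial.mem_rootSet]; exact ⟨hδ, by simpa using h⟩)
  set Mt := M.map (Polynomial.evalRingHom τ) with hMt
  have hsep : Mt.Separable := by
    have := congrArg (Polynomial.map (Polynomial.evalRingHom τ)) hAB
    rw [Polynomial.map_add, Polynomial.map_mul, Polynomial.map_mul, Polynomial.map_C,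
      ← Polynomial.derivative_map, ← hMt, Polynomial.coe_evalRingHom] at this
    refine ⟨Polynomial.C (δ.eval τ)⁻¹ * A.map (Polynomial.evalRingHom τ),
      Polynomial.C (δ.eval τ)⁻¹ * B.map (Polynomial.evalRingHom τ), ?_⟩
    rw [mul_assoc, mul_assoc, ← mul_add, this, ← Polynomial.C_mul, inv_mul_cancel₀ hτ',
      Polynomial.C_1]
  have hft : Algebra.FiniteType K R := .trans (S := Polynomial K) inferInstance inferInstance
  have key : ∀ t ∈ Mt.rootSet K, ∃ χ : R →ₐ[K] K,
      χ (algebraMap (Polynomial K) R Polynomial.X) = τ ∧ χ θ = t := by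
    intro t ht
    have ht : Mt.eval t = 0 := by
      simpa using (Polynomial.mem_rootSet.1 ht).2
    let ψ : Polynomial (Polynomial K) →+* K := Polynomial.eval₂RingHom (Polynomial.evalRingHom τ) t
    have hψ : Function.Surjective ψ := fun c => ⟨Polynomial.C (Polynomial.C c), by simp [ψ]⟩
    have hmax : (RingHom.ker ψ).IsMaximal := RingHom.ker_isMaximal_of_surjective ψ hψ
    let _ : Algebra (Polynomial (Polynomial K)) R := (Polynomial.aeval θ).toRingHom.toAlgebra
    have halg : algebraMap (Polynomial (Polynomial K)) R = (Polynomial.aeval θ).toRingHom := rfl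
    have htower : IsScalarTower (Polynomial K) (Polynomial (Polynomial K)) R :=
      .of_algebraMap_eq fun p => by rw [halg]; simp
    have : Algebra.IsIntegral (Polynomial (Polynomial K)) R := .tower_top (Polynomial K)
    obtain ⟨Q, hQ, hQc⟩ := Ideal.exists_ideal_over_maximal_of_isIntegral
      (S := R) (RingHom.ker ψ) (by
        rw [halg, minpoly.ker_eval hintg, Ideal.span_singleton_le_iff_mem, RingHom.mem_ker]
        rw [Polynomial.eval_map] at ht
        exact ht)
    obtain ⟨χ, hχ⟩ := exists_algHom_of_isMaximal (K := K) Q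
    have hC : ∀ c : K, χ (algebraMap (Polynomial K) R (Polynomial.C c)) = c := fun c => by
      rw [← Polynomial.algebraMap_eq, ← IsScalarTower.algebraMap_apply, AlgHom.commutes]
      rfl
    refine ⟨χ, ?_, ?_⟩
    · have : (Polynomial.C (Polynomial.X - Polynomial.C τ) : Polynomial (Polynomial K)) ∈
          Q.comap (algebraMap (Polynomial (Polynomial K)) R) := by
        rw [hQc, RingHom.mem_ker]; simp [ψ]
      have := hχ _ this
      rw [halg] at this
      simpa [sub_eq_zero, hC] using this
    · have : (Polynomial.X - Polynomial.C (Polynomial.C t) : Polynomial (Polynomial K)) ∈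
          Q.comap (algebraMap (Polynomial (Polynomial K)) R) := by
        rw [hQc, RingHom.mem_ker]; simp [ψ]
      have := hχ _ this
      rw [halg] at this
      simpa [sub_eq_zero, hC] using this
  obtain ⟨Q₀, hQ₀⟩ := Ideal.exists_maximal R
  have : Nonempty (R →ₐ[K] K) := ⟨(exists_algHom_of_isMaximal (K := K) Q₀).choose⟩
  choose! χ hχ using key
  classical
  have hfin : (Mt.rootSet K).Finite := Polynomial.rootSet_finite _ _
  refine ⟨hfin.toFinset.image χ, ?_, ?_⟩
  · rw [Finset.card_image_of_injOn, ← hdeg]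
    · have := Polynomial.card_rootSet_eq_natDegree (K := K) hsep (IsAlgClosed.splits _)
      rw [hmonic.natDegree_map] at this
      rw [← this, ← Set.toFinset_card]
      congr 1
      ext; simp
    · intro a ha b hb hab
      rw [← (hχ a (by simpa using ha)).2, ← (hχ b (by simpa using hb)).2, hab]
  · intro c hc
    simp only [Finset.mem_image, Set.Finite.mem_toFinset] at hc
    obtain ⟨t, ht, rfl⟩ := hc
    exact (hχ t ht).1

end FiniteFibres

section Filtration

variable {R : Type} [CommRing R] [Algebra K R] {W : Submodule K R}

theorem pow_le_pow_of_one_mem (h1 : 1 ∈ W) {m n : ℕ} (hmn : m ≤ n) : W ^ m ≤ W ^ n :=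
  pow_le_pow_right₀ (Submodule.one_le.2 h1) hmn

theorem exists_mem_pow_of_adjoin_eq_top (h1 : 1 ∈ W)
    (hW : Algebra.adjoin K (W : Set R) = ⊤) (r : R) : ∃ n, r ∈ W ^ n := by
  have hr : r ∈ Algebra.adjoin K (W : Set R) := hW ▸ Algebra.mem_top
  induction hr using Algebra.adjoin_induction with
  | mem x hx => exact ⟨1, by simpa using hx⟩
  | algebraMap c =>
    exact ⟨0, by
      rw [pow_zero, Algebra.algebraMap_eq_smul_one]
      exact Submodule.smul_mem _ _ (Submodule.one_le.1 le_rfl)⟩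
  | add x y _ _ hx hy =>
    obtain ⟨m, hm⟩ := hx
    obtain ⟨n, hn⟩ := hy
    exact ⟨max m n, add_mem (pow_le_pow_of_one_mem h1 (le_max_left _ _) hm)
      (pow_le_pow_of_one_mem h1 (le_max_right _ _) hn)⟩
  | mul x y _ _ hx hy =>
    obtain ⟨m, hm⟩ := hx
    obtain ⟨n, hn⟩ := hy
    exact ⟨m + n, by rw [pow_add]; exact Submodule.mul_mem_mul hm hn⟩

theorem exists_le_pow_of_fg (h1 : 1 ∈ W) (hW : Algebra.adjoin K (W : Set R) = ⊤)
    {N : Submodule K R} (hN : N.FG) : ∃ n, N ≤ W ^ n := by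
  classical
  obtain ⟨t, rfl⟩ := hN
  choose f hf using exists_mem_pow_of_adjoin_eq_top h1 hW
  refine ⟨t.sup f, Submodule.span_le.2 fun r hr => ?_⟩
  exact pow_le_pow_of_one_mem h1 (Finset.le_sup (f := f) hr) (hf r)

/-- The condition that multiplication by `z` makes up all of the filtration by the powers of `W`
from some point on. -/
def IsFiltered (W : Submodule K R) (z : R) : Prop :=
  ∃ m, ∀ n ≥ m, W ^ (n + 1) ≤ W ^ n ⊔ (W ^ n).map (LinearMap.mulLeft K z)

theorem transcendental_of_isFiltered [IsAlgClosed K] [IsDomain R] (h1 : 1 ∈ W) (hfg : W.FG)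
    (hW : Algebra.adjoin K (W : Set R) = ⊤) {z : R} (hz : IsFiltered W z)
    (hR : ¬ Module.Finite K R) : Transcendental K z := by
  intro halg
  have hintg : IsIntegral K z := halg.isIntegral
  have : Algebra.IsIntegral K (Algebra.adjoin K {z}) := Algebra.IsIntegral.adjoin (by simpa)
  obtain ⟨c, hc⟩ := (IsAlgClosed.algebraMap_bijective_of_isIntegral (k := K)
    (K := Algebra.adjoin K {z})).2 ⟨z, Algebra.self_mem_adjoin_singleton K z⟩
  have hc : algebraMap K R c = z := congrArg Subtype.val hc
  obtain ⟨m, hm⟩ := hz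
  have hle : ∀ k, W ^ (m + k) ≤ W ^ m := by
    intro k
    induction k with
    | zero => exact le_rfl
    | succ k ih =>
      refine (hm (m + k) (by omega)).trans (sup_le ih ?_)
      rw [Submodule.map_le_iff_le_comap]
      intro r hr
      rw [Submodule.mem_comap, LinearMap.mulLeft_apply, ← hc, ← Algebra.smul_def]
      exact Submodule.smul_mem _ _ (ih hr)
  refine hR ⟨?_⟩
  have : W ^ m = ⊤ := by
    rw [eq_top_iff]
    intro r _
    obtain ⟨n, hn⟩ := exists_mem_pow_of_adjoin_eq_top h1 hW r
    exact hle n (pow_le_pow_of_one_mem h1 (by omega) hn)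
  exact this ▸ hfg.pow m

theorem surjective_eval (s : Finset (R →ₐ[K] K)) :
    Function.Surjective (LinearMap.pi fun χ : s => (χ : R →ₐ[K] K).toLinearMap) := by
  rw [← LinearMap.range_eq_top]
  by_contra hne
  obtain ⟨f, hf, hle⟩ := Submodule.exists_le_ker_of_lt_top _ (lt_top_iff_ne_top.2 hne)
  have hli := (linearIndependent_algHom_toLinearMap K R K).comp ((↑) : s → R →ₐ[K] K)
    Subtype.val_injective
  rw [Fintype.linearIndependent_iff] at hli
  apply hf
  classical
  ext χ
  have := hli (fun χ => f (Pi.single χ 1)) (by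
    ext r
    have hr : f (fun χ : s => (χ : R →ₐ[K] K) r) = 0 := hle ⟨r, rfl⟩
    have hsingle : ∀ i : s, (fun j => if i = j then (1 : K) else 0) = Pi.single i 1 := fun i => by
      ext j
      simp [Pi.single_apply, eq_comm]
    rw [LinearMap.pi_apply_eq_sum_univ f] at hr
    simp only [hsingle] at hr
    simpa [mul_comm] using hr) χ
  simpa using this

theorem exists_le_finrank_pow [IsDomain R] (h1 : 1 ∈ W) (hfg : W.FG)
    (hW : Algebra.adjoin K (W : Set R) = ⊤) {y : R} (hy : y ∈ W) (hy0 : y ≠ 0)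
    (s : Finset (R →ₐ[K] K)) (hs : ∀ χ ∈ s, χ y = 0) :
    ∃ m, ∀ n ≥ m, ∀ k, s.card * k ≤ Module.finrank K (W ^ (n + k) : Submodule K R) := by
  classical
  set ev := LinearMap.pi fun χ : s => (χ : R →ₐ[K] K).toLinearMap with hev
  have hsurj : Function.Surjective ev := surjective_eval s
  obtain ⟨N, hN, hNt⟩ : ∃ N : Submodule K R, N.FG ∧ N.map ev = ⊤ := by
    obtain ⟨t, ht⟩ : (⊤ : Submodule K (s → K)).FG := Module.Finite.fg_top
    choose g hg using hsurj
    refine ⟨Submodule.span K (t.image g), ⟨_, rfl⟩, ?_⟩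
    rw [← ht, Submodule.map_span]
    congr 1
    ext v
    simp [hg]
  obtain ⟨m, hm⟩ := exists_le_pow_of_fg h1 hW hN
  refine ⟨m, fun n hn k => ?_⟩
  induction k with
  | zero => simp
  | succ k ih =>
    have hfd : ∀ j, FiniteDimensional K (W ^ j : Submodule K R) := fun j =>
      Module.Finite.iff_fg.2 (hfg.pow j)
    have h2 := LinearMap.finrank_range_add_finrank_ker
      (ev.domRestrict (W ^ (n + k + 1)))
    have h3 : LinearMap.range (ev.domRestrict (W ^ (n + k + 1))) = ⊤ := by
      rw [LinearMap.range_domRestrict, eq_top_iff, ← hNt]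
      exact Submodule.map_mono (hm.trans (pow_le_pow_of_one_mem h1 (by omega)))
    have h4 : Module.finrank K (W ^ (n + k) : Submodule K R) ≤
        Module.finrank K (LinearMap.ker (ev.domRestrict (W ^ (n + k + 1)))) := by
      let f : (W ^ (n + k) : Submodule K R) →ₗ[K]
          LinearMap.ker (ev.domRestrict (W ^ (n + k + 1))) :=
        (((LinearMap.mulLeft K y).comp (W ^ (n + k)).subtype).codRestrict (W ^ (n + k + 1))
          fun r => by
            rw [pow_succ']
            exact Submodule.mul_mem_mul hy r.2).codRestrict _ fun r => by
              rw [LinearMap.mem_ker]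
              ext χ
              simp [hev, hs χ χ.2]
      refine LinearMap.finrank_le_finrank_of_injective (f := f) ?_
      rw [injective_iff_map_eq_zero]
      intro r hr
      have : y * r = 0 :=
        congrArg (fun q : LinearMap.ker (ev.domRestrict (W ^ (n + k + 1))) => (q : R)) hr
      ext1
      exact (mul_eq_zero.1 this).resolve_left hy0
    rw [h3, finrank_top, Module.finrank_fintype_fun_eq_card, Fintype.card_coe] at h2
    rw [← add_assoc, ← h2, mul_add_one]
    omega

variable [Algebra (Polynomial K) R] [IsScalarTower K (Polynomial K) R]

theorem moduleFinite_of_isFiltered (h1 : 1 ∈ W) (hfg : W.FG)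
    (hW : Algebra.adjoin K (W : Set R) = ⊤)
    (hz : IsFiltered W (algebraMap (Polynomial K) R Polynomial.X)) :
    Module.Finite (Polynomial K) R := by
  obtain ⟨m, hm⟩ := hz
  obtain ⟨t, ht⟩ := hfg.pow m
  refine ⟨⟨t, ?_⟩⟩
  have key : ∀ k, W ^ (m + k) ≤ (Submodule.span (Polynomial K) (t : Set R)).restrictScalars K := by
    intro k
    induction k with
    | zero =>
      rw [add_zero, ← ht, Submodule.span_le]
      exact Submodule.subset_span
    | succ k ih =>
      refine (hm (m + k) (by omega)).trans (sup_le ih ?_)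
      rw [Submodule.map_le_iff_le_comap]
      intro r hr
      rw [Submodule.mem_comap, LinearMap.mulLeft_apply, ← Algebra.smul_def]
      exact Submodule.smul_mem (Submodule.span (Polynomial K) (t : Set R)) _ (ih hr)
  rw [eq_top_iff]
  intro r _
  obtain ⟨n, hn⟩ := exists_mem_pow_of_adjoin_eq_top h1 hW r
  exact key n (pow_le_pow_of_one_mem h1 (by omega) hn)

/-- Linear growth, with slope at most the rank over `K[X]`. -/
theorem exists_finrank_pow_le [Module.Free (Polynomial K) R] [Module.Finite (Polynomial K) R]
    (hfg : W.FG) (hz : IsFiltered W (algebraMap (Polynomial K) R Polynomial.X)) :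
    ∃ m c, ∀ k, Module.finrank K (W ^ (m + k) : Submodule K R) ≤
      Module.finrank (Polynomial K) R * (c + k) := by
  classical
  obtain ⟨m, hm⟩ := hz
  let b := Module.Free.chooseBasis (Polynomial K) R
  let D : ℕ → Submodule K R := fun n => ⨅ i,
    (Polynomial.degreeLT K n).comap ((b.coord i).restrictScalars K)
  have hD : ∀ n r, r ∈ D n ↔ ∀ i, b.repr r i ∈ Polynomial.degreeLT K n := by
    intro n r
    simp [D, Submodule.mem_iInf]
  have hmono : ∀ {a c}, a ≤ c → D a ≤ D c := fun hac r hr => by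
    rw [hD] at hr ⊢
    exact fun i => Polynomial.degreeLT_mono hac (hr i)
  have hX : ∀ n, ∀ r ∈ D n, algebraMap (Polynomial K) R Polynomial.X * r ∈ D (n + 1) := by
    intro n r hr
    rw [hD] at hr ⊢
    intro i
    have := hr i
    rw [← Algebra.smul_def, map_smul, Finsupp.smul_apply, smul_eq_mul,
      Polynomial.mem_degreeLT] at *
    rw [mul_comm, Polynomial.degree_mul_X]
    rw [Nat.cast_add, Nat.cast_one]
    exact WithBot.add_lt_add_right (by simp) this
  have hex : ∀ r, ∃ n, r ∈ D n := fun r => by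
    refine ⟨Finset.univ.sup fun i => (b.repr r i).natDegree + 1, (hD _ _).2 fun i => ?_⟩
    rw [Polynomial.mem_degreeLT]
    refine (Polynomial.degree_le_natDegree).trans_lt ?_
    exact_mod_cast (Nat.lt_succ_self _).trans_le
      (Finset.le_sup (f := fun i => (b.repr r i).natDegree + 1) (Finset.mem_univ i))
  have hrank : ∀ n, ∃ f : D n →ₗ[K]
      (Module.Free.ChooseBasisIndex (Polynomial K) R → Polynomial.degreeLT K n),
      Function.Injective f := by
    intro n
    refine ⟨LinearMap.pi fun i => (((b.coord i).restrictScalars K).comp (D n).subtype).codRestrict _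
      fun r => (hD _ _).1 r.2 i, ?_⟩
    rw [injective_iff_map_eq_zero]
    intro r hr
    ext1
    apply b.repr.injective
    ext1 i
    rw [Submodule.coe_zero, map_zero]
    exact congrArg Subtype.val (congrFun hr i)
  obtain ⟨t, ht⟩ := hfg.pow m
  choose g hg using hex
  have h0 : W ^ m ≤ D (t.sup g) := by
    rw [← ht, Submodule.span_le]
    exact fun r hr => hmono (Finset.le_sup (f := g) hr) (hg r)
  have key : ∀ k, W ^ (m + k) ≤ D (t.sup g + k) := by
    intro k
    induction k with
    | zero => exact h0
    | succ k ih =>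
      refine (hm (m + k) (by omega)).trans (sup_le (ih.trans (hmono (by omega))) ?_)
      rw [Submodule.map_le_iff_le_comap]
      exact fun r hr => hX _ _ (ih hr)
  refine ⟨m, t.sup g, fun k => ?_⟩
  have hfd : ∀ n, FiniteDimensional K (Polynomial.degreeLT K n) := fun n =>
    Module.Finite.equiv (Polynomial.degreeLTEquiv K n).symm
  obtain ⟨f, hf⟩ := hrank (t.sup g + k)
  have := Module.Finite.of_injective f hf
  refine (Submodule.finrank_mono (key k)).trans
    ((LinearMap.finrank_le_finrank_of_injective hf).trans ?_)
  rw [Module.finrank_pi_fintype, Finset.sum_const, (Polynomial.degreeLTEquiv K _).finrank_eq,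
    Module.finrank_fin_fun, Module.finrank_eq_card_chooseBasisIndex, Finset.card_univ, smul_eq_mul]

end Filtration

section Degree

variable {R : Type} [CommRing R] [IsDomain R] [Algebra K R] {W : Submodule K R}

theorem isTranscendenceBasis_of_isFiltered [IsAlgClosed K] (h1 : 1 ∈ W) (hfg : W.FG)
    (hW : Algebra.adjoin K (W : Set R) = ⊤) {z : R} (hz : IsFiltered W z)
    (hR : ¬ Module.Finite K R) :
    IsTranscendenceBasis K ((↑) : ({algebraMap R (FractionRing R) z} : Set (FractionRing R)) →
      FractionRing R) := by
  have htr := transcendental_of_isFiltered h1 hfg hW hz hR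
  let _ : Algebra (Polynomial K) R := (Polynomial.aeval z).toAlgebra
  have halg : algebraMap (Polynomial K) R = (Polynomial.aeval z).toRingHom := rfl
  have : IsScalarTower K (Polynomial K) R := .of_algebraMap_eq fun c => by rw [halg]; simp
  have hzX : algebraMap (Polynomial K) R Polynomial.X = z := by rw [halg]; simp
  have hfin := moduleFinite_of_isFiltered h1 hfg hW (hzX.symm ▸ hz)
  have hbasis : IsTranscendenceBasis K (fun _ : Unit => z) := by
    rw [isTranscendenceBasis_iff_algebraicIndependent_isAlgebraic]
    refine ⟨algebraicIndependent_unique_type_iff.2 htr, ⟨fun r => ?_⟩⟩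
    let g : Polynomial K →+* Algebra.adjoin K (Set.range fun _ : Unit => z) :=
      (Polynomial.aeval ⟨z, Algebra.subset_adjoin ⟨(), rfl⟩⟩ :
        Polynomial K →ₐ[K] Algebra.adjoin K (Set.range fun _ : Unit => z)).toRingHom
    have hg : (algebraMap _ R).comp g = algebraMap (Polynomial K) R := by
      rw [halg]
      ext <;> simp [g]
    have hintg : (algebraMap (Polynomial K) R).IsIntegralElem r := Algebra.IsIntegral.isIntegral r
    rw [← hg] at hintg
    exact IsIntegral.isAlgebraic (RingHom.IsIntegralElem.of_comp hintg)
  have : Algebra.IsAlgebraic R (FractionRing R) :=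
    (IsFractionRing.comap_isAlgebraic_iff (K := FractionRing R)).2 inferInstance
  have hb := hbasis.algebraMap_comp (A := FractionRing R)
  let e : Unit ≃ ({algebraMap R (FractionRing R) z} : Set (FractionRing R)) :=
    Equiv.ofUnique _ _
  exact (isTranscendenceBasis_equiv' e (by ext u; exact (e u).2)).1 hb

theorem card_le_of_isSeparable [IsAlgClosed K] (h1 : 1 ∈ W) (hfg : W.FG)
    (hW : Algebra.adjoin K (W : Set R) = ⊤) (hR : ¬ Module.Finite K R) {z : R}
    (hz : IsFiltered W z)
    (hsep : Algebra.IsSeparable (IntermediateField.adjoin K {algebraMap R (FractionRing R) z})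
      (FractionRing R)) {d : ℕ}
    (hd : ∃ B : Set K, B.Finite ∧ ∀ τ ∉ B, ∀ s : Finset (R →ₐ[K] K),
      (∀ χ ∈ s, χ z = τ) → s.card ≤ d)
    {y : R} (hy : y ∈ W) (hy0 : y ≠ 0) (s : Finset (R →ₐ[K] K)) (hs : ∀ χ ∈ s, χ y = 0) :
    s.card ≤ d := by
  have htr := transcendental_of_isFiltered h1 hfg hW hz hR
  let _ : Algebra (Polynomial K) R := (Polynomial.aeval z).toAlgebra
  have halg : algebraMap (Polynomial K) R = (Polynomial.aeval z).toRingHom := rfl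
  have : IsScalarTower K (Polynomial K) R := .of_algebraMap_eq fun c => by rw [halg]; simp
  have hzX : algebraMap (Polynomial K) R Polynomial.X = z := by rw [halg]; simp
  rw [← hzX] at hz
  have hfin := moduleFinite_of_isFiltered h1 hfg hW hz
  have hinj : Function.Injective (algebraMap (Polynomial K) R) := transcendental_iff_injective.1 htr
  have hfaith : FaithfulSMul (Polynomial K) R := (faithfulSMul_iff_algebraMap_injective _ _).2 hinj
  have hfree : Module.Free (Polynomial K) R := Module.free_of_finite_type_torsion_free'
  obtain ⟨m, c, hmc⟩ := exists_finrank_pow_le hfg hz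
  obtain ⟨m', hm'⟩ := exists_le_finrank_pow h1 hfg hW hy hy0 s hs
  set e := Module.finrank (Polynomial K) R
  have hse : s.card ≤ e := by
    by_contra hlt
    push Not at hlt
    set k := e * (c + m') + 1
    have h2 := hm' (m + m') (by omega) k
    have h3 := hmc (m' + k)
    rw [← add_assoc] at h3
    have h4 := Nat.mul_le_mul_right k hlt
    have h5 : e * (c + (m' + k)) = e * (c + m') + e * k := by ring
    have h6 : (e + 1) * k = e * k + k := by ring
    rw [Nat.succ_eq_add_one] at h4
    omega
  refine hse.trans ?_
  let F := IntermediateField.adjoin K {algebraMap R (FractionRing R) z}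
  let _ : Algebra (Polynomial K) F :=
    (Polynomial.aeval (IntermediateField.AdjoinSimple.gen K
      (algebraMap R (FractionRing R) z))).toAlgebra
  have halgF : ∀ p : Polynomial K, algebraMap F (FractionRing R) (algebraMap (Polynomial K) F p) =
      algebraMap R (FractionRing R) (algebraMap (Polynomial K) R p) := fun p => by
    change algebraMap F (FractionRing R) (Polynomial.aeval _ p) =
      algebraMap R (FractionRing R) (Polynomial.aeval z p)
    rw [← Polynomial.aeval_algebraMap_apply, IntermediateField.AdjoinSimple.algebraMap_gen,
      Polynomial.aeval_algebraMap_apply]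
  have htow : IsScalarTower (Polynomial K) F (FractionRing R) := .of_algebraMap_eq fun p => by
    rw [halgF, ← IsScalarTower.algebraMap_apply]
  have hFfaith : FaithfulSMul (Polynomial K) F := by
    refine (faithfulSMul_iff_algebraMap_injective _ _).2 fun p q hpq => hinj ?_
    apply IsFractionRing.injective R (FractionRing R)
    rw [← halgF, ← halgF, hpq]
  have hFfrac : IsFractionRing (Polynomial K) F := by
    refine IsFractionRing.of_field _ _ fun x => ?_
    obtain ⟨r, t, hrt⟩ := (IntermediateField.mem_adjoin_simple_iff K (x : FractionRing R)).1 x.2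
    refine ⟨r, t, Subtype.ext ?_⟩
    rw [Polynomial.aeval_algebraMap_apply, Polynomial.aeval_algebraMap_apply] at hrt
    rw [hrt]
    exact (congrArg₂ (· / ·) (halgF r) (halgF t)).symm
  have hsep' : Algebra.IsSeparable F (FractionRing R) := hsep
  obtain ⟨B, hB, hBe⟩ := exists_finset_algHom (K := K) (R := R) (F := F) (L := FractionRing R)
  obtain ⟨B', hB', hBd⟩ := hd
  have : Infinite K := IsAlgClosed.instInfinite
  obtain ⟨τ, hτ⟩ := (hB.union hB').infinite_compl.nonempty
  obtain ⟨t, ht, htτ⟩ := hBe τ fun h => hτ (Or.inl h)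
  rw [hzX] at htτ
  rw [← show t.card = e from ht]
  exact hBd τ (fun h => hτ (Or.inr h)) t htτ

/-- A linear form on an affine curve, given by a filtered coordinate ring, has no more zeros than
the general members of pencils of linear forms that generate the coordinate ring. -/
theorem card_le_of_generators [IsAlgClosed K] (h1 : 1 ∈ W) (hfg : W.FG)
    (hW : Algebra.adjoin K (W : Set R) = ⊤) (hR : ¬ Module.Finite K R) {ι : Type} [Finite ι]
    [Nonempty ι] {a : ι → R} (hgen : Algebra.adjoin K (Set.range a) = ⊤)
    (ha : ∀ i, IsFiltered W (a i)) {d : ℕ}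
    (hd : ∀ i, ∃ B : Set K, B.Finite ∧ ∀ τ ∉ B, ∀ s : Finset (R →ₐ[K] K),
      (∀ χ ∈ s, χ (a i) = τ) → s.card ≤ d)
    {y : R} (hy : y ∈ W) (hy0 : y ≠ 0) (s : Finset (R →ₐ[K] K)) (hs : ∀ χ ∈ s, χ y = 0) :
    s.card ≤ d := by
  set A := IntermediateField.adjoin K (Set.range fun i => algebraMap R (FractionRing R) (a i))
    with hA
  have hmem : ∀ r : R, algebraMap R (FractionRing R) r ∈ A := by
    have hle : Algebra.adjoin K (Set.range a) ≤
        A.toSubalgebra.comap (IsScalarTower.toAlgHom K R (FractionRing R)) := by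
      rw [Algebra.adjoin_le_iff]
      rintro _ ⟨i, rfl⟩
      exact IntermediateField.subset_adjoin K _ ⟨i, rfl⟩
    intro r
    rw [hgen] at hle
    exact hle (Algebra.mem_top (x := r))
  have htop : A = ⊤ := by
    rw [eq_top_iff]
    intro x _
    obtain ⟨r, t, _, rfl⟩ := IsFractionRing.div_surjective (A := R) x
    exact div_mem (hmem r) (hmem t)
  obtain ⟨_, ⟨i, rfl⟩, hsep⟩ := exists_isSeparable_adjoin_simple (Set.finite_range _)
    (Set.range_nonempty _) htop (by
      rintro _ ⟨i, rfl⟩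
      exact isTranscendenceBasis_of_isFiltered h1 hfg hW (ha i) hR)
  exact card_le_of_isSeparable h1 hfg hW hR (ha i) hsep (hd i) hy hy0 s hs

end Degree

section Grading

variable {n : ℕ}

/-- The linear form with coefficient vector `φ`. -/
noncomputable def linForm (φ : Fin n → K) : MvPolynomial (Fin n) K := ∑ i, C (φ i) * X i

theorem eval_linForm (φ v : Fin n → K) : eval v (linForm φ) = ∑ i, φ i * v i := by
  simp [linForm]

theorem isHomogeneous_linForm (φ : Fin n → K) : (linForm φ).IsHomogeneous 1 :=
  IsHomogeneous.sum _ _ _ fun i _ => by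
    simpa using (isHomogeneous_C (Fin n) (φ i)).mul (isHomogeneous_X K i)

theorem homogeneousComponent_mul_of_isHomogeneous_one {ℓ : MvPolynomial (Fin n) K}
    (hℓ : ℓ.IsHomogeneous 1) (g : MvPolynomial (Fin n) K) (k : ℕ) :
    homogeneousComponent (k + 1) (ℓ * g) = ℓ * homogeneousComponent k g := by
  classical
  conv_lhs => rw [← sum_homogeneousComponent g, Finset.mul_sum, map_sum]
  have h : ∀ j, homogeneousComponent (k + 1) (ℓ * homogeneousComponent j g) =
      if j = k then ℓ * homogeneousComponent k g else 0 := by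
    intro j
    have hj : (ℓ * homogeneousComponent j g).IsHomogeneous (j + 1) := by
      rw [add_comm]
      exact hℓ.mul (homogeneousComponent_isHomogeneous j g)
    rw [homogeneousComponent_of_mem hj]
    split_ifs with h1 h2 h2
    · rw [h2]
    · omega
    · omega
    · rfl
  simp only [h, Finset.sum_ite_eq', Finset.mem_range]
  split_ifs with hk
  · rfl
  · rw [homogeneousComponent_eq_zero _ _ (by omega), mul_zero]

theorem mem_restrictTotalDegree_one_pow {k : ℕ} {p : MvPolynomial (Fin n) K}
    (hp : p.totalDegree ≤ k) : p ∈ (restrictTotalDegree (Fin n) K 1) ^ k := by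
  classical
  have h1 : (1 : MvPolynomial (Fin n) K) ∈ restrictTotalDegree (Fin n) K 1 := by
    rw [mem_restrictTotalDegree]; simp
  have key : ∀ (k : ℕ) (m : Fin n →₀ ℕ), m.degree ≤ k →
      monomial m (1 : K) ∈ (restrictTotalDegree (Fin n) K 1) ^ k := by
    intro k
    induction k with
    | zero =>
      intro m hm
      have : m = 0 := (Finsupp.degree_eq_zero_iff m).1 (by simpa using hm)
      subst this
      rw [pow_zero]
      exact Submodule.one_le.1 le_rfl
    | succ k ih =>
      intro m hm
      by_cases h0 : m = 0
      · subst h0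
        exact pow_le_pow_of_one_mem h1 (Nat.zero_le _) (by
          rw [pow_zero]; exact Submodule.one_le.1 le_rfl)
      · obtain ⟨i, hi⟩ := Finsupp.ne_iff.1 h0
        have hle : Finsupp.single i 1 ≤ m := by
          rw [Finsupp.single_le_iff]; exact Nat.one_le_iff_ne_zero.2 hi
        have hm' : Finsupp.single i 1 + (m - Finsupp.single i 1) = m := add_tsub_cancel_of_le hle
        have hdeg := congrArg Finsupp.degree hm'
        rw [map_add, Finsupp.degree_single] at hdeg
        rw [← hm', ← mul_one (1 : K), ← monomial_mul, pow_succ']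
        refine Submodule.mul_mem_mul ?_ (ih _ (by omega))
        rw [mem_restrictTotalDegree]
        exact (totalDegree_X (R := K) i).le
  rw [p.as_sum]
  refine Submodule.sum_mem _ fun m hm => ?_
  rw [← mul_one (coeff m p), ← smul_eq_mul, ← smul_monomial]
  exact Submodule.smul_mem _ _ (key k m ((le_totalDegree hm).trans hp))

theorem totalDegree_le_of_mem_pow {k : ℕ} {p : MvPolynomial (Fin n) K}
    (hp : p ∈ (restrictTotalDegree (Fin n) K 1) ^ k) : p.totalDegree ≤ k := by
  rw [← mem_restrictTotalDegree]
  revert p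
  change (restrictTotalDegree (Fin n) K 1) ^ k ≤ restrictTotalDegree (Fin n) K k
  induction k with
  | zero =>
    rw [pow_zero, Submodule.one_le, mem_restrictTotalDegree]
    simp
  | succ k ih =>
    rw [pow_succ, Submodule.mul_le]
    intro p hp q hq
    have hp := ih hp
    rw [mem_restrictTotalDegree] at *
    exact (totalDegree_mul _ _).trans (by omega)

theorem mem_of_monomial_mem {I : Ideal (MvPolynomial (Fin n) K)} {D : ℕ}
    (hI : ∀ α : Fin n →₀ ℕ, D ≤ α.degree → monomial α (1 : K) ∈ I)
    {p : MvPolynomial (Fin n) K} {k : ℕ} (hp : p.IsHomogeneous k) (hk : D ≤ k) : p ∈ I := by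
  rw [p.as_sum]
  refine Ideal.sum_mem _ fun m hm => ?_
  have hm : m.degree = k := by
    rw [Finsupp.degree_eq_weight_one]
    exact hp (mem_support_iff.1 hm)
  rw [← mul_one (coeff m p), ← C_mul_monomial]
  exact I.mul_mem_left _ (hI m (hm ▸ hk))

/-- The homogenization of `f` with respect to the linear form `ℓ`. -/
noncomputable def homogenize (ℓ f : MvPolynomial (Fin n) K) : MvPolynomial (Fin n) K :=
  ∑ k ∈ Finset.range (f.totalDegree + 1), ℓ ^ (f.totalDegree - k) * homogeneousComponent k f

theorem eval_homogenize (ℓ f : MvPolynomial (Fin n) K) {v : Fin n → K} (hv : eval v ℓ ≠ 0) :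
    eval v (homogenize ℓ f) = eval v ℓ ^ f.totalDegree * eval ((eval v ℓ)⁻¹ • v) f := by
  rw [eval_eq_sum_components f, homogenize, map_sum, Finset.mul_sum]
  refine Finset.sum_congr rfl fun k hk => ?_
  rw [eval_smul_of_isHomogeneous (homogeneousComponent_isHomogeneous k f), map_mul, map_pow,
    ← mul_assoc, inv_pow]
  congr 1
  rw [Finset.mem_range] at hk
  rw [eq_mul_inv_iff_mul_eq₀ (pow_ne_zero _ hv), ← pow_add]
  congr 1
  omega

end Grading

section Chart

variable {n : ℕ} {Y : Set (PP K n)} {φ : Fin n → K}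

/-- The affine chart `φ ≠ 0` of `Y`, realized as the slice `φ = 1` of the affine cone. -/
def chart (Y : Set (PP K n)) (φ : Fin n → K) : Set (Fin n → K) :=
  {w | w ∈ cone Y ∧ ∑ i, φ i * w i = 1}

theorem mem_chartIdeal_iff {p : MvPolynomial (Fin n) K} :
    p ∈ vanishingIdeal K (chart Y φ) ↔ ∀ w ∈ chart Y φ, eval w p = 0 := by
  simp [mem_vanishingIdeal_iff]

theorem linForm_sub_one_mem : linForm φ - 1 ∈ vanishingIdeal K (chart Y φ) := by
  rw [mem_chartIdeal_iff]
  intro w hw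
  rw [map_sub, eval_linForm, hw.2, map_one, sub_self]

theorem vanishingIdeal_cone_le : vanishingIdeal K (cone Y) ≤ vanishingIdeal K (chart Y φ) :=
  vanishingIdeal_anti_mono fun _ hw => hw.1

theorem smul_rep_mem_chart {x : PP K n} (hx : x ∈ Y) (hxφ : x ∉ hyp φ) :
    (∑ i, φ i * x.rep i)⁻¹ • x.rep ∈ chart Y φ := by
  have h0 : ∑ i, φ i * x.rep i ≠ 0 := fun h => hxφ (by
    rw [← x.mk_rep]; exact (mk_mem_hyp_iff _).2 h)
  refine ⟨mem_cone_smul (rep_mem_cone.2 hx) (inv_ne_zero h0), ?_⟩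
  simp only [Pi.smul_apply, smul_eq_mul, mul_left_comm _ (_)⁻¹, ← Finset.mul_sum]
  exact inv_mul_cancel₀ h0

theorem isPrime_chartIdeal [Infinite K] (hY : ZIrred Y) (hφ : ¬ Y ⊆ hyp φ) :
    (vanishingIdeal K (chart Y φ)).IsPrime := by
  have hJ := hY.isPrime_vanishingIdeal
  rw [Ideal.isPrime_iff]
  constructor
  · intro h
    obtain ⟨x, hx, hxφ⟩ := Set.not_subset.1 hφ
    have := mem_chartIdeal_iff.1 ((Ideal.eq_top_iff_one _).1 h) _ (smul_rep_mem_chart hx hxφ)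
    simp at this
  · intro f g hfg
    rw [mem_chartIdeal_iff] at hfg
    have hmem : linForm φ * (homogenize (linForm φ) f * homogenize (linForm φ) g) ∈
        vanishingIdeal K (cone Y) := by
      rw [mem_vanishingIdeal_iff]
      intro v hv
      rw [aeval_eq_eval, map_mul, map_mul]
      by_cases h0 : eval v (linForm φ) = 0
      · rw [h0, zero_mul]
      · rw [eval_homogenize _ _ h0, eval_homogenize _ _ h0]
        have := hfg ((eval v (linForm φ))⁻¹ • v) ⟨mem_cone_smul hv (inv_ne_zero h0), by
          simp only [Pi.smul_apply, smul_eq_mul, mul_left_comm _ (_)⁻¹, ← Finset.mul_sum]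
          rw [← eval_linForm]
          exact inv_mul_cancel₀ h0⟩
        rw [map_mul] at this
        linear_combination (eval v (linForm φ) * eval v (linForm φ) ^ f.totalDegree *
          eval v (linForm φ) ^ g.totalDegree) * this
    have hback : ∀ f, homogenize (linForm φ) f ∈ vanishingIdeal K (cone Y) →
        f ∈ vanishingIdeal K (chart Y φ) := by
      intro f hf
      rw [mem_chartIdeal_iff]
      intro w hw
      have h1 : eval w (linForm φ) = 1 := by rw [eval_linForm, hw.2]
      have := mem_chartIdeal_iff.1 (vanishingIdeal_cone_le hf) w hw
      rw [eval_homogenize _ _ (by rw [h1]; exact one_ne_zero), h1] at this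
      simpa using this
    rcases hJ.mem_or_mem hmem with h | h
    · exfalso
      refine hφ fun x hx => ?_
      have := (mem_vanishingIdeal_iff.1 h) x.rep (rep_mem_cone.2 hx)
      rw [← x.mk_rep, mk_mem_hyp_iff, ← eval_linForm]
      simpa using this
    · exact (hJ.mem_or_mem h).imp (hback f) (hback g)

/-- The coordinate ring of the affine chart `φ ≠ 0`. -/
abbrev chartRing (Y : Set (PP K n)) (φ : Fin n → K) : Type :=
  MvPolynomial (Fin n) K ⧸ vanishingIdeal K (chart Y φ)

/-- The quotient map onto the coordinate ring of the chart. -/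
noncomputable abbrev toChartRing (Y : Set (PP K n)) (φ : Fin n → K) :
    MvPolynomial (Fin n) K →ₐ[K] chartRing Y φ :=
  Ideal.Quotient.mkₐ K (vanishingIdeal K (chart Y φ))

theorem toChartRing_eq_iff {p q : MvPolynomial (Fin n) K} :
    toChartRing Y φ p = toChartRing Y φ q ↔ ∀ w ∈ chart Y φ, eval w p = eval w q := by
  rw [Ideal.Quotient.mkₐ_eq_mk, Ideal.Quotient.eq, mem_chartIdeal_iff]
  simp [sub_eq_zero]

theorem toChartRing_surjective : Function.Surjective (toChartRing Y φ) :=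
  Ideal.Quotient.mkₐ_surjective _ _

theorem exists_algHom_of_mem_chart {w : Fin n → K} (hw : w ∈ chart Y φ) :
    ∃ χ : chartRing Y φ →ₐ[K] K, ∀ p, χ (toChartRing Y φ p) = eval w p :=
  ⟨Ideal.Quotient.liftₐ _ (aeval w) fun p hp => by simpa using mem_chartIdeal_iff.1 hp w hw,
    fun p => by simp⟩

/-- The point of affine space at which a character of the coordinate ring evaluates. -/
noncomputable def chartPoint (χ : chartRing Y φ →ₐ[K] K) : Fin n → K :=
  fun j => χ (toChartRing Y φ (X j))

theorem algHom_toChartRing (χ : chartRing Y φ →ₐ[K] K) (p : MvPolynomial (Fin n) K) :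
    χ (toChartRing Y φ p) = eval (chartPoint χ) p := by
  have : χ.comp (toChartRing Y φ) = aeval (chartPoint χ) := by
    ext j
    simp [chartPoint]
  simpa using DFunLike.congr_fun this p

theorem chartPoint_mem [Infinite K] (hY : ZClosed Y) (χ : chartRing Y φ →ₐ[K] K) :
    chartPoint χ ∈ chart Y φ := by
  have hz : ∀ p ∈ vanishingIdeal K (chart Y φ), eval (chartPoint χ) p = 0 := fun p hp => by
    rw [← algHom_toChartRing, Ideal.Quotient.mkₐ_eq_mk, Ideal.Quotient.eq_zero_iff_mem.2 hp,
      map_zero]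
  have h1 : ∑ i, φ i * chartPoint χ i = 1 := by
    have := hz _ linForm_sub_one_mem
    rwa [map_sub, eval_linForm, map_one, sub_eq_zero] at this
  have h0 : chartPoint χ ≠ 0 := fun h => by simp [h] at h1
  exact ⟨⟨h0, (hY.mk_mem_iff _ h0).2 fun p hp => hz p (vanishingIdeal_cone_le hp)⟩, h1⟩

theorem chartPoint_injective : Function.Injective (chartPoint (Y := Y) (φ := φ)) := by
  intro χ ψ h
  apply AlgHom.ext
  intro r
  obtain ⟨p, rfl⟩ := toChartRing_surjective r
  rw [algHom_toChartRing, algHom_toChartRing, h]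

theorem eq_of_mk_eq_of_mem_chart {v w : Fin n → K} (hv : v ∈ chart Y φ) (hw : w ∈ chart Y φ)
    (h : Projectivization.mk K v hv.1.1 = Projectivization.mk K w hw.1.1) : v = w := by
  obtain ⟨a, rfl⟩ := (Projectivization.mk_eq_mk_iff' K _ _ _ _).1 h
  have := hv.2
  simp only [Pi.smul_apply, smul_eq_mul, mul_left_comm _ a, ← Finset.mul_sum, hw.2, mul_one] at this
  rw [this, one_smul]

/-- The polynomial functions of degree at most one. -/
noncomputable def chartLinear (Y : Set (PP K n)) (φ : Fin n → K) : Submodule K (chartRing Y φ) :=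
  (restrictTotalDegree (Fin n) K 1).map (toChartRing Y φ).toLinearMap

theorem mem_chartLinear_pow {k : ℕ} {r : chartRing Y φ} :
    r ∈ chartLinear Y φ ^ k ↔ ∃ p, p.totalDegree ≤ k ∧ toChartRing Y φ p = r := by
  rw [chartLinear, ← Submodule.map_pow, Submodule.mem_map]
  exact exists_congr fun p => and_congr_left' ⟨totalDegree_le_of_mem_pow,
    mem_restrictTotalDegree_one_pow⟩

theorem one_mem_chartLinear : 1 ∈ chartLinear Y φ := by
  rw [← pow_one (chartLinear Y φ), mem_chartLinear_pow]
  exact ⟨1, by simp, map_one _⟩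

theorem fg_chartLinear : (chartLinear Y φ).FG :=
  (Module.Finite.iff_fg.1 inferInstance : (restrictTotalDegree (Fin n) K 1).FG).map _

theorem adjoin_eq_top_of_X_mem {A : Set (chartRing Y φ)}
    (h : ∀ j, toChartRing Y φ (X j) ∈ Algebra.adjoin K A) : Algebra.adjoin K A = ⊤ := by
  rw [eq_top_iff]
  intro r _
  obtain ⟨p, rfl⟩ := toChartRing_surjective r
  induction p using MvPolynomial.induction_on with
  | C c => exact Subalgebra.algebraMap_mem _ c
  | add p q hp hq => rw [map_add]; exact add_mem (hp trivial) (hq trivial)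
  | mul_X p j hp => rw [map_mul]; exact mul_mem (hp trivial) (h j)

theorem adjoin_chartLinear :
    Algebra.adjoin K (chartLinear Y φ : Set (chartRing Y φ)) = ⊤ :=
  adjoin_eq_top_of_X_mem fun j => Algebra.subset_adjoin (by
    rw [SetLike.mem_coe, ← pow_one (chartLinear Y φ), mem_chartLinear_pow]
    exact ⟨X j, (totalDegree_X (R := K) j).le, rfl⟩)

/-- If `φ` and `ψ` have no common zero on `Y` then the affine chart is filtered by `ψ / φ`. -/
theorem isFiltered_linForm [IsAlgClosed K] (hY : ZClosed Y) {ψ : Fin n → K}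
    (hψ : ∀ x ∈ Y, x ∈ hyp φ → x ∉ hyp ψ) :
    IsFiltered (chartLinear Y φ) (toChartRing Y φ (linForm ψ)) := by
  have : Infinite K := IsAlgClosed.instInfinite
  set J := vanishingIdeal K (cone Y)
  obtain ⟨D, hD⟩ := exists_monomial_mem (J ⊔ Ideal.span {linForm φ, linForm ψ}) (by
    intro w hw
    by_contra h0
    refine hψ (Projectivization.mk K w h0) ((hY.mk_mem_iff w h0).2 fun p hp =>
      hw p (Ideal.mem_sup_left hp)) ?_ ?_
    · rw [mk_mem_hyp_iff, ← eval_linForm]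
      exact hw _ (Ideal.mem_sup_right (Ideal.subset_span (by simp)))
    · rw [mk_mem_hyp_iff, ← eval_linForm]
      exact hw _ (Ideal.mem_sup_right (Ideal.subset_span (by simp))))
  refine ⟨D, fun k hk r hr => ?_⟩
  obtain ⟨p, hp, rfl⟩ := mem_chartLinear_pow.1 hr
  have hcomp : ∀ j (q : MvPolynomial (Fin n) K), j ≤ k →
      toChartRing Y φ (homogeneousComponent j q) ∈ chartLinear Y φ ^ k := fun j q hj =>
    mem_chartLinear_pow.2 ⟨_, (homogeneousComponent_isHomogeneous j q).totalDegree_le.trans hj, rfl⟩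
  have htop : toChartRing Y φ (homogeneousComponent (k + 1) p) ∈ chartLinear Y φ ^ k ⊔
      (chartLinear Y φ ^ k).map (LinearMap.mulLeft K (toChartRing Y φ (linForm ψ))) := by
    have hmem := mem_of_monomial_mem hD (homogeneousComponent_isHomogeneous (k + 1) p) (by omega)
    obtain ⟨q, hq, u, hu, hqu⟩ := Submodule.mem_sup.1 hmem
    obtain ⟨g, g', rfl⟩ := Ideal.mem_span_pair.1 hu
    have heq := congrArg (homogeneousComponent (k + 1)) hqu
    rw [homogeneousComponent_of_mem (homogeneousComponent_isHomogeneous (k + 1) p), if_pos rfl,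
      map_add, map_add, mul_comm g, mul_comm g',
      homogeneousComponent_mul_of_isHomogeneous_one (isHomogeneous_linForm φ),
      homogeneousComponent_mul_of_isHomogeneous_one (isHomogeneous_linForm ψ)] at heq
    have h1 : toChartRing Y φ (homogeneousComponent (k + 1) q) = 0 :=
      Ideal.Quotient.eq_zero_iff_mem.2
        (vanishingIdeal_cone_le (homogeneousComponent_mem_vanishingIdeal_cone hq (k + 1)))
    have h2 : toChartRing Y φ (linForm φ) = 1 := by
      rw [← map_one (toChartRing Y φ), ← sub_eq_zero, ← map_sub]
      exact Ideal.Quotient.eq_zero_iff_mem.2 linForm_sub_one_mem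
    rw [← heq, map_add, map_add, map_mul, map_mul, h1, h2, zero_add, one_mul]
    exact Submodule.add_mem_sup (hcomp k g le_rfl) ⟨_, hcomp k g' le_rfl, rfl⟩
  have hsum : p = ∑ j ∈ Finset.range (k + 2), homogeneousComponent j p := by
    conv_lhs => rw [← sum_homogeneousComponent p]
    refine Finset.sum_subset (Finset.range_subset_range.2 (by omega)) fun j _ hj => ?_
    exact homogeneousComponent_eq_zero _ _ (by simpa using hj)
  rw [hsum, Finset.sum_range_succ, map_add, map_sum]
  exact add_mem (Submodule.mem_sup_left (Submodule.sum_mem _ fun j hj =>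
    hcomp j p (by rw [Finset.mem_range] at hj; omega))) htop

end Chart

/-- A bound for hyperplane sections of a curve `Y`, from bounds for the general members of
finitely many pencils `⟨φ, l i⟩` without base points on `Y` whose quotients `l i / φ` generate the
coordinate ring of the chart `φ ≠ 0`. -/
theorem ncard_inter_hyp_le [IsAlgClosed K] {n : ℕ} {Y : Set (PP K n)} (hY : IsMinimalInfinite Y)
    {φ : Fin n → K} {ι : Type} [Finite ι] [Nonempty ι] {l : ι → Fin n → K}
    (hbase : ∀ i, ∀ x ∈ Y, x ∈ hyp φ → x ∉ hyp (l i))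
    (hgen : ∀ j, ∃ q : MvPolynomial ι K, ∀ w ∈ chart Y φ,
      w j = eval (fun i => ∑ k, l i k * w k) q)
    {d : ℕ} (hpencil : ∀ i, ∃ B : Set K, B.Finite ∧ ∀ τ ∉ B,
      (Y ∩ hyp (l i - τ • φ)).Finite ∧ (Y ∩ hyp (l i - τ • φ)).ncard ≤ d)
    {η : Fin n → K} (hη : ¬ Y ⊆ hyp η) (hηφ : ∀ x ∈ Y, x ∈ hyp η → x ∉ hyp φ) :
    (Y ∩ hyp η).ncard ≤ d := by
  have : Infinite K := IsAlgClosed.instInfinite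
  have hYc : ZClosed Y := hY.1
  obtain hempty | ⟨x₀, hx₀, hx₀η⟩ := (Y ∩ hyp η).eq_empty_or_nonempty
  · simp [hempty]
  have hφ : ¬ Y ⊆ hyp φ := fun h => hηφ x₀ hx₀ hx₀η (h hx₀)
  have hprime := isPrime_chartIdeal hY.zIrred hφ
  have hfinη : (Y ∩ hyp η).Finite := hY.finite_inter (zClosed_hyp η) hη
  have hfinφ : (Y ∩ hyp φ).Finite := hY.finite_inter (zClosed_hyp φ) hφ
  have hpt : ∀ x : PP K n, ∃ χ : chartRing Y φ →ₐ[K] K, x ∈ Y → x ∉ hyp φ →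
      ∀ p, χ (toChartRing Y φ p) = eval ((∑ i, φ i * x.rep i)⁻¹ • x.rep) p := fun x => by
    by_cases hx : x ∈ Y ∧ x ∉ hyp φ
    · obtain ⟨χ, hχ⟩ := exists_algHom_of_mem_chart (smul_rep_mem_chart hx.1 hx.2)
      exact ⟨χ, fun _ _ => hχ⟩
    · obtain ⟨χ, hχ⟩ := exists_algHom_of_mem_chart
        (smul_rep_mem_chart hx₀ (hηφ x₀ hx₀ hx₀η))
      exact ⟨χ, fun h h' => absurd ⟨h, h'⟩ hx⟩
  choose χ hχ using hpt
  have hne : ∀ x ∈ Y, x ∉ hyp φ → (∑ i, φ i * x.rep i) ≠ 0 := fun x _ hxφ h0 => hxφ (by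
    rw [← x.mk_rep]; exact (mk_mem_hyp_iff _).2 h0)
  have hχinj : Set.InjOn χ (Y \ hyp φ) := by
    intro x hx y hy hxy
    have hv : (∑ i, φ i * x.rep i)⁻¹ • x.rep = (∑ i, φ i * y.rep i)⁻¹ • y.rep := by
      funext j
      have h1 := hχ x hx.1 hx.2 (X j)
      have h2 := hχ y hy.1 hy.2 (X j)
      rw [eval_X] at h1 h2
      rw [← h1, ← h2, hxy]
    rw [← x.mk_rep, ← y.mk_rep, Projectivization.mk_eq_mk_iff']
    refine ⟨(∑ i, φ i * x.rep i) * (∑ i, φ i * y.rep i)⁻¹, ?_⟩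
    rw [mul_smul, ← hv, smul_smul, mul_inv_cancel₀ (hne x hx.1 hx.2), one_smul]
  have hnf : ¬ Module.Finite K (chartRing Y φ) := fun hf => by
    have : (Y \ hyp φ).Finite := Set.Finite.of_finite_image (Set.toFinite (χ '' _)) hχinj
    refine hY.2.1 ((this.union hfinφ).subset fun x hx => ?_)
    by_cases h : x ∈ hyp φ
    exacts [Or.inr ⟨hx, h⟩, Or.inl ⟨hx, h⟩]
  have hbound := card_le_of_generators (R := chartRing Y φ) (W := chartLinear Y φ)
    one_mem_chartLinear fg_chartLinear adjoin_chartLinear hnf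
    (a := fun i => toChartRing Y φ (linForm (l i)))
    (adjoin_eq_top_of_X_mem fun j => by
      obtain ⟨q, hq⟩ := hgen j
      have : toChartRing Y φ (X j) = aeval (fun i => toChartRing Y φ (linForm (l i))) q := by
        have h2 : aeval (fun i => toChartRing Y φ (linForm (l i))) q =
            toChartRing Y φ (aeval (fun i => linForm (l i)) q) := by
          rw [← MvPolynomial.comp_aeval_apply]
        rw [h2, toChartRing_eq_iff]
        intro w hw
        rw [eval_X, hq w hw, eval_aeval]
        simp only [eval_linForm]
      rw [this, Algebra.adjoin_range_eq_range_aeval]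
      exact ⟨q, rfl⟩)
    (fun i => isFiltered_linForm hYc (hbase i))
    (d := d) (fun i => by
      obtain ⟨B, hB, hBd⟩ := hpencil i
      refine ⟨B, hB, fun τ hτ s hs => ?_⟩
      obtain ⟨hf, hle⟩ := hBd τ hτ
      rw [← Set.ncard_coe_finset]
      refine le_trans (Set.ncard_le_ncard_of_injOn
        (fun ψ => Projectivization.mk K (chartPoint ψ) (chartPoint_mem hYc ψ).1.1) ?_ ?_ hf) hle
      · intro ψ hψ
        refine ⟨(chartPoint_mem hYc ψ).1.2, ?_⟩
        have h1 := hs ψ hψ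
        rw [algHom_toChartRing, eval_linForm] at h1
        rw [mk_mem_hyp_iff]
        simp only [Pi.sub_apply, Pi.smul_apply, smul_eq_mul, sub_mul, Finset.sum_sub_distrib,
          mul_assoc, ← Finset.mul_sum, h1, (chartPoint_mem hYc ψ).2, mul_one, sub_self]
      · intro ψ _ ψ' _ h
        exact chartPoint_injective (eq_of_mk_eq_of_mem_chart (chartPoint_mem hYc ψ)
          (chartPoint_mem hYc ψ') h))
    (y := toChartRing Y φ (linForm η))
    (by
      rw [← pow_one (chartLinear Y φ), mem_chartLinear_pow]
      exact ⟨_, (isHomogeneous_linForm η).totalDegree_le, rfl⟩)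
    (by
      intro h0
      rw [← map_zero (toChartRing Y φ), toChartRing_eq_iff] at h0
      obtain ⟨x, hx, hxn⟩ := (hY.2.1.sdiff (hfinη.union hfinφ)).nonempty
      have hxφ : x ∉ hyp φ := fun h => hxn (Or.inr ⟨hx, h⟩)
      have h1 := h0 _ (smul_rep_mem_chart hx hxφ)
      rw [eval_linForm, map_zero] at h1
      refine hxn (Or.inl ⟨hx, ?_⟩)
      rw [← x.mk_rep, mk_mem_hyp_iff]
      simp only [Pi.smul_apply, smul_eq_mul, mul_left_comm _ (_)⁻¹, ← Finset.mul_sum] at h1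
      exact (mul_eq_zero.1 h1).resolve_left (inv_ne_zero (hne x hx hxφ)))
    (hfinη.image χ).toFinset
    (by
      intro ψ hψ
      obtain ⟨x, ⟨hx, hxη⟩, rfl⟩ := (Set.Finite.mem_toFinset _).1 hψ
      rw [hχ x hx (hηφ x hx hxη), eval_linForm]
      simp only [Pi.smul_apply, smul_eq_mul, mul_left_comm _ (_)⁻¹, ← Finset.mul_sum]
      rw [← x.mk_rep, mk_mem_hyp_iff] at hxη
      rw [hxη, mul_zero])
  have hinj : Set.InjOn χ (Y ∩ hyp η) := hχinj.mono fun x hx =>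
    (⟨hx.1, hηφ x hx.1 hx.2⟩ : x ∈ Y \ hyp φ)
  rwa [← Set.ncard_eq_toFinset_card _ (hfinη.image χ), hinj.ncard_image] at hbound

/-- A subspace over an infinite field is not covered by finitely many subspaces not containing
it. -/
theorem exists_mem_forall_notMem [Infinite K] {E ι : Type*} [AddCommGroup E] [Module K E]
    (M : Submodule K E) {s : Set ι} (hs : s.Finite) {N : ι → Submodule K E}
    (h : ∀ i ∈ s, ¬ M ≤ N i) : ∃ q ∈ M, ∀ i ∈ s, q ∉ N i := by
  classical
  have hne := Subspace.biUnion_ne_univ_of_top_notMem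
    (s := (hs.image fun i => (N i).comap M.subtype).toFinset) (by
      intro hmem
      obtain ⟨i, hi, htop⟩ := (Set.Finite.mem_toFinset _).1 hmem
      exact h i hi fun x hx =>
        (by simpa using htop.ge (Submodule.mem_top (x := (⟨x, hx⟩ : M))) : x ∈ N i))
  obtain ⟨q, hq⟩ := (Set.ne_univ_iff_exists_notMem _).1 hne
  refine ⟨q, q.2, fun i hi hqi => hq ?_⟩
  exact Set.mem_biUnion (x := (N i).comap M.subtype)
    ((Set.Finite.mem_toFinset _).2 ⟨i, hi, rfl⟩) hqi

/-- A functional vanishing on a subspace and at none of finitely many vectors outside it. -/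
theorem exists_functional [Infinite K] {n : ℕ} (P : Submodule K (Fin n → K))
    {Z : Set (Fin n → K)} (hZ : Z.Finite) (h : ∀ z ∈ Z, z ∉ P) :
    ∃ f : Fin n → K, (∀ v ∈ P, f ⬝ᵥ v = 0) ∧ ∀ z ∈ Z, f ⬝ᵥ z ≠ 0 := by
  obtain ⟨f, hf, hfZ⟩ := exists_mem_forall_notMem P.dualAnnihilator hZ
    (N := fun z => LinearMap.ker (Module.Dual.eval K (Fin n → K) z)) (fun z hz hle => by
      obtain ⟨f, hfz, hfP⟩ := Submodule.exists_le_ker_of_notMem (h z hz)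
      exact hfz (hle ((Submodule.mem_dualAnnihilator _).2 fun v hv => hfP hv)))
  obtain ⟨f, rfl⟩ := (dotProductEquiv K (Fin n)).surjective f
  exact ⟨f, fun v hv => (Submodule.mem_dualAnnihilator _).1 hf v hv, fun z hz h0 => hfZ z hz h0⟩

/-- A proper closed subset of an irreducible surface meets every plane avoiding finitely many of
its points in a finite set. -/
theorem exists_finite_probe [Infinite K] {n : ℕ} {S T : Set (PP K n)} (hS : ZClosed S)
    (hSi : ZIrred S) (hdim : ¬ dimGE S 3) (hT : ZClosed T) (hTS : T ⊆ S) (hST : ¬ S ⊆ T) :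
    ∃ Z ⊆ T, Z.Finite ∧ ∀ f : Fin n → K, (∀ z ∈ Z, z ∉ hyp f) → (T ∩ hyp f).Finite := by
  obtain ⟨𝒵, hfin, h𝒵, rfl⟩ := hT.exists_components
  have : Nonempty (PP K n) := ⟨hSi.1.some⟩
  have : ∀ Z ∈ 𝒵, ∃ z, z ∈ Z := fun Z hZ => (h𝒵 Z hZ).2.1
  choose! z hz using this
  refine ⟨z '' 𝒵, ?_, hfin.image z, fun f hf => ?_⟩
  · rintro _ ⟨Z, hZ, rfl⟩
    exact Set.mem_biUnion hZ (hz Z hZ)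
  · rw [Set.iUnion₂_inter]
    refine hfin.biUnion fun Z hZ => ?_
    have hZT : Z ⊆ ⋃ Z ∈ 𝒵, Z := Set.subset_biUnion_of_mem (u := fun Z => Z) hZ
    refine finite_of_ssubset_of_not_dimGE hS hSi hdim (h𝒵 Z hZ).1 (h𝒵 Z hZ).2
      ⟨hZT.trans hTS, fun h => hST (h.trans hZT)⟩ ((h𝒵 Z hZ).1.inter (zClosed_hyp f))
      ⟨Set.inter_subset_left, fun h => hf _ ⟨Z, hZ, rfl⟩ (h (hz Z hZ)).2⟩

theorem plucker_sub_smul_left (a b c : Fin 4 → K) (τ : K) :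
    plucker (a - τ • b) c = plucker a c - τ • plucker b c := by
  ext i; fin_cases i <;> simp [plucker] <;> ring

theorem orthVec_sub_smul (w z : Fin 6 → K) (τ : K) :
    orthVec (w - τ • z) = orthVec w - τ • orthVec z := by
  ext i; fin_cases i <;> simp [orthVec] <;> ring

theorem mem_hyp_orthVec_iff {w : Fin 6 → K} (hw : IsLineRep w) {y : PP K 6} (hy : y ∈ grass K) :
    y ∈ hyp (orthVec w) ↔
      ∃ p, p ∈ lineOf (Projectivization.mk K w hw.1) ∧ p ∈ lineOf y := by
  rw [← y.mk_rep, mk_mem_hyp_iff, sum_orthVec, hw.plPair_eq_zero_iff (isLineRep_rep hy), y.mk_rep]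
  constructor
  · rintro ⟨v, hv, h1, h2⟩
    exact ⟨Projectivization.mk K v hv, (mk_mem_lineOf_mk_iff hw.1 hv).2 h1,
      (mk_mem_lineOf_iff hv).2 h2⟩
  · rintro ⟨p, h1, h2⟩
    rw [← p.mk_rep, mk_mem_lineOf_mk_iff] at h1
    exact ⟨p.rep, p.rep_nonzero, h1, mem_lineOf_iff.1 h2⟩

theorem mem_lineOf_mk_plucker_iff {u v : Fin 4 → K} (h : plucker u v ≠ 0) {p : PP K 4} :
    p ∈ lineOf (Projectivization.mk K (plucker u v) h) ↔ ∃ a b : K, p.rep = a • u + b • v := by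
  conv_lhs => rw [← p.mk_rep]
  rw [mk_mem_lineOf_mk_iff, wedgePt_plucker_iff h]

theorem isLineRep_plucker {u v : Fin 4 → K} (h : LinearIndependent K ![u, v]) :
    IsLineRep (plucker u v) := by
  refine ⟨plucker_ne_zero (h.ne_zero 0) fun c hc => ?_, plQuad_plucker u v⟩
  have := LinearIndependent.pair_iff.1 h (-c) 1 (by rw [hc]; simp)
  exact one_ne_zero this.2

section Pencil

variable {S : Set (PP K 4)} {Y : Set (PP K 6)} {a b c f : Fin 4 → K}

/-- A point on two distinct lines of the pencil through `c` in the plane `⟨a, b, c⟩` is `c`. -/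
theorem eq_mk_of_mem_pencil (hind : ∀ x y z : K, x • a + y • b + z • c = 0 → x = 0 ∧ y = 0 ∧ z = 0)
    (hc : c ≠ 0) {p : PP K 4} {σ τ x y z w : K} (hστ : σ ≠ τ)
    (h1 : p.rep = x • (a - σ • b) + y • c) (h2 : p.rep = z • (a - τ • b) + w • c) :
    p = Projectivization.mk K c hc := by
  obtain ⟨hx, hy, -⟩ := hind (x - z) (-(x * σ) + z * τ) (y - w) (by
    have := h1.symm.trans h2
    rw [← sub_eq_zero] at this
    rw [← this]
    module)
  have hz : z = 0 := by
    have : z * (τ - σ) = 0 := by linear_combination hy + σ * hx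
    exact (mul_eq_zero.1 this).resolve_right (sub_ne_zero.2 hστ.symm)
  rw [← p.mk_rep, Projectivization.mk_eq_mk_iff']
  exact ⟨w, by rw [h2, hz, zero_smul, zero_add]⟩

theorem isLineRep_pencil (hind : ∀ x y z : K, x • a + y • b + z • c = 0 → x = 0 ∧ y = 0 ∧ z = 0)
    (τ : K) : IsLineRep (plucker (a - τ • b) c) :=
  isLineRep_plucker (LinearIndependent.pair_iff.2 fun s t hst => by
    obtain ⟨h1, -, h2⟩ := hind s (-(s * τ)) t (by rw [← hst]; module)
    exact ⟨h1, h2⟩)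

theorem subset_hyp_or_mem_of_mem_pencil
    (hind : ∀ x y z : K, x • a + y • b + z • c = 0 → x = 0 ∧ y = 0 ∧ z = 0)
    (hfa : f ⬝ᵥ a = 0) (hfb : f ⬝ᵥ b = 0) (hfc : f ⬝ᵥ c = 0) (hc : c ≠ 0) {y : PP K 6}
    (hy : y ∈ grass K) (h1 : y ∈ hyp (orthVec (plucker a c)))
    (h2 : y ∈ hyp (orthVec (plucker b c))) :
    lineOf y ⊆ hyp f ∨ Projectivization.mk K c hc ∈ lineOf y := by
  have hac : IsLineRep (plucker a c) := by simpa using isLineRep_pencil hind 0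
  have hbc : IsLineRep (plucker b c) := by
    simpa using isLineRep_pencil (a := b) (b := a) (c := c) (fun x y z h => by
      obtain ⟨hy, hx, hz⟩ := hind y x z (by rw [← h]; module)
      exact ⟨hx, hy, hz⟩) 0
  obtain ⟨p, hp, hpy⟩ := (mem_hyp_orthVec_iff hac hy).1 h1
  obtain ⟨q, hq, hqy⟩ := (mem_hyp_orthVec_iff hbc hy).1 h2
  obtain ⟨x, z, hp⟩ := (mem_lineOf_mk_plucker_iff hac.1).1 hp
  obtain ⟨x', z', hq⟩ := (mem_lineOf_mk_plucker_iff hbc.1).1 hq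
  by_cases hpq : p = q
  · right
    have hx := (hind x (-x') (z - z') (by
      have := hp.symm.trans (hpq ▸ hq)
      rw [← sub_eq_zero] at this
      rw [← this]
      module)).1
    have : p = Projectivization.mk K c hc := by
      rw [← p.mk_rep, Projectivization.mk_eq_mk_iff']
      exact ⟨z, by rw [hp, hx, zero_smul, zero_add]⟩
    exact this ▸ hpy
  · left
    refine lineOf_subset_hyp hy hpq hpy hqy (mem_hyp_iff.2 ?_) (mem_hyp_iff.2 ?_)
    · simp [hp, hfa, hfc]
    · simp [hq, hfb, hfc]

/-- The general line of a pencil through a point `c ∉ S` in a plane meets the curve of lines in at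
most `d` points. -/
theorem exists_pencil_bound {d : ℕ} (hdeg : HasSurfDeg S d) (hYS : Y ⊆ linesOf S)
    {T : Set (PP K 4)} (huniq : ∀ p ∈ S, p ∉ T → ∃! x, x ∈ linesOf S ∧ p ∈ lineOf x) (hTS : T ⊆ S)
    (hind : ∀ x y z : K, x • a + y • b + z • c = 0 → x = 0 ∧ y = 0 ∧ z = 0)
    (hfa : f ⬝ᵥ a = 0) (hfb : f ⬝ᵥ b = 0) (hfc : f ⬝ᵥ c = 0) (hfin : (T ∩ hyp f).Finite)
    (hc : c ≠ 0) (hcS : Projectivization.mk K c hc ∉ S) :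
    ∃ B : Set K, B.Finite ∧ ∀ τ ∉ B,
      (Y ∩ hyp (orthVec (plucker a c) - τ • orthVec (plucker b c))).Finite ∧
      (Y ∩ hyp (orthVec (plucker a c) - τ • orthVec (plucker b c))).ncard ≤ d := by
  have hbad : ∀ t ∈ T, {τ : K | ∃ x y : K, t.rep = x • (a - τ • b) + y • c}.Subsingleton := by
    rintro t ht σ ⟨x, y, h1⟩ τ ⟨z, w, h2⟩
    by_contra hστ
    exact hcS (eq_mk_of_mem_pencil hind hc hστ h1 h2 ▸ hTS ht)
  refine ⟨⋃ t ∈ T ∩ hyp f, {τ : K | ∃ x y : K, t.rep = x • (a - τ • b) + y • c},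
    hfin.biUnion fun t ht => (hbad t ht.1).finite, fun τ hτ => ?_⟩
  have hline := isLineRep_pencil hind τ
  rw [← orthVec_sub_smul, ← plucker_sub_smul_left]
  set l := Projectivization.mk K _ hline.1
  have havoid : ∀ p ∈ lineOf l, p ∉ T := fun p hp hpT => by
    obtain ⟨x, y, h⟩ := (mem_lineOf_mk_plucker_iff hline.1).1 hp
    refine hτ (Set.mem_biUnion (x := p) ⟨hpT, mem_hyp_iff.2 ?_⟩ ⟨x, y, h⟩)
    simp [h, hfa, hfb, hfc]
  have hcl : Projectivization.mk K c hc ∈ lineOf l :=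
    (mk_mem_lineOf_mk_iff _ _).2 ((wedgePt_plucker_iff hline.1).2 ⟨0, 1, by simp⟩)
  obtain ⟨hfinS, hle⟩ := hdeg.finite_inter hline.mk_mem_grass fun h => hcS (h hcl)
  have hmeet : ∀ y ∈ Y ∩ hyp (orthVec (plucker (a - τ • b) c)),
      ∃ p, p ∈ lineOf l ∧ p ∈ lineOf y := fun y hy =>
    (mem_hyp_orthVec_iff hline (hYS hy.1).1).1 hy.2
  have : Nonempty (PP K 4) := ⟨Projectivization.mk K c hc⟩
  choose! g hgl hgy using hmeet
  have hmaps : Set.MapsTo g (Y ∩ hyp (orthVec (plucker (a - τ • b) c))) (S ∩ lineOf l) :=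
    fun y hy => ⟨(hYS hy.1).2 (hgy y hy), hgl y hy⟩
  have hinj : Set.InjOn g (Y ∩ hyp (orthVec (plucker (a - τ • b) c))) := fun y hy z hz hyz =>
    (huniq (g y) (hmaps hy).1 (havoid _ (hgl y hy))).unique ⟨hYS hy.1, hgy y hy⟩
      ⟨hYS hz.1, hyz ▸ hgy z hz⟩
  exact ⟨Set.Finite.of_injOn hmaps hinj hfinS,
    (Set.ncard_le_ncard_of_injOn g hmaps hinj hfinS).trans hle⟩

end Pencil

/-- The coordinates of a bivector in terms of its pairings with the wedges of four vectors. -/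
theorem det_mul_eq_sum_plPair (e₁ e₂ e₃ e₄ : Fin 4 → K) (w : Fin 6 → K) (j : Fin 6) :
    Matrix.det (Matrix.of ![e₁, e₂, e₃, e₄]) * w j =
      plPair (plucker e₃ e₄) w * plucker e₁ e₂ j - plPair (plucker e₂ e₄) w * plucker e₁ e₃ j +
      plPair (plucker e₂ e₃) w * plucker e₁ e₄ j + plPair (plucker e₁ e₄) w * plucker e₂ e₃ j -
      plPair (plucker e₁ e₃) w * plucker e₂ e₄ j + plPair (plucker e₁ e₂) w * plucker e₃ e₄ j := by
  rw [← plPair_plucker_eq_det]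
  fin_cases j <;> simp [plPair, plucker] <;> ring

theorem det_mul_plQuad (e₁ e₂ e₃ e₄ : Fin 4 → K) (w : Fin 6 → K) :
    Matrix.det (Matrix.of ![e₁, e₂, e₃, e₄]) * plQuad w =
      plPair (plucker e₃ e₄) w * plPair (plucker e₁ e₂) w -
      plPair (plucker e₂ e₄) w * plPair (plucker e₁ e₃) w +
      plPair (plucker e₂ e₃) w * plPair (plucker e₁ e₄) w := by
  rw [← plPair_plucker_eq_det]
  simp [plPair, plucker, plQuad]
  ring

theorem not_ker_le_span (f u v : Fin 4 → K) :
    ¬ LinearMap.ker (dotProductEquiv K (Fin 4) f) ≤ Submodule.span K {u, v} := by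
  classical
  intro h
  have h1 := Submodule.finrank_mono h
  have h2 := LinearMap.finrank_range_add_finrank_ker (dotProductEquiv K (Fin 4) f)
  have h3 := Submodule.finrank_le (LinearMap.range (dotProductEquiv K (Fin 4) f))
  have h4 : Module.finrank K (Submodule.span K ({u, v} : Set (Fin 4 → K))) ≤ 2 := by
    have := (finrank_span_finset_le_card (R := K) ({u, v} : Finset (Fin 4 → K))).trans
      Finset.card_le_two
    rwa [Finset.coe_pair] at this
  simp only [Module.finrank_fin_fun, Module.finrank_self] at h2 h3
  omega

theorem exists_dotProduct_eq_zero_notMem_span (f u v : Fin 4 → K) :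
    ∃ e, f ⬝ᵥ e = 0 ∧ e ∉ Submodule.span K {u, v} :=
  Set.not_subset.1 (not_ker_le_span f u v)

theorem mem_lineOf_mk_plucker_iff_mem_span {u v : Fin 4 → K} (h : plucker u v ≠ 0) {p : PP K 4} :
    p ∈ lineOf (Projectivization.mk K (plucker u v) h) ↔ p.rep ∈ Submodule.span K {u, v} := by
  simp only [mem_lineOf_mk_plucker_iff, Submodule.mem_span_pair, eq_comm]

/-- A line avoiding a proper closed subset `T` of a surface `S`, with two chosen points outside
`S`. -/
theorem exists_axis [IsAlgClosed K] {S T : Set (PP K 4)} {d : ℕ} (hS : ZClosed S) (hSi : ZIrred S)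
    (hdim : ¬ dimGE S 3) (hdeg : HasSurfDeg S d) (hT : ZClosed T) (hTS : T ⊆ S) (hST : ¬ S ⊆ T) :
    ∃ u v : Fin 4 → K, LinearIndependent K ![u, v] ∧
      (∀ h, Projectivization.mk K u h ∉ S) ∧ (∀ h, Projectivization.mk K v h ∉ S) ∧
      ∀ p ∈ T, p.rep ∉ Submodule.span K {u, v} := by
  have : Infinite K := IsAlgClosed.instInfinite
  obtain ⟨l, hl, hlS, -⟩ := hdeg.exists_line
  obtain ⟨p, -, hpS⟩ := Set.not_subset.1 hlS
  have hsingle : ∀ t ∈ S, t.rep ∉ Submodule.span K {p.rep} := fun t ht h => by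
    obtain ⟨a, ha⟩ := Submodule.mem_span_singleton.1 h
    refine hpS ?_
    rwa [← p.mk_rep, ← (Projectivization.mk_eq_mk_iff' K t.rep p.rep t.rep_nonzero
      p.rep_nonzero).2 ⟨a, ha⟩, t.mk_rep]
  obtain ⟨Z, hZT, hZ, hprobe⟩ := exists_finite_probe hS hSi hdim hT hTS hST
  obtain ⟨f, hfp, hfZ⟩ := exists_functional (Submodule.span K {p.rep}) (hZ.image (·.rep)) (by
    rintro _ ⟨z, hz, rfl⟩
    exact hsingle z (hTS (hZT hz)))
  have hfin := hprobe f fun z hz h => hfZ _ ⟨z, hz, rfl⟩ (mem_hyp_iff.1 h)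
  have hfp : f ⬝ᵥ p.rep = 0 := hfp _ (Submodule.mem_span_singleton_self _)
  obtain ⟨q, hqf, hq⟩ := exists_mem_forall_notMem (LinearMap.ker (dotProductEquiv K (Fin 4) f))
    (hfin.insert p) (N := fun t => Submodule.span K {p.rep, t.rep})
    fun t _ => not_ker_le_span f _ _
  have hqf : f ⬝ᵥ q = 0 := hqf
  have hqp : ∀ a : K, a • p.rep ≠ q := fun a ha => hq p (Set.mem_insert _ _)
    (Submodule.mem_span_pair.2 ⟨a, 0, by rw [ha, zero_smul, add_zero]⟩)
  have hind : ∀ c : K, LinearIndependent K ![q + c • p.rep, p.rep] := fun c => by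
    rw [LinearIndependent.pair_iff]
    intro s t hst
    have hs : s = 0 := by
      by_contra hs
      refine hqp (-(s⁻¹ * (s * c + t))) ?_
      have : s • q = -((s * c + t) • p.rep) := by
        rw [eq_neg_iff_add_eq_zero, ← hst]; module
      rw [neg_smul, mul_smul, ← smul_neg, ← this, smul_smul, inv_mul_cancel₀ hs, one_smul]
    rw [hs, zero_smul, zero_add] at hst
    exact ⟨hs, (smul_eq_zero.1 hst).resolve_right p.rep_nonzero⟩
  have hline := isLineRep_plucker (by simpa using hind 0 : LinearIndependent K ![q, p.rep])
  have hfinl := (hdeg.finite_inter hline.mk_mem_grass fun h => hpS (h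
    ((mem_lineOf_mk_plucker_iff hline.1).2 ⟨0, 1, by simp⟩))).1
  have hinj : Function.Injective fun c : K =>
      Projectivization.mk K (q + c • p.rep) ((hind c).ne_zero 0) := fun c c' h => by
    obtain ⟨a, ha⟩ := (Projectivization.mk_eq_mk_iff' K _ _ _ _).1 h
    have hi := LinearIndependent.pair_iff.1 (hind 0) (a - 1) (a * c' - c) (by
      rw [← sub_eq_zero] at ha; rw [← ha]; module)
    have ha1 : a = 1 := sub_eq_zero.1 hi.1
    rw [ha1, one_mul] at hi
    exact (sub_eq_zero.1 hi.2).symm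
  obtain ⟨c, hc⟩ := ((Set.Finite.preimage hinj.injOn hfinl).infinite_compl).nonempty
  refine ⟨q + c • p.rep, p.rep, hind c, fun h hS => hc ⟨hS, ?_⟩, fun h => by rwa [p.mk_rep],
    fun t ht htm => ?_⟩
  · exact (mk_mem_lineOf_mk_iff _ _).2 ((wedgePt_plucker_iff hline.1).2 ⟨1, c, by simp⟩)
  · obtain ⟨a, b, hab⟩ := Submodule.mem_span_pair.1 htm
    have ht' : t ∈ T ∩ hyp f := ⟨ht, mem_hyp_iff.2 (by rw [← hab]; simp [hqf, hfp])⟩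
    have ha : a ≠ 0 := by
      rintro rfl
      exact hsingle t (hTS ht) (Submodule.mem_span_singleton.2 ⟨b, by rw [← hab]; simp⟩)
    refine hq t (Set.mem_insert_of_mem _ ht') (Submodule.mem_span_pair.2
      ⟨-(a⁻¹ * (a * c + b)), a⁻¹, ?_⟩)
    rw [← hab]
    match_scalars
    · field_simp
      ring
    · field_simp

/-- A plane through a line not contained in `S` and avoiding `T`, containing no line of the
ruling `Y` and meeting `T` in finitely many points. -/
theorem exists_plane_of_axis [IsAlgClosed K] {S T : Set (PP K 4)} {Y : Set (PP K 6)} {d : ℕ}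
    (hS : ZClosed S) (hSi : ZIrred S) (hdim : ¬ dimGE S 3) (hdeg : HasSurfDeg S d)
    (hYS : Y ⊆ linesOf S) (hY : IsMinimalInfinite Y) (hskew : ∃ x ∈ Y, ∃ y ∈ Y, y ∉ polar x)
    (hT : ZClosed T) (hTS : T ⊆ S) (hST : ¬ S ⊆ T) {u v : Fin 4 → K}
    (huv : LinearIndependent K ![u, v]) (hu : ∀ h, Projectivization.mk K u h ∉ S)
    (hTuv : ∀ p ∈ T, p.rep ∉ Submodule.span K {u, v}) {z : Fin 4 → K}
    (hz : z ∉ Submodule.span K {u, v}) :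
    ∃ f : Fin 4 → K, f ⬝ᵥ u = 0 ∧ f ⬝ᵥ v = 0 ∧ f ⬝ᵥ z ≠ 0 ∧ (T ∩ hyp f).Finite ∧
      ∀ y ∈ Y, ¬ lineOf y ⊆ hyp f := by
  have : Infinite K := IsAlgClosed.instInfinite
  have hline := isLineRep_plucker huv
  set m := Projectivization.mk K _ hline.1 with hm
  have hmg : m ∈ grass K := hline.mk_mem_grass
  have hmS : ¬ lineOf m ⊆ S := fun h => hu (huv.ne_zero 0) (h ((mk_mem_lineOf_mk_iff _ _).2
    ((wedgePt_plucker_iff hline.1).2 ⟨1, 0, by simp⟩)))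
  have hpol : (Y ∩ polar m).Finite := hY.finite_inter (zClosed_polar m) fun h => by
    obtain ⟨s, -, hs⟩ := exists_subset_sigma2_of_subset_polar hYS hY.zIrred hmg
      (hdeg.finite_inter hmg hmS).1 h
    obtain ⟨x, hx, y, hy, hxy⟩ := hskew
    exact hxy ((mem_polar_iff_meet (hYS hx).1 (hYS hy).1).2 ⟨s, (hs hx).2, (hs hy).2⟩)
  have hoff : ∀ y ∈ Y, ∃ r ∈ lineOf y, r ∉ lineOf m := fun y hy => by
    refine Set.not_subset.1 fun h => hmS ?_
    rw [← lineOf_injOn (hYS hy).1 hmg h]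
    exact (hYS hy).2
  have : Nonempty (PP K 4) := ⟨hSi.1.some⟩
  choose! r hry hrm using hoff
  obtain ⟨Z, hZT, hZ, hprobe⟩ := exists_finite_probe hS hSi hdim hT hTS hST
  obtain ⟨f, hf, hfZ⟩ := exists_functional (Submodule.span K {u, v})
    (((hZ.union (hpol.image r)).image (·.rep)).insert z) (by
      rintro _ (rfl | ⟨p, hp | ⟨y, hy, rfl⟩, rfl⟩)
      · exact hz
      · exact hTuv p (hZT hp)
      · exact fun h => hrm y hy.1 ((mem_lineOf_mk_plucker_iff_mem_span hline.1).2 h))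
  have hfz := hfZ z (Set.mem_insert _ _)
  have hf0 : f ≠ 0 := by rintro rfl; simp at hfz
  refine ⟨f, hf _ (Submodule.subset_span (by simp)), hf _ (Submodule.subset_span (by simp)), hfz,
    hprobe f fun p hp h => hfZ p.rep (Or.inr ⟨p, Or.inl hp, rfl⟩) (mem_hyp_iff.1 h),
    fun y hy hyf => ?_⟩
  have hmf : lineOf m ⊆ hyp f := fun p hp =>
    mem_hyp_iff.2 (hf _ ((mem_lineOf_mk_plucker_iff_mem_span hline.1).1 hp))
  exact hfZ _ (Or.inr ⟨_, Or.inr ⟨y, ⟨hy, mem_polar_of_subset_hyp hmg (hYS hy).1 hf0 hmf hyf⟩, rfl⟩,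
    rfl⟩) (mem_hyp_iff.1 (hyf (hry y hy)))

theorem eq_zero_of_comb_eq_zero {u v e : Fin 4 → K} (huv : LinearIndependent K ![u, v])
    (he : e ∉ Submodule.span K {u, v}) {x y z : K} (h : x • e + y • u + z • v = 0) :
    x = 0 ∧ y = 0 ∧ z = 0 := by
  have hx : x = 0 := by
    by_contra hx
    refine he (Submodule.mem_span_pair.2 ⟨-(x⁻¹ * y), -(x⁻¹ * z), ?_⟩)
    have : x • e = -(y • u + z • v) := by rw [eq_neg_iff_add_eq_zero, ← h]; module
    calc _ = x⁻¹ • -(y • u + z • v) := by module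
      _ = e := by rw [← this, smul_smul, inv_mul_cancel₀ hx, one_smul]
  rw [hx, zero_smul, zero_add] at h
  exact ⟨hx, LinearIndependent.pair_iff.1 huv y z h⟩

/-- A hyperplane section of the curve of lines has at most `d` points. -/
theorem ncard_ruling_inter_hyp_le [IsAlgClosed K] {S : Set (PP K 4)} {Y : Set (PP K 6)} {d : ℕ}
    (hruled : IsRuled S) (hdeg : HasSurfDeg S d) (hYS : Y ⊆ linesOf S) (hY : IsMinimalInfinite Y)
    (hfin : (linesOf S \ Y).Finite) (hsweep : sweep Y = S)
    (hskew : ∃ x ∈ Y, ∃ y ∈ Y, y ∉ polar x) {η : Fin 6 → K} (hη : ¬ Y ⊆ hyp η) :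
    (Y ∩ hyp η).ncard ≤ d := by
  have : Infinite K := IsAlgClosed.instInfinite
  obtain ⟨hS, hSi, ⟨-, hdim⟩, -⟩ := hruled
  obtain ⟨T₀, hT₀, hST₀, huniq₀⟩ := exists_unique_line hSi hYS hY hfin hsweep hskew
  have hYη := hY.finite_inter (zClosed_hyp η) hη
  set T := S ∩ (T₀ ∪ ⋃ x ∈ Y ∩ hyp η, lineOf x) with hTdef
  have hU : ZClosed (⋃ x ∈ Y ∩ hyp η, lineOf x) :=
    Set.Finite.zClosed_biUnion hYη fun x _ => zClosed_lineOf x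
  have hT : ZClosed T := hS.inter (hT₀.union hU)
  have hTS : T ⊆ S := Set.inter_subset_left
  have hST : ¬ S ⊆ T := fun h => by
    rcases hSi.2 _ _ hT₀ hU (h.trans Set.inter_subset_right) with h | h
    · exact hST₀ h
    · obtain ⟨x, hx, hSx⟩ := hSi.exists_subset_of_biUnion hYη (fun x _ => zClosed_lineOf x) h
      exact not_subset_lineOf hYS hY.2.1 (hYS hx.1).1 hSx
  have huniq : ∀ p ∈ S, p ∉ T → ∃! x, x ∈ linesOf S ∧ p ∈ lineOf x := fun p hp hpT =>
    huniq₀ p hp fun h => hpT ⟨hp, Or.inl h⟩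
  obtain ⟨e₃, e₄, h34, h3S, h4S, hTm⟩ := exists_axis hS hSi hdim hdeg hT hTS hST
  obtain ⟨z, -, hz⟩ := exists_dotProduct_eq_zero_notMem_span 0 e₃ e₄
  obtain ⟨f₁, h13, h14, -, hfin₁, hno₁⟩ := exists_plane_of_axis hS hSi hdim hdeg hYS hY hskew hT
    hTS hST h34 h3S hTm hz
  obtain ⟨e₂, h12, he₂⟩ := exists_dotProduct_eq_zero_notMem_span f₁ e₃ e₄
  obtain ⟨f₂, h23, h24, h22, hfin₂, hno₂⟩ := exists_plane_of_axis hS hSi hdim hdeg hYS hY hskew hT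
    hTS hST h34 h3S hTm he₂
  obtain ⟨e₁, h21, he₁⟩ := exists_dotProduct_eq_zero_notMem_span f₂ e₃ e₄
  have hdet : Matrix.det (Matrix.of ![e₁, e₂, e₃, e₄]) ≠ 0 := by
    intro h
    obtain ⟨t, ht, hM⟩ := Matrix.exists_vecMul_eq_zero_iff.2 h
    have hsum : t 0 • e₁ + t 1 • e₂ + t 2 • e₃ + t 3 • e₄ = 0 := by
      rw [← hM]
      ext i
      simp [Matrix.vecMul, dotProduct, Fin.sum_univ_four]
    have h1 : t 1 = 0 := by
      have := congrArg (f₂ ⬝ᵥ ·) hsum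
      simpa [h21, h23, h24, h22] using this
    rw [h1, zero_smul, add_zero] at hsum
    obtain ⟨h0, h2, h3⟩ := eq_zero_of_comb_eq_zero h34 he₁ hsum
    exact ht (by ext i; fin_cases i <;> assumption)
  have hne3 : e₃ ≠ 0 := h34.ne_zero 0
  have hne4 : e₄ ≠ 0 := h34.ne_zero 1
  have hpl : plucker (-e₄) e₃ = plucker e₃ e₄ := by
    ext i; fin_cases i <;> simp [plucker] <;> ring
  have hind3 : ∀ e ∉ Submodule.span K {e₃, e₄}, ∀ x y z : K, x • e + y • -e₄ + z • e₃ = 0 →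
      x = 0 ∧ y = 0 ∧ z = 0 := fun e he x y z h => by
    obtain ⟨hx, hz, hy⟩ := eq_zero_of_comb_eq_zero (x := x) (y := z) (z := -y) h34 he
      (by rw [← h]; module)
    exact ⟨hx, neg_eq_zero.1 hy, hz⟩
  have hind4 : ∀ e ∉ Submodule.span K {e₃, e₄}, ∀ x y z : K, x • e + y • e₃ + z • e₄ = 0 →
      x = 0 ∧ y = 0 ∧ z = 0 := fun e he x y z h => eq_zero_of_comb_eq_zero h34 he h
  have hbase3 : ∀ e ∉ Submodule.span K {e₃, e₄}, ∀ f : Fin 4 → K, f ⬝ᵥ e = 0 → f ⬝ᵥ e₃ = 0 →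
      f ⬝ᵥ e₄ = 0 → (∀ y ∈ Y, ¬ lineOf y ⊆ hyp f) → ∀ x ∈ Y,
      x ∈ hyp (orthVec (plucker e₃ e₄)) → x ∉ hyp (orthVec (plucker e e₃)) := by
    intro e he f hfe hf3 hf4 hno x hx h1 h2
    rw [← hpl] at h1
    rcases subset_hyp_or_mem_of_mem_pencil (hind3 e he) hfe (by simpa using hf4) hf3 hne3
      (hYS hx).1 h2 h1 with h | h
    · exact hno x hx h
    · exact h3S hne3 ((hYS hx).2 h)
  have hbase4 : ∀ e ∉ Submodule.span K {e₃, e₄}, ∀ f : Fin 4 → K, f ⬝ᵥ e = 0 → f ⬝ᵥ e₃ = 0 →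
      f ⬝ᵥ e₄ = 0 → (∀ y ∈ Y, ¬ lineOf y ⊆ hyp f) → ∀ x ∈ Y,
      x ∈ hyp (orthVec (plucker e₃ e₄)) → x ∉ hyp (orthVec (plucker e e₄)) := by
    intro e he f hfe hf3 hf4 hno x hx h1 h2
    rcases subset_hyp_or_mem_of_mem_pencil (hind4 e he) hfe hf3 hf4 hne4
      (hYS hx).1 h2 h1 with h | h
    · exact hno x hx h
    · exact h4S hne4 ((hYS hx).2 h)
  refine ncard_inter_hyp_le hY (φ := orthVec (plucker e₃ e₄))
    (l := ![orthVec (plucker e₂ e₄), orthVec (plucker e₂ e₃), orthVec (plucker e₁ e₄),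
      orthVec (plucker e₁ e₃)]) ?_ ?_ ?_ hη ?_
  · intro i
    fin_cases i
    · exact hbase4 e₂ he₂ f₁ h12 h13 h14 hno₁
    · exact hbase3 e₂ he₂ f₁ h12 h13 h14 hno₁
    · exact hbase4 e₁ he₁ f₂ h21 h23 h24 hno₂
    · exact hbase3 e₁ he₁ f₂ h21 h23 h24 hno₂
  · intro j
    refine ⟨C (Matrix.det (Matrix.of ![e₁, e₂, e₃, e₄]))⁻¹ * (C (plucker e₁ e₂ j) -
      X 0 * C (plucker e₁ e₃ j) + X 1 * C (plucker e₁ e₄ j) + X 2 * C (plucker e₂ e₃ j) -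
      X 3 * C (plucker e₂ e₄ j) + (X 0 * X 3 - X 1 * X 2) * C (plucker e₃ e₄ j)), ?_⟩
    rintro w ⟨⟨hw0, hwY⟩, hw1⟩
    have hq : plQuad w = 0 := (mk_mem_grass_iff hw0).1 (hYS hwY).1
    have e1 := det_mul_eq_sum_plPair e₁ e₂ e₃ e₄ w j
    have e2 := det_mul_plQuad e₁ e₂ e₃ e₄ w
    rw [sum_orthVec] at hw1
    rw [hw1] at e1 e2
    rw [hq, mul_zero] at e2
    simp only [map_mul, map_add, map_sub, eval_C, eval_X, Matrix.cons_val, sum_orthVec]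
    rw [eq_inv_mul_iff_mul_eq₀ hdet, e1]
    linear_combination (-plucker e₃ e₄ j) * e2
  · intro i
    fin_cases i
    · exact exists_pencil_bound hdeg hYS huniq hTS (hind4 e₂ he₂) h12 h13 h14 hfin₁ hne4 (h4S _)
    · have h := exists_pencil_bound hdeg hYS huniq hTS (hind3 e₂ he₂) h12
        (by simpa using h14) h13 hfin₁ hne3 (h3S _)
      simp only [hpl] at h
      exact h
    · exact exists_pencil_bound hdeg hYS huniq hTS (hind4 e₁ he₁) h21 h23 h24 hfin₂ hne4 (h4S _)
    · have h := exists_pencil_bound hdeg hYS huniq hTS (hind3 e₁ he₁) h21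
        (by simpa using h24) h23 hfin₂ hne3 (h3S _)
      simp only [hpl] at h
      exact h
  · intro x hx hxη h
    have hline := isLineRep_plucker h34
    obtain ⟨p, hp, hpx⟩ := (mem_hyp_orthVec_iff hline (hYS hx).1).1 h
    exact hTm p ⟨(hYS hx).2 hpx, Or.inr (Set.mem_biUnion (x := x) ⟨hx, hxη⟩ hpx)⟩
      ((mem_lineOf_mk_plucker_iff_mem_span hline.1).1 hp)

theorem not_subset_sigma2_of_skew {Y : Set (PP K 6)} (hskew : ∃ x ∈ Y, ∃ y ∈ Y, y ∉ polar x)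
    (p : PP K 4) : ¬ Y ⊆ sigma2 p := by
  intro h
  obtain ⟨x, hx, y, hy, hxy⟩ := hskew
  exact hxy ((mem_polar_iff_meet (h hx).1 (h hy).1).2 ⟨p, (h hx).2, (h hy).2⟩)

theorem hasCurveDeg_ruling [IsAlgClosed K] {S : Set (PP K 4)} {Y : Set (PP K 6)} {d : ℕ}
    (hruled : IsRuled S) (hdeg : HasSurfDeg S d) (hYS : Y ⊆ linesOf S) (hY : IsMinimalInfinite Y)
    (hfin : (linesOf S \ Y).Finite) (hsweep : sweep Y = S)
    (hskew : ∃ x ∈ Y, ∃ y ∈ Y, y ∉ polar x) : HasCurveDeg Y d := by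
  have : Infinite K := IsAlgClosed.instInfinite
  have hle {η : Fin 6 → K} (hη : ¬ Y ⊆ hyp η) : (Y ∩ hyp η).Finite ∧ (Y ∩ hyp η).ncard ≤ d :=
    ⟨hY.finite_inter (zClosed_hyp η) hη,
      ncard_ruling_inter_hyp_le hruled hdeg hYS hY hfin hsweep hskew hη⟩
  obtain ⟨l, hl, hlS, hlc⟩ := hdeg.exists_line
  have hYl : ¬ Y ⊆ polar l := by
    intro h
    obtain ⟨s, -, hs⟩ :=
      exists_subset_sigma2_of_subset_polar hYS hY.zIrred hl (hdeg.finite_inter hl hlS).1 h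
    exact not_subset_sigma2_of_skew hskew s hs
  refine ⟨fun φ _ h => hle h, orthVec l.rep, orthVec_ne_zero l.rep_nonzero, hYl,
    le_antisymm (hle hYl).2 ?_⟩
  have hex : ∀ s : PP K 4, s ∈ S → ∃ y ∈ Y, s ∈ lineOf y := fun s hs => by
    rwa [← hsweep] at hs
  choose! g hgY hg using hex
  rw [← hlc]
  refine Set.ncard_le_ncard_of_injOn g
    (fun s hs => ⟨hgY s hs.1, (mem_polar_iff_meet hl (hYS (hgY s hs.1)).1).2 ⟨s, hs.2, hg s hs.1⟩⟩)
    (fun s hs t ht hst => ?_) (hle hYl).1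
  by_contra hne
  have hlg : l = g s := eq_of_mem_lineOf hl (hYS (hgY s hs.1)).1 hne hs.2 ht.2 (hg s hs.1)
    (hst ▸ hg t ht.1)
  exact hlS (hlg ▸ (hYS (hgY s hs.1)).2)

/-! STATEMENT 2: the set of lines on a ruled surface of degree `d ≥ 3` (not a cone) is
Zariski closed and is the union of one irreducible curve of degree `d` (not contained in
any `σ₂(p₀)`) and a finite set; through a general point of `S` there is exactly one line. -/

theorem statement_2 (K : Type) [Field K] [IsAlgClosed K]
    (S : Set (PP K 4)) (d : ℕ) (hd : 3 ≤ d)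
    (hruled : IsRuled S) (hdeg : HasSurfDeg S d) (hcone : ¬ IsCone S) :
    ZClosed (linesOf S) ∧
    (∃ C F : Set (PP K 6),
      linesOf S = C ∪ F ∧ F.Finite ∧
      ZClosed C ∧ ZIrred C ∧ HasDim C 1 ∧ HasCurveDeg C d ∧
      (∀ p₀ : PP K 4, ¬ C ⊆ sigma2 p₀)) ∧
    GenericPts S (fun p => ({x ∈ linesOf S | p ∈ lineOf x}).ncard = 1) := by
  have : Infinite K := IsAlgClosed.instInfinite
  obtain ⟨Y, hYS, hY, hfin, hsweep, hskew⟩ := exists_ruling hd hruled hdeg hcone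
  refine ⟨zClosed_linesOf hruled.1, ⟨Y, linesOf S \ Y, ?_, hfin, hY.1, hY.zIrred, hY.hasDim,
    hasCurveDeg_ruling hruled hdeg hYS hY hfin hsweep hskew, not_subset_sigma2_of_skew hskew⟩, ?_⟩
  · exact (Set.union_sdiff_cancel hYS).symm
  · obtain ⟨T, hT, hST, huniq⟩ := exists_unique_line hruled.2.1 hYS hY hfin hsweep hskew
    refine ⟨T, hT, hST, fun p hp hpT => ?_⟩
    obtain ⟨x, hx, hxu⟩ := huniq p hp hpT
    exact Set.ncard_eq_one.2 ⟨x, Set.eq_singleton_iff_unique_mem.2 ⟨hx, hxu⟩⟩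

end RQS
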